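/- Any homeomorphism between two σ-graphs in the sphere S² = ℝ² ∪ {∞} can be extended to a homeomorphism of the sphere. -/

import Mathlib

open scoped Topology

/-- The model σ-graph: the unit circle together with the segment `[1,2] × {0}` in `ℝ²`. -/
def sigmaModel : Set (ℝ × ℝ) :=
  (Metric.sphere ((0 : ℝ), (0 : ℝ)) 1) ∪ (Set.Icc (1 : ℝ) 2 ×ˢ ({0} : Set ℝ))

namespace Sig

open Set Topology Filter Metric

/-- `f` has a continuous logarithm on `K`. -/
def HasLog {X : Type*} [TopologicalSpace X] (f : X → ℂ) (K : Set X) : Prop :=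
  ∃ φ : X → ℂ, ContinuousOn φ K ∧ ∀ z ∈ K, Complex.exp (φ z) = f z

section logs
variable {X : Type*} [TopologicalSpace X]

lemma HasLog.mono {f : X → ℂ} {K L : Set X} (h : HasLog f K) (hLK : L ⊆ K) : HasLog f L := by
  obtain ⟨φ, h1, h2⟩ := h
  exact ⟨φ, h1.mono hLK, fun z hz => h2 z (hLK hz)⟩

lemma HasLog.congr {f g : X → ℂ} {K : Set X} (h : HasLog f K) (hfg : ∀ z ∈ K, f z = g z) :
    HasLog g K := by
  obtain ⟨φ, h1, h2⟩ := h
  exact ⟨φ, h1, fun z hz => (h2 z hz).trans (hfg z hz)⟩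

lemma HasLog.mul {f g : X → ℂ} {K : Set X} (h : HasLog f K) (h' : HasLog g K) :
    HasLog (fun z => f z * g z) K := by
  obtain ⟨φ, h1, h2⟩ := h
  obtain ⟨ψ, h3, h4⟩ := h'
  exact ⟨fun z => φ z + ψ z, h1.add h3, fun z hz => by rw [Complex.exp_add, h2 z hz, h4 z hz]⟩

lemma HasLog.inv {f : X → ℂ} {K : Set X} (h : HasLog f K) :
    HasLog (fun z => (f z)⁻¹) K := by
  obtain ⟨φ, h1, h2⟩ := h
  exact ⟨fun z => - φ z, h1.neg, fun z hz => by rw [Complex.exp_neg, h2 z hz]⟩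

lemma HasLog.comp {Y : Type*} [TopologicalSpace Y] {f : X → ℂ} {K : Set X} (h : HasLog f K)
    {g : Y → X} {L : Set Y} (hg : ContinuousOn g L) (hm : MapsTo g L K) :
    HasLog (fun z => f (g z)) L := by
  obtain ⟨φ, h1, h2⟩ := h
  exact ⟨fun z => φ (g z), h1.comp hg hm, fun z hz => h2 _ (hm hz)⟩

lemma hasLog_const (c : ℂ) (hc : c ≠ 0) (K : Set X) : HasLog (fun _ => c) K :=
  ⟨fun _ => Complex.log c, continuousOn_const, fun _ _ => Complex.exp_log hc⟩

lemma HasLog.ne_zero {f : X → ℂ} {K : Set X} (h : HasLog f K) {z : X} (hz : z ∈ K) : f z ≠ 0 := by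
  obtain ⟨φ, h1, h2⟩ := h
  rw [← h2 z hz]; exact Complex.exp_ne_zero _

lemma hasLog_near_one {f : X → ℂ} {K : Set X} (hf : ContinuousOn f K)
    (h : ∀ z ∈ K, ‖f z - 1‖ < 1) : HasLog f K := by
  have hs : ∀ z ∈ K, f z ∈ Complex.slitPlane := by
    intro z hz
    left
    have h1 := h z hz
    have h2 := Complex.abs_re_le_norm (f z - 1)
    simp only [Complex.sub_re, Complex.one_re] at h2
    have := abs_lt.1 (h2.trans_lt h1)
    linarith [this.1]
  refine ⟨fun z => Complex.log (f z), hf.clog hs, fun z hz => Complex.exp_log ?_⟩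
  exact Complex.slitPlane_ne_zero (hs z hz)

/-- Homotopy lifting for logarithms. -/
lemma hasLog_homotopy {K : Set X} (H : unitInterval × X → ℂ)
    (hc : ContinuousOn H (univ ×ˢ K)) (hne : ∀ t, ∀ z ∈ K, H (t, z) ≠ 0)
    (h0 : HasLog (fun z => H (0, z)) K) : HasLog (fun z => H (1, z)) K := by
  classical
  obtain ⟨φ, h1, h2⟩ := h0
  let H' : C(unitInterval × K, {z : ℂ // z ≠ 0}) :=
    ⟨fun p => ⟨H (p.1, p.2), hne _ _ p.2.2⟩, by
      refine Continuous.subtype_mk ?_ _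
      refine hc.comp_continuous (by fun_prop) (fun p => ⟨mem_univ _, p.2.2⟩)⟩
  let f' : C(K, ℂ) := ⟨fun z => φ z, continuousOn_iff_continuous_restrict.1 h1⟩
  have e : ∀ a : K, H' (0, a) = (fun z : ℂ ↦ (⟨_, z.exp_ne_zero⟩ : {z : ℂ // z ≠ 0})) (f' a) := by
    intro a
    apply Subtype.ext
    exact (h2 a a.2).symm
  have L := Complex.isCoveringMap_exp.liftHomotopy_lifts H' f' e
  set G := Complex.isCoveringMap_exp.liftHomotopy H' f' e
  refine ⟨fun z => if hz : z ∈ K then G (1, ⟨z, hz⟩) else 0, ?_, ?_⟩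
  · rw [continuousOn_iff_continuous_restrict]
    have : K.domRestrict (fun z => if hz : z ∈ K then G (1, ⟨z, hz⟩) else 0) = fun z => G (1, z) := by
      ext z; simp [z.2]
    rw [this]; fun_prop
  · intro z hz
    simp only [hz, dif_pos]
    have := congrFun L (1, ⟨z, hz⟩)
    exact congrArg Subtype.val this

lemma hasLog_of_contr {E : Type*} [AddCommGroup E] [TopologicalSpace E] [Module ℝ E]
    [ContinuousSMul ℝ E] {K : Set E} {f : E → ℂ} (hs : ∀ z ∈ K, ∀ t : unitInterval, (t : ℝ) • z ∈ K)
    (hf : ContinuousOn f K) (hne : ∀ z ∈ K, f z ≠ 0) : HasLog f K := by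
  rcases K.eq_empty_or_nonempty with rfl | ⟨z0, hz0⟩
  · exact ⟨0, by simp, by simp⟩
  have := hasLog_homotopy (K := K) (fun p => f ((p.1 : ℝ) • p.2)) ?_ ?_ ?_
  · simpa using this
  · refine hf.comp (by fun_prop) ?_
    rintro ⟨t, z⟩ ⟨_, hz⟩
    exact hs z hz t
  · intro t z hz; exact hne _ (hs z hz t)
  · have : f 0 ≠ 0 := by
      have := hne _ (hs z0 hz0 0)
      simpa using this
    simpa using hasLog_const (f 0) this K

lemma exp_eq_on {K : Set X} (hK : IsPreconnected K) {φ ψ : X → ℂ} (hφ : ContinuousOn φ K)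
    (hψ : ContinuousOn ψ K) (h : ∀ z ∈ K, Complex.exp (φ z) = Complex.exp (ψ z)) :
    ∃ n : ℤ, ∀ z ∈ K, φ z = ψ z + n * (2 * Real.pi * Complex.I) := by
  rcases K.eq_empty_or_nonempty with rfl | ⟨z0, hz0⟩
  · exact ⟨0, by simp⟩
  obtain ⟨n, hn⟩ := Complex.exp_eq_exp_iff_exists_int.1 (h z0 hz0)
  refine ⟨n, ?_⟩
  have := Complex.isCoveringMap_exp.eqOn_of_comp_eqOn (s := K) (g₁ := φ)
    (g₂ := fun z => ψ z + n * (2 * Real.pi * Complex.I)) hK hφ (hψ.add continuousOn_const) ?_ hz0 hn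
  · exact this
  · intro z hz
    apply Subtype.ext
    simp only [Function.comp]
    rw [h z hz, Complex.exp_add, Complex.exp_int_mul_two_pi_mul_I, mul_one]

lemma hasLog_union_aux {f : X → ℂ} {K L : Set X} (hKL : IsPreconnected (K ∩ L))
    (hK : HasLog f K) (hL : HasLog f L) : ∃ φ : X → ℂ, ContinuousOn φ K ∧ ContinuousOn φ L ∧
    ∀ z ∈ K ∪ L, Complex.exp (φ z) = f z := by
  classical
  obtain ⟨φ, h1, h2⟩ := hK
  obtain ⟨ψ, h3, h4⟩ := hL
  obtain ⟨n, hn⟩ := exp_eq_on hKL (h1.mono inter_subset_left) (h3.mono inter_subset_right)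
    (fun z hz => by rw [h2 z hz.1, h4 z hz.2])
  let χ : X → ℂ := fun z => if z ∈ K then φ z else ψ z + n * (2 * Real.pi * Complex.I)
  have c1 : ∀ z ∈ K, χ z = φ z := fun z hz => by simp [χ, hz]
  have c2 : ∀ z ∈ L, χ z = ψ z + n * (2 * Real.pi * Complex.I) := fun z hz => by
    by_cases hzK : z ∈ K
    · simp only [χ, hzK, if_true]; exact hn z ⟨hzK, hz⟩
    · simp [χ, hzK]
  refine ⟨χ, h1.congr c1, (h3.add continuousOn_const).congr c2, ?_⟩
  rintro z (hz | hz)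
  · rw [c1 z hz, h2 z hz]
  · rw [c2 z hz, Complex.exp_add, Complex.exp_int_mul_two_pi_mul_I, mul_one, h4 z hz]

lemma hasLog_union {f : X → ℂ} {K L : Set X} (hKc : IsClosed K) (hLc : IsClosed L)
    (hKL : IsPreconnected (K ∩ L)) (hK : HasLog f K) (hL : HasLog f L) : HasLog f (K ∪ L) := by
  obtain ⟨φ, h1, h2, h3⟩ := hasLog_union_aux hKL hK hL
  exact ⟨φ, h1.union_of_isClosed h2 hKc hLc, h3⟩

lemma hasLog_union_open {f : X → ℂ} {K L : Set X} (hKc : IsOpen K) (hLc : IsOpen L)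
    (hKL : IsPreconnected (K ∩ L)) (hK : HasLog f K) (hL : HasLog f L) : HasLog f (K ∪ L) := by
  obtain ⟨φ, h1, h2, h3⟩ := hasLog_union_aux hKL hK hL
  exact ⟨φ, h1.union_continuousAt hKc (fun x hx => h2.continuousAt (hLc.mem_nhds hx)), h3⟩

lemma HasLog.zpow {f : X → ℂ} {K : Set X} (h : HasLog f K) (n : ℤ) :
    HasLog (fun z => (f z) ^ n) K := by
  obtain ⟨φ, h1, h2⟩ := h
  exact ⟨fun z => n * φ z, continuousOn_const.mul h1,
    fun z hz => by rw [Complex.exp_int_mul, h2 z hz]⟩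

end logs

/-- A power of `z - a` has no logarithm on a circle around `a`. -/
lemma not_hasLog_circle (a : ℂ) (R : ℝ) (hR : 0 < R) (m : ℤ) (hm : m ≠ 0) :
    ¬ HasLog (fun z => (z - a) ^ m) (sphere a R) := by
  intro h
  let g : ℝ → ℂ := fun t => a + R * Complex.exp (t * Complex.I)
  have hg : Continuous g := by fun_prop
  have hm' : MapsTo g univ (sphere a R) := by
    intro t _
    simp [g, Complex.norm_exp_ofReal_mul_I, abs_of_pos hR]
  obtain ⟨φ, h1, h2⟩ := h
  have hc : ContinuousOn (fun t => φ (g t)) univ := h1.comp hg.continuousOn hm'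
  have hR' : (R : ℂ) ≠ 0 := by exact_mod_cast hR.ne'
  obtain ⟨n, hn⟩ := exp_eq_on (K := (univ : Set ℝ)) isPreconnected_univ hc
    (ψ := fun t : ℝ => m * (Complex.log R + t * Complex.I)) (by fun_prop) (by
      intro t _
      rw [h2 _ (hm' (mem_univ t)), Complex.exp_int_mul, Complex.exp_add, Complex.exp_log hR']
      simp [g])
  have e0 := hn 0 (mem_univ _)
  have e1 := hn (2 * Real.pi) (mem_univ _)
  have : g (2 * Real.pi) = g 0 := by
    simp [g, Complex.exp_two_pi_mul_I]
  simp only [this, e0] at e1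
  push_cast at e1
  have h3 : (m : ℂ) * (2 * Real.pi * Complex.I) = 0 := by linear_combination -e1
  have h4 : (2 * (Real.pi : ℂ) * Complex.I) ≠ 0 := Complex.two_pi_I_ne_zero
  rcases mul_eq_zero.1 h3 with h | h
  · exact hm (by exact_mod_cast h)
  · exact h4 h

/-- Main separation criterion (hard direction). -/
lemma not_hasLog_of_bounded {K U : Set ℂ} (hK : IsClosed K) (hU : IsOpen U)
    (hUb : Bornology.IsBounded U) (hfr : frontier U ⊆ K) {a b : ℂ} (ha : a ∈ U) (hb : b ∉ U)
    (hbK : b ∉ K) (m n : ℤ) (hm : m ≠ 0) :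
    ¬ HasLog (fun z => (z - a) ^ m * (z - b) ^ n) K := by
  classical
  rintro ⟨φ, h1, h2⟩
  obtain ⟨Φ, hΦ⟩ := ContinuousMap.exists_restrict_eq hK
    (⟨fun z : K => φ z, continuousOn_iff_continuous_restrict.1 h1⟩ : C(K, ℂ))
  have hΦ' : ∀ z ∈ K, Φ z = φ z := fun z hz => by
    have := congrArg (fun g : C(K, ℂ) => g ⟨z, hz⟩) hΦ
    exact this
  have hcl : ∀ z ∈ closure U, z - b ≠ 0 := by
    intro z hz h
    have : z = b := sub_eq_zero.1 h
    subst this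
    by_cases hzU : z ∈ U
    · exact hb hzU
    · exact hbK (hfr ⟨hz, by rwa [hU.interior_eq]⟩)
  have hcl' : ∀ z ∈ closure Uᶜ, z - a ≠ 0 := by
    intro z hz h
    have : z = a := sub_eq_zero.1 h
    subst this
    rw [hU.isClosed_compl.closure_eq] at hz
    exact hz ha
  let F : ℂ → ℂ := U.piecewise (fun z => (z - b) ^ (-n) * Complex.exp (Φ z)) (fun z => (z - a) ^ m)
  have hF : ContinuousOn F univ := by
    apply ContinuousOn.piecewise
    · rintro z ⟨_, hz⟩
      have hzK := hfr hz
      have hzb : z - b ≠ 0 := hcl z hz.1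
      rw [hΦ' z hzK, h2 z hzK, zpow_neg]
      field_simp
    · refine ContinuousOn.mul (ContinuousOn.zpow₀ (by fun_prop) _ ?_) (by fun_prop)
      intro z hz; left; exact hcl z hz.2
    · refine ContinuousOn.zpow₀ (by fun_prop) _ ?_
      intro z hz; left; exact hcl' z hz.2
  have hF0 : ∀ z ∈ (univ : Set ℂ), F z ≠ 0 := by
    intro z _
    by_cases hz : z ∈ U
    · simp only [F, hz, piecewise_eq_of_mem]
      exact mul_ne_zero (zpow_ne_zero _ (hcl z (subset_closure hz))) (Complex.exp_ne_zero _)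
    · simp only [F, hz, not_false_iff, piecewise_eq_of_notMem]
      exact zpow_ne_zero _ (hcl' z (subset_closure hz))
  have hL : HasLog F univ := hasLog_of_contr (by simp) hF hF0
  obtain ⟨R, hR⟩ := hUb.subset_closedBall a
  have hR0 : 0 ≤ R := by simpa using hR ha
  refine not_hasLog_circle a (R + 1) (by linarith) m hm ((hL.mono (subset_univ _)).congr ?_)
  intro z hz
  have : z ∉ U := by
    intro h
    have h1 := hR h
    rw [mem_closedBall] at h1; rw [mem_sphere] at hz
    linarith
  simp [F, this]

/-- `a` and `b` are not separated by `K`. -/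
def Conn (K : Set ℂ) (a b : ℂ) : Prop := ∃ C, IsPreconnected C ∧ C ⊆ Kᶜ ∧ a ∈ C ∧ b ∈ C

/-- The union of bounded components of the complement. -/
def ins (K : Set ℂ) : Set ℂ := {x | x ∉ K ∧ Bornology.IsBounded (connectedComponentIn Kᶜ x)}

/-- The union of unbounded components of the complement. -/
def out (K : Set ℂ) : Set ℂ := {x | x ∉ K ∧ ¬ Bornology.IsBounded (connectedComponentIn Kᶜ x)}

lemma Conn.symm {K : Set ℂ} {a b : ℂ} (h : Conn K a b) : Conn K b a := by
  obtain ⟨C, h1, h2, h3, h4⟩ := h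
  exact ⟨C, h1, h2, h4, h3⟩

lemma Conn.trans {K : Set ℂ} {a b c : ℂ} (h : Conn K a b) (h' : Conn K b c) : Conn K a c := by
  obtain ⟨C, h1, h2, h3, h4⟩ := h
  obtain ⟨D, h5, h6, h7, h8⟩ := h'
  exact ⟨C ∪ D, h1.union b h4 h7 h5, union_subset h2 h6, Or.inl h3, Or.inr h8⟩

lemma Conn.mono {K L : Set ℂ} (hKL : K ⊆ L) {a b : ℂ} (h : Conn L a b) : Conn K a b := by
  obtain ⟨C, h1, h2, h3, h4⟩ := h
  exact ⟨C, h1, h2.trans (compl_subset_compl.2 hKL), h3, h4⟩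

lemma conn_refl {K : Set ℂ} {a : ℂ} (h : a ∉ K) : Conn K a a :=
  ⟨{a}, isPreconnected_singleton, by simpa using h, rfl, rfl⟩

lemma Conn.notMem_left {K : Set ℂ} {a b : ℂ} (h : Conn K a b) : a ∉ K := by
  obtain ⟨C, h1, h2, h3, h4⟩ := h
  exact h2 h3

lemma Conn.mem {K : Set ℂ} {a b : ℂ} (h : Conn K a b) : b ∈ connectedComponentIn Kᶜ a := by
  obtain ⟨C, h1, h2, h3, h4⟩ := h
  exact h1.subset_connectedComponentIn h3 h2 h4

lemma conn_of_mem {K : Set ℂ} {a b : ℂ} (ha : a ∉ K) (h : b ∈ connectedComponentIn Kᶜ a) :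
    Conn K a b :=
  ⟨_, isPreconnected_connectedComponentIn, connectedComponentIn_subset _ _,
    mem_connectedComponentIn ha, h⟩

lemma Conn.comp_eq {K : Set ℂ} {a b : ℂ} (h : Conn K a b) :
    connectedComponentIn Kᶜ a = connectedComponentIn Kᶜ b :=
  connectedComponentIn_eq h.mem

lemma Conn.ins {K : Set ℂ} {a b : ℂ} (h : Conn K a b) (ha : a ∈ ins K) : b ∈ ins K :=
  ⟨h.symm.notMem_left, h.comp_eq ▸ ha.2⟩

lemma Conn.out {K : Set ℂ} {a b : ℂ} (h : Conn K a b) (ha : a ∈ out K) : b ∈ out K :=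
  ⟨h.symm.notMem_left, h.comp_eq ▸ ha.2⟩

lemma ins_or_out {K : Set ℂ} {a : ℂ} (h : a ∉ K) : a ∈ ins K ∨ a ∈ out K := by
  by_cases hb : Bornology.IsBounded (connectedComponentIn Kᶜ a)
  · exact Or.inl ⟨h, hb⟩
  · exact Or.inr ⟨h, hb⟩

lemma not_ins_out {K : Set ℂ} {a : ℂ} (h : a ∈ ins K) (h' : a ∈ out K) : False := h'.2 h.2

lemma conn_near {K : Set ℂ} (hK : IsClosed K) {a : ℂ} (h : a ∉ K) : ∀ᶠ b in 𝓝 a, Conn K a b := by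
  have : connectedComponentIn Kᶜ a ∈ 𝓝 a :=
    (hK.isOpen_compl.connectedComponentIn).mem_nhds (mem_connectedComponentIn h)
  filter_upwards [this] with b hb
  exact conn_of_mem h hb

lemma isOpen_ins {K : Set ℂ} (hK : IsClosed K) : IsOpen (ins K) := by
  rw [isOpen_iff_mem_nhds]
  intro a ha
  filter_upwards [conn_near hK ha.1] with b hb
  exact hb.ins ha

lemma isOpen_out {K : Set ℂ} (hK : IsClosed K) : IsOpen (out K) := by
  rw [isOpen_iff_mem_nhds]
  intro a ha
  filter_upwards [conn_near hK ha.1] with b hb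
  exact hb.out ha

lemma isPreconnected_compl_closedBall' (R : ℝ) : IsPreconnected ((closedBall (0 : ℂ) R)ᶜ) := by
  rcases lt_or_ge R 0 with h | h
  · rw [closedBall_eq_empty.2 h, compl_empty]; exact isPreconnected_univ
  have : (closedBall (0 : ℂ) R)ᶜ =
      (fun p : ℝ × ℝ => (p.1 : ℂ) * Complex.exp (p.2 * Complex.I)) '' (Ioi R ×ˢ univ) := by
    ext z
    simp only [mem_compl_iff, mem_closedBall, dist_zero_right, not_le, mem_image, mem_prod, mem_Ioi,
      mem_univ, and_true, Prod.exists]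
    constructor
    · intro hz
      exact ⟨‖z‖, z.arg, hz, Complex.norm_mul_exp_arg_mul_I z⟩
    · rintro ⟨r, t, hr, rfl⟩
      simp [Complex.norm_exp_ofReal_mul_I]
      exact hr.trans_le (le_abs_self _)
  rw [this]
  exact (isPreconnected_Ioi.prod isPreconnected_univ).image _ (by fun_prop)

lemma exists_far {K : Set ℂ} (hK : IsCompact K) : ∃ R : ℝ, 0 < R ∧ K ⊆ closedBall 0 R ∧
    (closedBall (0 : ℂ) R)ᶜ ⊆ out K := by
  obtain ⟨R, hR⟩ := hK.isBounded.subset_closedBall 0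
  have hR' : K ⊆ closedBall 0 (max R 1) := hR.trans (closedBall_subset_closedBall (le_max_left _ _))
  refine ⟨max R 1, lt_max_of_lt_right one_pos, hR', fun z hz => ⟨fun h => hz (hR' h), fun hb => ?_⟩⟩
  have h1 : (closedBall (0 : ℂ) (max R 1))ᶜ ⊆ connectedComponentIn Kᶜ z :=
    (isPreconnected_compl_closedBall' _).subset_connectedComponentIn hz (compl_subset_compl.2 hR')
  have h2 := (hb.subset h1).union (isBounded_closedBall (x := (0 : ℂ)) (r := max R 1))
  rw [compl_union_self] at h2
  exact NoncompactSpace.noncompact_univ (X := ℂ) (isCompact_of_isClosed_isBounded isClosed_univ h2)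

lemma exists_far_conn {K : Set ℂ} {a : ℂ} (ha : a ∈ out K) (R : ℝ) :
    ∃ b ∈ (closedBall (0 : ℂ) R)ᶜ, Conn K a b := by
  by_contra hcon
  push Not at hcon
  apply ha.2
  refine (isBounded_closedBall (x := (0 : ℂ)) (r := R)).subset ?_
  intro b hb
  by_contra hb'
  exact hcon b hb' (conn_of_mem ha.1 hb)

lemma out_conn {K : Set ℂ} (hK : IsCompact K) {a b : ℂ} (ha : a ∈ out K) (hb : b ∈ out K) :
    Conn K a b := by
  obtain ⟨R, hR, hKR, hR'⟩ := exists_far hK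
  obtain ⟨a', ha', haa⟩ := exists_far_conn ha R
  obtain ⟨b', hb', hbb⟩ := exists_far_conn hb R
  exact haa.trans (Conn.trans ⟨_, isPreconnected_compl_closedBall' R, compl_subset_compl.2 hKR,
    ha', hb'⟩ hbb.symm)

lemma isPreconnected_of_conn {K S : Set ℂ} (h : ∀ a ∈ S, ∀ b ∈ S, Conn K a b)
    (h' : ∀ a b, Conn K a b → a ∈ S → b ∈ S) : IsPreconnected S := by
  rcases S.eq_empty_or_nonempty with rfl | ⟨a, ha⟩
  · exact isPreconnected_empty
  have haK := (h a ha a ha).notMem_left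
  have : S = connectedComponentIn Kᶜ a := by
    apply Subset.antisymm
    · intro b hb; exact (h a ha b hb).mem
    · intro b hb; exact h' a b (conn_of_mem haK hb) ha
  rw [this]; exact isPreconnected_connectedComponentIn

lemma isPreconnected_out {K : Set ℂ} (hK : IsCompact K) : IsPreconnected (out K) :=
  isPreconnected_of_conn (fun _ ha _ hb => out_conn hK ha hb) (fun _ _ h ha => h.out ha)

lemma ins_bounded {K : Set ℂ} (hK : IsCompact K) : Bornology.IsBounded (ins K) := by
  obtain ⟨R, hR, hKR, hR'⟩ := exists_far hK
  refine (isBounded_closedBall (x := (0 : ℂ)) (r := R)).subset ?_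
  intro z hz
  by_contra h
  exact not_ins_out hz (hR' h)

lemma closure_sub {K S : Set ℂ} (hK : IsClosed K)
    (h' : ∀ a b, Conn K a b → a ∈ S → b ∈ S) : closure S ⊆ S ∪ K := by
  intro z hz
  by_cases hzK : z ∈ K
  · exact Or.inr hzK
  left
  rw [mem_closure_iff_frequently] at hz
  obtain ⟨b, hb1, hb2⟩ := (hz.and_eventually (conn_near hK hzK)).exists
  exact h' _ _ hb2.symm hb1

lemma frontier_ins {K : Set ℂ} (hK : IsClosed K) : frontier (ins K) ⊆ K := by
  intro z hz
  rcases closure_sub hK (fun _ _ h ha => h.ins ha) hz.1 with h | h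
  · exact absurd h (by have := hz.2; rwa [(isOpen_ins hK).interior_eq] at this)
  · exact h

lemma hasLog_of_conn {K : Set ℂ} (hK : IsCompact K) {a b : ℂ} (h : Conn K a b) :
    HasLog (fun z => (z - a) * (z - b)⁻¹) K := by
  obtain ⟨C, h1, h2, h3, h4⟩ := h
  have hne : ∀ x ∈ C, ∀ z ∈ K, z - x ≠ 0 := by
    intro x hx z hz h
    rw [sub_eq_zero.1 h] at hz
    exact h2 hx hz
  let P : ℂ → ℂ → Prop := fun a b => a ∈ C → b ∈ C → HasLog (fun z => (z - a) * (z - b)⁻¹) K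
  refine h1.induction₂' (fun a b => HasLog (fun z => (z - a) * (z - b)⁻¹) K) ?_ ?_ h3 h4
  · intro x hx
    obtain ⟨ε, hε, hball⟩ := Metric.isOpen_iff.1 hK.isClosed.isOpen_compl x (h2 hx)
    have : ball x ε ∈ 𝓝 x := ball_mem_nhds x hε
    filter_upwards [mem_nhdsWithin_of_mem_nhds this, self_mem_nhdsWithin] with y hy hyC
    have key : HasLog (fun z => (z - y) * (z - x)⁻¹) K := by
      apply hasLog_near_one
      · apply ContinuousOn.mul (by fun_prop)
        exact ContinuousOn.inv₀ (by fun_prop) (fun z hz => hne x hx z hz)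
      · intro z hz
        have hzx := hne x hx z hz
        have : (z - y) * (z - x)⁻¹ - 1 = (x - y) * (z - x)⁻¹ := by field_simp; ring
        rw [this, norm_mul, norm_inv, ← div_eq_mul_inv, div_lt_one (norm_pos_iff.2 hzx)]
        rw [mem_ball, dist_comm, dist_eq_norm] at hy
        refine hy.trans_le ?_
        by_contra hlt
        push Not at hlt
        have : z ∈ ball x ε := by rwa [mem_ball, dist_eq_norm]
        exact hball this hz
    refine ⟨key.inv.congr ?_, key⟩
    intro z hz
    rw [mul_inv, inv_inv, mul_comm]
  · intro x y w hx hy hw hxy hyw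
    refine (hxy.mul hyw).congr fun z hz => ?_
    have := hne y hy z hz
    field_simp

lemma hasLog_of_out {K : Set ℂ} (hK : IsCompact K) {a : ℂ} (h : a ∈ out K) :
    HasLog (fun z => z - a) K := by
  obtain ⟨R, hR, hKR, hR'⟩ := exists_far hK
  obtain ⟨b, hb, hab⟩ := exists_far_conn h R
  have hb' : R < ‖b‖ := by simpa using hb
  have hb0 : b ≠ 0 := by rintro rfl; simp at hb'; linarith
  have h1 : HasLog (fun z => 1 - z / b) K := by
    apply hasLog_near_one (by fun_prop)
    intro z hz
    have := hKR hz
    rw [mem_closedBall, dist_zero_right] at this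
    rw [sub_sub_cancel_left, norm_neg, norm_div, div_lt_one (by linarith)]
    linarith
  refine ((hasLog_of_conn hK hab).mul ((hasLog_const (-b) (neg_ne_zero.2 hb0) K).mul h1)).congr ?_
  intro z hz
  have : z - b ≠ 0 := by
    intro h
    rw [sub_eq_zero.1 h] at hz
    exact hb (hKR hz)
  field_simp
  ring

lemma out_of_hasLog {K : Set ℂ} (hK : IsCompact K) {a : ℂ} (ha : a ∉ K)
    (h : HasLog (fun z => z - a) K) : a ∈ out K := by
  refine (ins_or_out ha).resolve_left fun hi => ?_
  obtain ⟨R, hR, hKR, hR'⟩ := exists_far hK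
  have hfar : ((R + 1 : ℝ) : ℂ) ∈ out K := hR' (by
    simp only [mem_compl_iff, mem_closedBall, dist_zero_right, Complex.norm_real, not_le,
      Real.norm_eq_abs]
    exact (lt_add_one R).trans_le (le_abs_self _))
  refine not_hasLog_of_bounded hK.isClosed (isOpen_ins hK.isClosed) (ins_bounded hK)
    (frontier_ins hK.isClosed) hi (fun h => not_ins_out h hfar) hfar.1 1 0 one_ne_zero ?_
  simpa using h

/-- The component of a point in the inside. -/
lemma comp_facts {K : Set ℂ} (hK : IsCompact K) {a : ℂ} (ha : a ∈ ins K) :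
    IsOpen (connectedComponentIn Kᶜ a) ∧ frontier (connectedComponentIn Kᶜ a) ⊆ K := by
  have ho : IsOpen (connectedComponentIn Kᶜ a) := hK.isClosed.isOpen_compl.connectedComponentIn
  refine ⟨ho, fun z hz => ?_⟩
  rcases closure_sub (S := connectedComponentIn Kᶜ a) hK.isClosed (fun x y h hx =>
    ((conn_of_mem ha.1 hx).trans h).mem) hz.1 with h | h
  · exact absurd h (by have := hz.2; rwa [ho.interior_eq] at this)
  · exact h

lemma conn_of_zpow {K : Set ℂ} (hK : IsCompact K) {a b : ℂ} (ha : a ∈ ins K) (hb : b ∉ K)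
    {m n : ℤ} (hm : m ≠ 0) (h : HasLog (fun z => (z - a) ^ m * (z - b) ^ n) K) : Conn K a b := by
  by_contra hcon
  obtain ⟨h1, h2⟩ := comp_facts hK ha
  exact not_hasLog_of_bounded hK.isClosed h1 ha.2 h2 (mem_connectedComponentIn ha.1)
    (fun h => hcon (conn_of_mem ha.1 h)) hb m n hm h

lemma conn_of_hasLog {K : Set ℂ} (hK : IsCompact K) {a b : ℂ} (ha : a ∉ K) (hb : b ∉ K)
    (h : HasLog (fun z => (z - a) * (z - b)⁻¹) K) : Conn K a b := by
  rcases ins_or_out ha with hi | ho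
  · exact conn_of_zpow hK hi hb (m := 1) (n := -1) one_ne_zero (by simpa using h)
  rcases ins_or_out hb with hi' | ho'
  · refine (conn_of_zpow hK hi' ha (m := 1) (n := -1) one_ne_zero (h.inv.congr ?_)).symm
    intro z hz
    simp [mul_comm]
  · exact out_conn hK ho ho'

lemma janiszewski {K L : Set ℂ} (hK : IsCompact K) (hL : IsCompact L)
    (hKL : IsPreconnected (K ∩ L)) {a b : ℂ} (h1 : Conn K a b) (h2 : Conn L a b) :
    Conn (K ∪ L) a b := by
  refine conn_of_hasLog (hK.union hL) ?_ ?_ (hasLog_union hK.isClosed hL.isClosed hKL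
    (hasLog_of_conn hK h1) (hasLog_of_conn hL h2))
  · rintro (h | h)
    · exact h1.notMem_left h
    · exact h2.notMem_left h
  · rintro (h | h)
    · exact h1.symm.notMem_left h
    · exact h2.symm.notMem_left h

lemma janiszewski_out {K L : Set ℂ} (hK : IsCompact K) (hL : IsCompact L)
    (hKL : IsPreconnected (K ∩ L)) {a : ℂ} (h1 : a ∈ out K) (h2 : a ∈ out L) :
    a ∈ out (K ∪ L) := by
  refine out_of_hasLog (hK.union hL) ?_ (hasLog_union hK.isClosed hL.isClosed hKL
    (hasLog_of_out hK h1) (hasLog_of_out hL h2))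
  rintro (h | h)
  · exact h1.1 h
  · exact h2.1 h

section arcs
variable {X Y : Type*} [TopologicalSpace X] [TopologicalSpace Y]

lemma continuousOn_invFunOn [T2Space Y] [Nonempty X] {K : Set X} (hK : IsCompact K) {γ : X → Y}
    (hc : ContinuousOn γ K) (hi : InjOn γ K) :
    ContinuousOn (Function.invFunOn γ K) (γ '' K) := by
  rw [continuousOn_iff_isClosed]
  intro T hT
  refine ⟨γ '' (K ∩ T), ((hK.inter_right hT).image_of_continuousOn (hc.mono inter_subset_left)).isClosed, ?_⟩
  ext y
  constructor
  · rintro ⟨hy, x, hx, rfl⟩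
    refine ⟨⟨x, ⟨hx, ?_⟩, rfl⟩, x, hx, rfl⟩
    have : Function.invFunOn γ K (γ x) = x := hi.leftInvOn_invFunOn hx
    simpa [this] using hy
  · rintro ⟨⟨x, ⟨hx, hxT⟩, rfl⟩, -⟩
    refine ⟨?_, x, hx, rfl⟩
    have : Function.invFunOn γ K (γ x) = x := hi.leftInvOn_invFunOn hx
    simpa [this] using hxT

/-- `A` is an arc from `p` to `q`. -/
def IsArc (A : Set X) (p q : X) : Prop :=
  ∃ γ : ℝ → X, ContinuousOn γ (Icc 0 1) ∧ InjOn γ (Icc 0 1) ∧ γ 0 = p ∧ γ 1 = q ∧ γ '' Icc 0 1 = A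

/-- `J` is a simple closed curve. -/
def IsJordan (J : Set X) : Prop :=
  ∃ γ : ℝ → X, Continuous γ ∧ Function.Periodic γ 1 ∧ InjOn γ (Ico 0 1) ∧ range γ = J

lemma isArc_of_Icc {γ : ℝ → X} {a b : ℝ} (hab : a < b) (hc : ContinuousOn γ (Icc a b))
    (hi : InjOn γ (Icc a b)) : IsArc (γ '' Icc a b) (γ a) (γ b) := by
  have hm : MapsTo (fun t : ℝ => a + t * (b - a)) (Icc 0 1) (Icc a b) := by
    intro t ht
    have h1 := ht.1
    have h2 := ht.2
    constructor <;> nlinarith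
  refine ⟨fun t => γ (a + t * (b - a)), hc.comp (by fun_prop) hm, ?_, by simp, by simp, ?_⟩
  · intro s hs t ht h
    have := hi (hm hs) (hm ht) h
    have h2 : s * (b - a) = t * (b - a) := by linarith
    exact mul_right_cancel₀ (by linarith : b - a ≠ 0) h2
  · apply Subset.antisymm
    · rintro _ ⟨t, ht, rfl⟩
      exact ⟨_, hm ht, rfl⟩
    · rintro _ ⟨t, ht, rfl⟩
      refine ⟨(t - a) / (b - a), ⟨div_nonneg (by linarith [ht.1]) (by linarith), ?_⟩, ?_⟩
      · rw [div_le_one (by linarith)]; linarith [ht.2]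
      · have : b - a ≠ 0 := by linarith
        simp only; congr 1; field_simp; ring

lemma IsArc.symm {A : Set X} {p q : X} (h : IsArc A p q) : IsArc A q p := by
  obtain ⟨γ, hc, hi, h0, h1, rfl⟩ := h
  have hm : MapsTo (fun t : ℝ => 1 - t) (Icc 0 1) (Icc 0 1) := by
    intro t ht
    exact ⟨by linarith [ht.2], by linarith [ht.1]⟩
  refine ⟨fun t => γ (1 - t), hc.comp (by fun_prop) hm, ?_, by simpa, by simpa, ?_⟩
  · intro s hs t ht h
    have := hi (hm hs) (hm ht) h
    linarith
  · apply Subset.antisymm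
    · rintro _ ⟨t, ht, rfl⟩
      exact ⟨_, hm ht, rfl⟩
    · rintro _ ⟨t, ht, rfl⟩
      exact ⟨1 - t, hm ht, by simp⟩

lemma IsArc.isCompact {A : Set X} {p q : X} (h : IsArc A p q) : IsCompact A := by
  obtain ⟨γ, hc, hi, h0, h1, rfl⟩ := h
  exact isCompact_Icc.image_of_continuousOn hc

lemma IsArc.isPreconnected {A : Set X} {p q : X} (h : IsArc A p q) : IsPreconnected A := by
  obtain ⟨γ, hc, hi, h0, h1, rfl⟩ := h
  exact isPreconnected_Icc.image _ hc

lemma IsArc.left_mem {A : Set X} {p q : X} (h : IsArc A p q) : p ∈ A := by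
  obtain ⟨γ, hc, hi, h0, h1, rfl⟩ := h
  exact ⟨0, by simp, h0⟩

lemma IsArc.right_mem {A : Set X} {p q : X} (h : IsArc A p q) : q ∈ A := h.symm.left_mem

lemma IsArc.ne {A : Set X} {p q : X} (h : IsArc A p q) : p ≠ q := by
  obtain ⟨γ, hc, hi, h0, h1, rfl⟩ := h
  intro hpq
  have := hi (show (0 : ℝ) ∈ Icc (0 : ℝ) 1 by simp) (show (1 : ℝ) ∈ Icc (0 : ℝ) 1 by simp)
    (by rw [h0, h1, hpq])
  exact zero_ne_one this

lemma IsArc.image {A : Set X} {p q : X} (h : IsArc A p q) {f : X → Y} (hf : ContinuousOn f A)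
    (hfi : InjOn f A) : IsArc (f '' A) (f p) (f q) := by
  obtain ⟨γ, hc, hi, h0, h1, rfl⟩ := h
  refine ⟨f ∘ γ, hf.comp hc (mapsTo_image _ _), hfi.comp hi (mapsTo_image _ _), by simp [h0],
    by simp [h1], by rw [image_comp]⟩

lemma IsArc.trans {A B : Set X} {p q r : X} (hA : IsArc A p q) (hB : IsArc B q r)
    (hAB : A ∩ B = {q}) : IsArc (A ∪ B) p r := by
  obtain ⟨γ, hc, hi, h0, h1, rfl⟩ := hA
  obtain ⟨δ, hc', hi', h0', h1', rfl⟩ := hB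
  have hmeet : ∀ s ∈ Icc (0 : ℝ) 1, ∀ t ∈ Icc (0 : ℝ) 1, γ s = δ t → s = 1 ∧ t = 0 := by
    intro s hs t ht h
    have : γ s ∈ γ '' Icc 0 1 ∩ δ '' Icc 0 1 := ⟨⟨s, hs, rfl⟩, ⟨t, ht, h.symm⟩⟩
    rw [hAB] at this
    have hq : γ s = q := this
    exact ⟨hi hs (by simp) (by rw [hq, h1]), hi' ht (by simp) (by rw [← h, hq, h0'])⟩
  let η : ℝ → X := fun t => if t ≤ 1 then γ t else δ (t - 1)
  have e1 : ∀ t ∈ Icc (0 : ℝ) 1, η t = γ t := fun t ht => by simp [η, ht.2]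
  have e2 : ∀ t ∈ Icc (1 : ℝ) 2, η t = δ (t - 1) := fun t ht => by
    rcases ht.1.eq_or_lt with rfl | h
    · simp [η, h1, h0']
    · simp [η, not_le.2 h]
  have hm : MapsTo (fun t : ℝ => t - 1) (Icc 1 2) (Icc 0 1) := by
    intro t ht
    exact ⟨by linarith [ht.1], by linarith [ht.2]⟩
  have hun : Icc (0 : ℝ) 2 = Icc 0 1 ∪ Icc 1 2 := (Icc_union_Icc_eq_Icc (by norm_num) (by norm_num)).symm
  have hηc : ContinuousOn η (Icc 0 2) := by
    rw [hun]
    refine ContinuousOn.union_of_isClosed (hc.congr e1) ?_ isClosed_Icc isClosed_Icc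
    exact (hc'.comp (by fun_prop) hm).congr e2
  have hηi : InjOn η (Icc 0 2) := by
    rw [hun]
    rintro s (hs | hs) t (ht | ht) h
    · rw [e1 s hs, e1 t ht] at h; exact hi hs ht h
    · rw [e1 s hs, e2 t ht] at h
      have := hmeet s hs _ (hm ht) h
      simp only at this; linarith [this.1, this.2]
    · rw [e2 s hs, e1 t ht] at h
      have := hmeet t ht _ (hm hs) h.symm
      simp only at this; linarith [this.1, this.2]
    · rw [e2 s hs, e2 t ht] at h
      have := hi' (hm hs) (hm ht) h
      simp only at this; linarith
  have := isArc_of_Icc (by norm_num : (0 : ℝ) < 2) hηc hηi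
  have e3 : η 0 = p := by rw [e1 0 (by simp), h0]
  have e4 : η 2 = r := by
    rw [e2 2 (by constructor <;> norm_num), ← h1']; norm_num
  rw [e3, e4] at this
  convert this using 1
  rw [hun, image_union, image_congr e1, image_congr e2]
  congr 1
  rw [show (fun t : ℝ => δ (t - 1)) = δ ∘ (fun t => t - 1) from rfl, image_comp]
  congr 1
  simp
  norm_num

lemma IsArc.open_part {A : Set X} {p q : X} (h : IsArc A p q) :
    IsPreconnected (A \ {p, q}) ∧ (A \ {p, q}).Nonempty ∧ A ⊆ closure (A \ {p, q}) := by
  obtain ⟨γ, hc, hi, h0, h1, rfl⟩ := h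
  have e : γ '' Icc 0 1 \ {p, q} = γ '' Ioo 0 1 := by
    apply Subset.antisymm
    · rintro _ ⟨⟨t, ht, rfl⟩, hn⟩
      refine ⟨t, ⟨lt_of_le_of_ne ht.1 ?_, lt_of_le_of_ne ht.2 ?_⟩, rfl⟩
      · rintro rfl; exact hn (by simp [h0])
      · rintro rfl; exact hn (by simp [h1])
    · rintro _ ⟨t, ht, rfl⟩
      refine ⟨⟨t, Ioo_subset_Icc_self ht, rfl⟩, ?_⟩
      rintro (h | h)
      · rw [← h0] at h
        have := hi (Ioo_subset_Icc_self ht) (by simp) h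
        exact ht.1.ne' this
      · rw [← h1] at h
        have := hi (Ioo_subset_Icc_self ht) (by simp) h
        exact ht.2.ne this
  rw [e]
  refine ⟨isPreconnected_Ioo.image _ (hc.mono Ioo_subset_Icc_self), ⟨γ (1/2), 1/2, by constructor <;> norm_num, rfl⟩, ?_⟩
  have : closure (Ioo (0 : ℝ) 1) = Icc 0 1 := closure_Ioo zero_ne_one
  rw [← this]
  exact image_closure_subset_closure_image (by rwa [this])
where
  image_closure_subset_closure_image {s : Set ℝ} {f : ℝ → X} (hf : ContinuousOn f (closure s)) :
    f '' closure s ⊆ closure (f '' s) := by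
    rintro _ ⟨x, hx, rfl⟩
    exact ((hf x hx).mono subset_closure).mem_closure_image hx

lemma hasLog_arc [T2Space X] {A : Set X} {p q : X} (h : IsArc A p q) {f : X → ℂ}
    (hf : ContinuousOn f A) (hne : ∀ z ∈ A, f z ≠ 0) : HasLog f A := by
  obtain ⟨γ, hc, hi, h0, h1, rfl⟩ := h
  have h1 : HasLog (fun t => f (γ t)) (Icc (0 : ℝ) 1) := by
    apply hasLog_of_contr
    · intro z hz t
      have := t.2
      simp only [smul_eq_mul]
      exact ⟨mul_nonneg t.2.1 hz.1, mul_le_one₀ t.2.2 hz.1 hz.2⟩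
    · exact hf.comp hc (mapsTo_image _ _)
    · intro z hz; exact hne _ ⟨z, hz, rfl⟩
  have := h1.comp (continuousOn_invFunOn isCompact_Icc hc hi) (L := γ '' Icc 0 1) (by
    intro z hz; exact Function.invFunOn_mem hz)
  refine this.congr fun z hz => ?_
  rw [Function.invFunOn_eq hz]

lemma injOn_Ico {γ : ℝ → X} (hp : Function.Periodic γ 1) (hi : InjOn γ (Ico 0 1)) (a : ℝ) :
    InjOn γ (Ico a (a + 1)) := by
  intro s hs t ht h
  have h1 : γ (Int.fract s) = γ (Int.fract t) := by
    rw [← Int.self_sub_floor, ← Int.self_sub_floor]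
    have e : ∀ x : ℝ, γ (x - ⌊x⌋) = γ x := fun x => by
      have := hp.sub_int_mul_eq (x := x) ⌊x⌋
      simpa using this
    rw [e, e, h]
  have h2 := hi ⟨Int.fract_nonneg _, Int.fract_lt_one _⟩ ⟨Int.fract_nonneg _, Int.fract_lt_one _⟩ h1
  rw [Int.fract_eq_fract] at h2
  obtain ⟨z, hz⟩ := h2
  have h3 : ((z : ℤ) : ℝ) < 1 := by rw [← hz]; linarith [hs.2, ht.1]
  have h4 : (-1 : ℝ) < ((z : ℤ) : ℝ) := by rw [← hz]; linarith [hs.1, ht.2]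
  have : z = 0 := by
    have h5 : z < 1 := by exact_mod_cast h3
    have h6 : -1 < z := by exact_mod_cast h4
    omega
  rw [this] at hz
  simp at hz
  linarith

lemma range_eq_Ico {γ : ℝ → X} (hp : Function.Periodic γ 1) (a : ℝ) :
    range γ = γ '' Ico a (a + 1) := by
  apply Subset.antisymm
  · rintro _ ⟨t, rfl⟩
    obtain ⟨y, hy, h⟩ := hp.exists_mem_Ico one_pos t a
    exact ⟨y, hy, h.symm⟩
  · exact image_subset_range _ _

lemma IsJordan.isCompact {J : Set X} (h : IsJordan J) : IsCompact J := by
  obtain ⟨γ, hc, hp, hi, rfl⟩ := h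
  have : range γ = γ '' Icc 0 1 := by
    apply Subset.antisymm
    · rw [range_eq_Ico hp 0, zero_add]; exact image_mono Ico_subset_Icc_self
    · exact image_subset_range _ _
  rw [this]
  exact isCompact_Icc.image hc

lemma IsJordan.isPreconnected {J : Set X} (h : IsJordan J) : IsPreconnected J := by
  obtain ⟨γ, hc, hp, hi, rfl⟩ := h
  exact isPreconnected_range hc

lemma IsJordan.image {J : Set X} (h : IsJordan J) {f : X → Y} (hf : ContinuousOn f J)
    (hfi : InjOn f J) : IsJordan (f '' J) := by
  obtain ⟨γ, hc, hp, hi, rfl⟩ := h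
  refine ⟨f ∘ γ, hf.comp_continuous hc (fun t => ⟨t, rfl⟩), fun t => by simp [hp t],
    hfi.comp hi (fun t _ => ⟨t, rfl⟩), by rw [range_comp]⟩

lemma IsJordan.split {J : Set X} (h : IsJordan J) {p q : X} (hp : p ∈ J) (hq : q ∈ J)
    (hpq : p ≠ q) : ∃ A B, IsArc A p q ∧ IsArc B p q ∧ A ∪ B = J ∧ A ∩ B = {p, q} := by
  obtain ⟨γ, hc, hper, hi, rfl⟩ := h
  obtain ⟨s, rfl⟩ := hp
  obtain ⟨t, ht, rfl⟩ : q ∈ γ '' Ico s (s + 1) := by rwa [← range_eq_Ico hper]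
  have hst : s < t := lt_of_le_of_ne ht.1 (fun h => hpq (by rw [h]))
  have hi1 := injOn_Ico hper hi s
  have hi2 := injOn_Ico hper hi t
  have hA : IsArc (γ '' Icc s t) (γ s) (γ t) := isArc_of_Icc hst hc.continuousOn
    (hi1.mono (show Icc s t ⊆ Ico s (s+1) from fun x hx => ⟨hx.1, hx.2.trans_lt ht.2⟩))
  have hB : IsArc (γ '' Icc t (s + 1)) (γ t) (γ (s + 1)) := isArc_of_Icc ht.2 hc.continuousOn
    (hi2.mono (show Icc t (s+1) ⊆ Ico t (t+1) from fun x hx => ⟨hx.1, hx.2.trans_lt (by linarith)⟩))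
  rw [hper] at hB
  refine ⟨_, _, hA, hB.symm, ?_, ?_⟩
  · rw [← image_union, Icc_union_Icc_eq_Icc hst.le ht.2.le]
    apply Subset.antisymm (image_subset_range _ _)
    rw [range_eq_Ico hper s]
    exact image_mono Ico_subset_Icc_self
  · apply Subset.antisymm
    · rintro _ ⟨⟨x, hx, rfl⟩, y, hy, hxy⟩
      rcases hy.2.eq_or_lt with rfl | hy2
      · left; rw [← hxy, hper]
      · have := hi1 ⟨hst.le.trans hy.1, hy2⟩ ⟨hx.1, hx.2.trans_lt ht.2⟩ hxy
        subst this
        right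
        rw [le_antisymm hx.2 hy.1]; rfl
    · rintro _ (rfl | rfl)
      · exact ⟨hA.left_mem, hB.right_mem⟩
      · exact ⟨hA.right_mem, hB.left_mem⟩

lemma isJordan_of_arcs {A B : Set X} {p q : X} (hA : IsArc A p q) (hB : IsArc B p q)
    (hAB : A ∩ B = {p, q}) : IsJordan (A ∪ B) := by
  have hpq := hA.ne
  obtain ⟨γ, hc, hi, h0, h1, rfl⟩ := hA
  obtain ⟨δ, hc', hi', h0', h1', rfl⟩ := hB
  have hmeet : ∀ s ∈ Icc (0 : ℝ) 1, ∀ t ∈ Icc (0 : ℝ) 1, γ s = δ t →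
      (s = 0 ∧ t = 0) ∨ (s = 1 ∧ t = 1) := by
    intro s hs t ht h
    have : γ s ∈ γ '' Icc 0 1 ∩ δ '' Icc 0 1 := ⟨⟨s, hs, rfl⟩, ⟨t, ht, h.symm⟩⟩
    rw [hAB] at this
    rcases this with hq | hq
    · left; exact ⟨hi hs (by simp) (by rw [hq, h0]), hi' ht (by simp) (by rw [← h, hq, h0'])⟩
    · right; exact ⟨hi hs (by simp) (by rw [hq, h1]), hi' ht (by simp) (by rw [← h, hq, h1'])⟩
  let η : ℝ → X := fun t => if t ≤ 1/2 then γ (2 * t) else δ (2 - 2 * t)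
  have e1 : ∀ t ∈ Icc (0 : ℝ) (1/2), η t = γ (2 * t) := fun t ht => by simp only [η, ht.2, if_true]
  have e2 : ∀ t ∈ Icc (1/2 : ℝ) 1, η t = δ (2 - 2 * t) := fun t ht => by
    rcases ht.1.eq_or_lt with rfl | h
    · simp only [η, le_refl, if_true]; norm_num [h1, h1']
    · simp only [η, not_le.2 h, if_false]
  have hm1 : MapsTo (fun t : ℝ => 2 * t) (Icc 0 (1/2)) (Icc 0 1) := by
    intro t ht
    exact ⟨by linarith [ht.1], by linarith [ht.2]⟩
  have hm2 : MapsTo (fun t : ℝ => 2 - 2 * t) (Icc (1/2) 1) (Icc 0 1) := by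
    intro t ht
    exact ⟨by linarith [ht.2], by linarith [ht.1]⟩
  have hun : Icc (0 : ℝ) 1 = Icc 0 (1/2) ∪ Icc (1/2) 1 :=
    (Icc_union_Icc_eq_Icc (by norm_num) (by norm_num)).symm
  have hηc : ContinuousOn η (Icc 0 1) := by
    rw [hun]
    refine ContinuousOn.union_of_isClosed ?_ ?_ isClosed_Icc isClosed_Icc
    · exact (hc.comp (by fun_prop) hm1).congr e1
    · exact (hc'.comp (by fun_prop) hm2).congr e2
  have hη01 : η 0 = η 1 := by
    rw [e1 0 (by constructor <;> norm_num), e2 1 (by constructor <;> norm_num)]; norm_num [h0, h0']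
  have hηi : InjOn η (Ico 0 1) := by
    intro s hs t ht h
    have hs' : s ∈ Icc (0 : ℝ) (1/2) ∪ Icc (1/2) 1 := hun ▸ Ico_subset_Icc_self hs
    have ht' : t ∈ Icc (0 : ℝ) (1/2) ∪ Icc (1/2) 1 := hun ▸ Ico_subset_Icc_self ht
    rcases hs' with hs' | hs' <;> rcases ht' with ht' | ht'
    · rw [e1 s hs', e1 t ht'] at h
      have := hi (hm1 hs') (hm1 ht') h
      simp only at this; linarith
    · rw [e1 s hs', e2 t ht'] at h
      have := hmeet _ (hm1 hs') _ (hm2 ht') h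
      simp only at this
      rcases this with this | this
      · linarith [this.1, this.2, ht.2]
      · linarith [this.1, this.2, ht.2]
    · rw [e2 s hs', e1 t ht'] at h
      have := hmeet _ (hm1 ht') _ (hm2 hs') h.symm
      simp only at this
      rcases this with this | this
      · linarith [this.1, this.2, hs.2]
      · linarith [this.1, this.2, ht.2]
    · rw [e2 s hs', e2 t ht'] at h
      have := hi' (hm2 hs') (hm2 ht') h
      simp only at this; linarith
  have hfr : ∀ t ∈ Ico (0 : ℝ) 1, η (Int.fract t) = η t := fun t ht => by
    rw [Int.fract_eq_self.2 ⟨ht.1, ht.2⟩]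
  refine ⟨η ∘ Int.fract, ContinuousOn.comp_fract'' hηc hη01, ?_, ?_, ?_⟩
  · intro t; simp [Int.fract_add_one]
  · intro s hs t ht h
    simp only [Function.comp, hfr s hs, hfr t ht] at h
    exact hηi hs ht h
  · have : range (η ∘ Int.fract) = η '' Icc 0 1 := by
      apply Subset.antisymm
      · rintro _ ⟨t, rfl⟩
        exact ⟨_, ⟨Int.fract_nonneg _, (Int.fract_lt_one _).le⟩, rfl⟩
      · rintro _ ⟨t, ht, rfl⟩
        rcases ht.2.eq_or_lt with rfl | h
        · exact ⟨0, by simp [hη01]⟩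
        · exact ⟨t, hfr t ⟨ht.1, h⟩⟩
    rw [this]
    conv_lhs => rw [hun, image_union, image_congr e1, image_congr e2]
    congr 1
    · apply Subset.antisymm
      · rintro _ ⟨t, ht, rfl⟩; exact ⟨_, hm1 ht, rfl⟩
      · rintro _ ⟨t, ht, rfl⟩
        exact ⟨t / 2, ⟨by linarith [ht.1], by linarith [ht.2]⟩, by simp only; congr 1; ring⟩
    · apply Subset.antisymm
      · rintro _ ⟨t, ht, rfl⟩; exact ⟨_, hm2 ht, rfl⟩
      · rintro _ ⟨t, ht, rfl⟩
        exact ⟨1 - t / 2, ⟨by linarith [ht.2], by linarith [ht.1]⟩, by simp only; congr 1; ring⟩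

lemma IsJordan.local_arc [T2Space X] {J : Set X} (h : IsJordan J) {p : X} (hp : p ∈ J) {N : Set X}
    (hN : N ∈ 𝓝 p) : ∃ B u v, IsArc B u v ∧ B ⊆ J ∧ p ∉ B ∧ J \ B ⊆ N ∧ IsPreconnected (J \ B) := by
  obtain ⟨γ, hc, hper, hi, rfl⟩ := h
  obtain ⟨s, rfl⟩ := hp
  obtain ⟨ε, hε, hball⟩ := Metric.mem_nhds_iff.1 (hc.continuousAt.preimage_mem_nhds hN)
  set δ := min (ε / 2) (1 / 4) with hδ
  have hδ0 : 0 < δ := by positivity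
  have hδ1 : δ ≤ 1 / 4 := min_le_right _ _
  have hδ2 : δ ≤ ε / 2 := min_le_left _ _
  have hi' := injOn_Ico hper hi (s - δ)
  have hE : range γ \ γ '' Icc (s + δ) (s + 1 - δ) = γ '' Ioo (s - δ) (s + δ) := by
    apply Subset.antisymm
    · rintro _ ⟨ht, hn⟩
      rw [range_eq_Ico hper (s - δ)] at ht
      obtain ⟨t, ht, rfl⟩ := ht
      refine ⟨t, ⟨lt_of_le_of_ne ht.1 ?_, ?_⟩, rfl⟩
      · rintro rfl
        exact hn ⟨s - δ + 1, ⟨by linarith, by linarith⟩, hper _⟩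
      · by_contra hh
        push Not at hh
        exact hn ⟨t, ⟨hh, by linarith [ht.2]⟩, rfl⟩
    · rintro _ ⟨t, ht, rfl⟩
      refine ⟨⟨t, rfl⟩, ?_⟩
      rintro ⟨u, hu, hut⟩
      rcases hu.2.eq_or_lt with rfl | hu2
      · rw [show s + 1 - δ = (s - δ) + 1 by ring, hper] at hut
        have := hi' ⟨le_refl _, by linarith⟩ ⟨ht.1.le, by linarith [ht.2]⟩ hut
        linarith [ht.1]
      · have := hi' ⟨by linarith [hu.1], by linarith⟩ ⟨ht.1.le, by linarith [ht.2]⟩ hut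
        linarith [hu.1, ht.2]
  refine ⟨γ '' Icc (s + δ) (s + 1 - δ), _, _, isArc_of_Icc (by linarith) hc.continuousOn ?_,
    image_subset_range _ _, ?_, ?_, ?_⟩
  · exact (injOn_Ico hper hi s).mono (show Icc (s+δ) (s+1-δ) ⊆ Ico s (s+1) from fun x hx => ⟨by linarith [hx.1], by linarith [hx.2]⟩)
  · intro h
    have : γ s ∈ γ '' Ioo (s - δ) (s + δ) := ⟨s, ⟨by linarith, by linarith⟩, rfl⟩
    rw [← hE] at this
    exact this.2 h
  · rw [hE]
    rintro _ ⟨t, ht, rfl⟩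
    apply hball
    rw [mem_ball, Real.dist_eq, abs_lt]
    constructor <;> linarith [ht.1, ht.2]
  · rw [hE]
    exact isPreconnected_Ioo.image _ hc.continuousOn

lemma IsJordan.nonempty {J : Set X} (h : IsJordan J) : J.Nonempty := by
  obtain ⟨γ, hc, hp, hi, rfl⟩ := h
  exact range_nonempty _

lemma IsJordan.two {J : Set X} (h : IsJordan J) : ∃ p ∈ J, ∃ q ∈ J, p ≠ q := by
  obtain ⟨γ, hc, hp, hi, rfl⟩ := h
  refine ⟨γ 0, ⟨0, rfl⟩, γ (1/2), ⟨_, rfl⟩, fun h => ?_⟩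
  have := hi (by simp) (by constructor <;> norm_num) h
  norm_num at this

/-- Descent of a periodic logarithm. -/
lemma hasLog_descend [T2Space X] {γ : ℝ → X} (hc : Continuous γ) (hp : Function.Periodic γ 1)
    (hi : InjOn γ (Ico 0 1)) {f : X → ℂ} {θ : ℝ → ℂ} (hθ : Continuous θ)
    (hθp : Function.Periodic θ 1) (he : ∀ t, Complex.exp (θ t) = f (γ t)) :
    HasLog f (range γ) := by
  have key : ∀ t ∈ Icc (0 : ℝ) 1, θ (Function.invFunOn γ (Ico 0 1) (γ t)) = θ t := by
    intro t ht
    rcases ht.2.eq_or_lt with rfl | h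
    · have h1 : γ 1 = γ 0 := by have := hp 0; simpa using this
      have h2 : θ 1 = θ 0 := by have := hθp 0; simpa using this
      rw [h1, h2, hi.leftInvOn_invFunOn (by simp)]
    · rw [hi.leftInvOn_invFunOn ⟨ht.1, h⟩]
  have hr : range γ = γ '' Icc 0 1 := by
    apply Subset.antisymm
    · rw [range_eq_Ico hp 0, zero_add]; exact image_mono Ico_subset_Icc_self
    · exact image_subset_range _ _
  refine ⟨fun z => θ (Function.invFunOn γ (Ico 0 1) z), ?_, ?_⟩
  · rw [continuousOn_iff_isClosed]
    intro T hT
    refine ⟨γ '' (Icc 0 1 ∩ θ ⁻¹' T),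
      ((isCompact_Icc.inter_right (hT.preimage hθ)).image hc).isClosed, ?_⟩
    rw [hr]
    ext y
    constructor
    · rintro ⟨hy, t, ht, rfl⟩
      refine ⟨⟨t, ⟨ht, ?_⟩, rfl⟩, t, ht, rfl⟩
      simpa [key t ht] using hy
    · rintro ⟨⟨t, ⟨ht, htT⟩, rfl⟩, -⟩
      refine ⟨?_, t, ht, rfl⟩
      simpa [key t ht] using htT
  · rw [hr]
    rintro _ ⟨t, ht, rfl⟩
    show Complex.exp (θ (Function.invFunOn γ (Ico 0 1) (γ t))) = f (γ t)
    rw [key t ht, he]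

lemma lift_degree {γ : ℝ → X} (hc : Continuous γ) (hp : Function.Periodic γ 1) {f : X → ℂ}
    (hf : ContinuousOn f (range γ)) (hne : ∀ z ∈ range γ, f z ≠ 0) :
    ∃ (θ : ℝ → ℂ) (d : ℤ), Continuous θ ∧ (∀ t, Complex.exp (θ t) = f (γ t)) ∧
      ∀ t, θ (t + 1) = θ t + d * (2 * Real.pi * Complex.I) := by
  have hfg : Continuous (fun t => f (γ t)) := hf.comp_continuous hc (fun t => ⟨t, rfl⟩)
  obtain ⟨θ, h1, h2⟩ := hasLog_of_contr (K := (univ : Set ℝ)) (f := fun t => f (γ t)) (by simp)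
    hfg.continuousOn (fun z _ => hne _ ⟨z, rfl⟩)
  rw [continuousOn_univ] at h1
  obtain ⟨d, hd⟩ := exp_eq_on (K := (univ : Set ℝ)) isPreconnected_univ
    (φ := fun t => θ (t + 1)) (ψ := θ) (by fun_prop) h1.continuousOn (by
      intro t _
      have a1 := h2 (t+1) (mem_univ _)
      have a2 := h2 t (mem_univ _)
      simp only [hp t] at a1
      rw [a1, a2])
  exact ⟨θ, d, h1, fun t => h2 t (mem_univ _), fun t => hd t (mem_univ _)⟩

lemma IsJordan.rank_one [T2Space X] {J : Set X} (h : IsJordan J) {f g : X → ℂ}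
    (hf : ContinuousOn f J) (hfne : ∀ z ∈ J, f z ≠ 0) (hg : ContinuousOn g J)
    (hgne : ∀ z ∈ J, g z ≠ 0) (hgl : ¬ HasLog g J) :
    ∃ m n : ℤ, m ≠ 0 ∧ HasLog (fun z => f z ^ m * g z ^ n) J := by
  obtain ⟨γ, hc, hp, hi, rfl⟩ := h
  obtain ⟨θ, d, h1, h2, h3⟩ := lift_degree hc hp hf hfne
  obtain ⟨η, e, h4, h5, h6⟩ := lift_degree hc hp hg hgne
  refine ⟨e, -d, ?_, ?_⟩
  · rintro rfl
    exact hgl (hasLog_descend hc hp hi h4 (fun t => by simp [h6]) h5)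
  · refine hasLog_descend hc hp hi (θ := fun t => e * θ t + (-d : ℤ) * η t) (by fun_prop) ?_ ?_
    · intro t
      simp only [h3, h6]
      push_cast
      ring
    · intro t
      rw [Complex.exp_add, Complex.exp_int_mul, Complex.exp_int_mul, h2, h5]
end arcs

lemma out_mono {K L : Set ℂ} (h : K ⊆ L) : out L ⊆ out K := by
  intro z hz
  refine ⟨fun hk => hz.1 (h hk), fun hb => hz.2 (hb.subset ?_)⟩
  exact connectedComponentIn_mono _ (compl_subset_compl.2 h)

lemma sub_out {K S : Set ℂ} (hS : IsPreconnected S) (hSK : S ⊆ Kᶜ) (hu : ¬ Bornology.IsBounded S) :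
    S ⊆ out K := fun z hz =>
  ⟨hSK hz, fun hb => hu (hb.subset (hS.subset_connectedComponentIn hz hSK))⟩

lemma out_unbounded {K : Set ℂ} (hK : IsCompact K) : ¬ Bornology.IsBounded (out K) := by
  intro hb
  obtain ⟨R, hR, hKR, hR'⟩ := exists_far hK
  obtain ⟨M, hM⟩ := hb.subset_closedBall 0
  have h1 : ((max R M + 1 : ℝ) : ℂ) ∉ closedBall (0 : ℂ) (max R M) := by
    simp only [mem_closedBall, dist_zero_right, Complex.norm_real, not_le, Real.norm_eq_abs]
    exact lt_of_lt_of_le (by linarith) (le_abs_self _)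
  have h2 : ((max R M + 1 : ℝ) : ℂ) ∈ out K := hR' fun h =>
    h1 (closedBall_subset_closedBall (le_max_left _ _) h)
  exact h1 (closedBall_subset_closedBall (le_max_right _ _) (hM h2))

lemma IsArc.conn {A : Set ℂ} {p q a b : ℂ} (h : IsArc A p q) (ha : a ∉ A) (hb : b ∉ A) :
    Conn A a b := by
  refine conn_of_hasLog h.isCompact ha hb (hasLog_arc h ?_ ?_)
  · refine ContinuousOn.mul (by fun_prop) (ContinuousOn.inv₀ (by fun_prop) ?_)
    intro z hz h; exact hb (by rwa [← sub_eq_zero.1 h])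
  · intro z hz
    refine mul_ne_zero ?_ (inv_ne_zero ?_)
    · intro h; exact ha (by rwa [← sub_eq_zero.1 h])
    · intro h; exact hb (by rwa [← sub_eq_zero.1 h])

lemma IsArc.mem_out {A : Set ℂ} {p q a : ℂ} (h : IsArc A p q) (ha : a ∉ A) : a ∈ out A := by
  refine out_of_hasLog h.isCompact ha (hasLog_arc h (by fun_prop) ?_)
  intro z hz h; exact ha (by rwa [← sub_eq_zero.1 h])

lemma IsJordan.conn_ins {J : Set ℂ} (hJ : IsJordan J) {a b : ℂ} (ha : a ∈ ins J) (hb : b ∈ ins J) :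
    Conn J a b := by
  have hne : ∀ {x : ℂ}, x ∈ ins J → ∀ z ∈ J, z - x ≠ 0 := by
    intro x hx z hz h
    exact hx.1 (by rwa [← sub_eq_zero.1 h])
  obtain ⟨m, n, hm, h⟩ := hJ.rank_one (f := fun z => z - a) (g := fun z => z - b) (by fun_prop)
    (hne ha) (by fun_prop) (hne hb)
    (fun h => not_ins_out hb (out_of_hasLog hJ.isCompact hb.1 h))
  exact conn_of_zpow hJ.isCompact ha hb.1 hm h

lemma IsJordan.isPreconnected_ins {J : Set ℂ} (hJ : IsJordan J) : IsPreconnected (ins J) :=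
  isPreconnected_of_conn (fun _ ha _ hb => hJ.conn_ins ha hb) (fun _ _ h ha => h.ins ha)

lemma IsArc.log_compl {A : Set ℂ} {p q : ℂ} (h : IsArc A p q) :
    HasLog (fun z => (z - p) * (z - q)⁻¹) Aᶜ := by
  obtain ⟨γ, hc, hi, h0, h1, rfl⟩ := h.symm
  have hq : q ∈ γ '' Icc 0 1 := ⟨0, by simp, h0⟩
  have hγ : Continuous (fun t : unitInterval => γ t) := by
    have := continuousOn_iff_continuous_restrict.1 hc
    exact this
  have := hasLog_homotopy (K := (γ '' Icc 0 1)ᶜ)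
    (fun x : unitInterval × ℂ => (x.2 - γ x.1) * (x.2 - q)⁻¹) ?_ ?_ ?_
  · simpa [h1] using this
  · refine ContinuousOn.mul ?_ (ContinuousOn.inv₀ (by fun_prop) ?_)
    · exact (continuous_snd.sub (hγ.comp continuous_fst)).continuousOn
    · rintro ⟨t, z⟩ ⟨-, hz⟩ h
      have h' : z = q := sub_eq_zero.1 h
      exact hz (by rwa [h'])
  · intro t z hz
    refine mul_ne_zero ?_ (inv_ne_zero ?_)
    · intro h; exact hz ⟨t, t.2, (sub_eq_zero.1 h).symm⟩
    · intro h
      have h' : z = q := sub_eq_zero.1 h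
      exact hz (by rwa [h'])
  · refine (hasLog_const 1 one_ne_zero _).congr ?_
    intro z hz
    have : z - q ≠ 0 := fun h => hz (by rwa [sub_eq_zero.1 h])
    simp [h0, this]

lemma IsJordan.ins_nonempty {J : Set ℂ} (hJ : IsJordan J) : (ins J).Nonempty := by
  by_contra hne
  rw [not_nonempty_iff_eq_empty] at hne
  obtain ⟨p, hp, q, hq, hpq⟩ := hJ.two
  obtain ⟨A, B, hA, hB, hAB, hAB'⟩ := hJ.split hp hq hpq
  have hout : Aᶜ ∩ Bᶜ = out J := by
    rw [← compl_union, hAB]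
    ext z
    refine ⟨fun hz => (ins_or_out hz).resolve_left (by simp [hne]), fun hz => hz.1⟩
  have h1 : HasLog (fun z => (z - p) * (z - q)⁻¹) (Aᶜ ∪ Bᶜ) :=
    hasLog_union_open hA.isCompact.isClosed.isOpen_compl hB.isCompact.isClosed.isOpen_compl
      (by rw [hout]; exact isPreconnected_out hJ.isCompact) hA.log_compl hB.log_compl
  rw [← compl_inter, hAB'] at h1
  have hd : 0 < dist p q := dist_pos.2 hpq
  have hsub : sphere p (dist p q / 2) ⊆ ({p, q} : Set ℂ)ᶜ := by
    intro z hz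
    rw [mem_sphere] at hz
    rintro (rfl | rfl)
    · simp at hz; exact hpq (by simpa using hz.symm)
    · rw [dist_comm] at hz; linarith
  have h2 := h1.mono hsub
  have h3 : HasLog (fun z => (z - q) * (p - q)⁻¹) (sphere p (dist p q / 2)) := by
    refine hasLog_near_one (by fun_prop) fun z hz => ?_
    have hne : p - q ≠ 0 := sub_ne_zero.2 hpq
    have : (z - q) * (p - q)⁻¹ - 1 = (z - p) / (p - q) := by field_simp; ring
    rw [this, norm_div, ← dist_eq_norm, ← dist_eq_norm, mem_sphere.1 hz, div_lt_one hd]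
    linarith
  have h4 := h2.mul (h3.mul (hasLog_const (p - q) (sub_ne_zero.2 hpq) _))
  refine not_hasLog_circle p (dist p q / 2) (by linarith) 1 one_ne_zero (h4.congr ?_)
  intro z hz
  have h5 : z - q ≠ 0 := fun h => hsub hz (Or.inr (sub_eq_zero.1 h))
  have hne : p - q ≠ 0 := sub_ne_zero.2 hpq
  field_simp

lemma out_nonempty {K : Set ℂ} (hK : IsCompact K) : (out K).Nonempty := by
  by_contra h
  rw [not_nonempty_iff_eq_empty] at h
  exact out_unbounded hK (by rw [h]; exact Bornology.isBounded_empty)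

lemma IsJordan.sub_closure {J : Set ℂ} (hJ : IsJordan J) :
    J ⊆ closure (ins J) ∧ J ⊆ closure (out J) := by
  have key : ∀ p ∈ J, ∀ N : Set ℂ, IsOpen N → p ∈ N → ((N ∩ ins J).Nonempty ∧ (N ∩ out J).Nonempty) := by
    intro p hp N hN hpN
    obtain ⟨B, u, v, hB, hBJ, hpB, hJB, -⟩ := hJ.local_arc hp (hN.mem_nhds hpN)
    obtain ⟨a, ha⟩ := hJ.ins_nonempty
    obtain ⟨b, hb⟩ := out_nonempty hJ.isCompact
    obtain ⟨C, hC, hCB, haC, hbC⟩ := hB.conn (fun h => ha.1 (hBJ h)) (fun h => hb.1 (hBJ h))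
    have hcl := hJ.isCompact.isClosed
    have hcov : ∀ z ∈ C, z ∈ ins J ∨ z ∈ out J ∨ z ∈ N := by
      intro z hz
      by_cases hzJ : z ∈ J
      · exact Or.inr (Or.inr (hJB ⟨hzJ, hCB hz⟩))
      · rcases ins_or_out hzJ with h | h <;> simp [h]
    constructor
    · by_contra hcon
      obtain ⟨z, -, h1, h2 | h2⟩ := hC _ _ (isOpen_ins hcl) ((isOpen_out hcl).union hN) hcov
        ⟨a, haC, ha⟩ ⟨b, hbC, Or.inl hb⟩
      · exact not_ins_out h1 h2
      · exact hcon ⟨z, h2, h1⟩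
    · by_contra hcon
      obtain ⟨z, -, h1, h2 | h2⟩ := hC _ _ (isOpen_out hcl) ((isOpen_ins hcl).union hN)
        (fun z hz => by rcases hcov z hz with h | h | h <;> simp [h])
        ⟨b, hbC, hb⟩ ⟨a, haC, Or.inl ha⟩
      · exact not_ins_out h2 h1
      · exact hcon ⟨z, h2, h1⟩
  constructor
  · intro p hp
    rw [_root_.mem_closure_iff]
    intro N hN hpN
    exact (key p hp N hN hpN).1
  · intro p hp
    rw [_root_.mem_closure_iff]
    intro N hN hpN
    exact (key p hp N hN hpN).2

lemma closure_ins_sub {K : Set ℂ} (hK : IsClosed K) : closure (ins K) ⊆ ins K ∪ K :=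
  closure_sub hK (fun _ _ h ha => h.ins ha)

lemma theta_aux {A B c : Set ℂ} {p q : ℂ} (hA : IsArc A p q) (hB : IsArc B p q) (hc : IsArc c p q)
    (hAB : A ∩ B = {p, q}) (hcJ : c \ {p, q} ⊆ ins (A ∪ B)) :
    out (A ∪ B) ⊆ out (B ∪ c) ∧ A \ {p, q} ⊆ out (B ∪ c) := by
  have hJ := isJordan_of_arcs hA hB hAB
  have hcl := hJ.sub_closure.2
  have hpre : IsPreconnected (out (A ∪ B) ∪ A \ {p, q}) :=
    (isPreconnected_out hJ.isCompact).subset_closure subset_union_left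
      (union_subset subset_closure (fun z hz => hcl (Or.inl hz.1)))
  have := sub_out (K := B ∪ c) hpre ?_ (fun h => out_unbounded hJ.isCompact (h.subset subset_union_left))
  · exact union_subset_iff.1 this
  · rintro z (hz | hz) (hzB | hzc)
    · exact hz.1 (Or.inr hzB)
    · by_cases h : z ∈ ({p, q} : Set ℂ)
      · rw [← hAB] at h; exact hz.1 (Or.inl h.1)
      · exact not_ins_out (hcJ ⟨hzc, h⟩) hz
    · exact hz.2 (hAB ▸ ⟨hz.1, hzB⟩)
    · exact (hcJ ⟨hzc, hz.2⟩).1 (Or.inl hz.1)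

lemma theta {A B c : Set ℂ} {p q : ℂ} (hA : IsArc A p q) (hB : IsArc B p q) (hc : IsArc c p q)
    (hAB : A ∩ B = {p, q}) (hcJ : c \ {p, q} ⊆ ins (A ∪ B)) :
    ins (A ∪ c) ∪ ins (B ∪ c) = ins (A ∪ B) \ c ∧ ins (A ∪ c) ∩ ins (B ∪ c) = ∅ ∧
      A \ {p, q} ⊆ out (B ∪ c) ∧ B \ {p, q} ⊆ out (A ∪ c) := by
  obtain ⟨o1, a1⟩ := theta_aux hA hB hc hAB hcJ
  obtain ⟨o2, a2⟩ := theta_aux hB hA hc (by rw [inter_comm, hAB]) (by rwa [union_comm])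
  rw [union_comm B A] at o2
  have hJ := isJordan_of_arcs hA hB hAB
  have hAc : IsCompact (A ∪ c) := hA.isCompact.union hc.isCompact
  have hBc : IsCompact (B ∪ c) := hB.isCompact.union hc.isCompact
  have hpq : ({p, q} : Set ℂ) ⊆ c := by
    rintro _ (rfl | rfl)
    exacts [hc.left_mem, hc.right_mem]
  have nB : ∀ z ∈ ins (A ∪ c), z ∉ B := fun z hz hzB => by
    by_cases h : z ∈ ({p, q} : Set ℂ)
    · exact hz.1 (Or.inr (hpq h))
    · exact not_ins_out hz (a2 ⟨hzB, h⟩)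
  have nA : ∀ z ∈ ins (B ∪ c), z ∉ A := fun z hz hzA => by
    by_cases h : z ∈ ({p, q} : Set ℂ)
    · exact hz.1 (Or.inr (hpq h))
    · exact not_ins_out hz (a1 ⟨hzA, h⟩)
  refine ⟨?_, ?_, a1, a2⟩
  · ext z
    constructor
    · rintro (hz | hz)
      · have h1 : z ∉ A ∪ B := by
          rintro (h | h)
          exacts [hz.1 (Or.inl h), nB z hz h]
        refine ⟨(ins_or_out h1).resolve_right fun h => not_ins_out hz (o2 h), fun h => hz.1 (Or.inr h)⟩
      · have h1 : z ∉ A ∪ B := by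
          rintro (h | h)
          exacts [nA z hz h, hz.1 (Or.inl h)]
        refine ⟨(ins_or_out h1).resolve_right fun h => not_ins_out hz (o1 h), fun h => hz.1 (Or.inr h)⟩
    · rintro ⟨hz, hzc⟩
      by_contra hcon
      rw [mem_union, not_or] at hcon
      have h1 : z ∈ out (A ∪ c) := (ins_or_out (by
        rintro (h | h)
        exacts [hz.1 (Or.inl h), hzc h])).resolve_left hcon.1
      have h2 : z ∈ out (B ∪ c) := (ins_or_out (by
        rintro (h | h)
        exacts [hz.1 (Or.inr h), hzc h])).resolve_left hcon.2
      have e : (A ∪ c) ∩ (B ∪ c) = c := by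
        rw [← inter_union_distrib_right, hAB, union_eq_self_of_subset_left hpq]
      have h3 := janiszewski_out hAc hBc (by rw [e]; exact hc.isPreconnected) h1 h2
      refine not_ins_out hz (out_mono ?_ h3)
      rintro w (h | h)
      · exact Or.inl (Or.inl h)
      · exact Or.inr (Or.inl h)
  · by_contra hne
    rw [← ne_eq, ← nonempty_iff_ne_empty] at hne
    obtain ⟨a, ha⟩ := hne
    have hac : a ∉ c := fun h => ha.1.1 (Or.inr h)
    have hao := hc.mem_out hac
    refine hao.2 ((ins_bounded hAc).subset (Subset.trans ?_ (inter_subset_left (t := ins (B ∪ c)))))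
    refine isPreconnected_connectedComponentIn.subset_of_closure_inter_subset
      ((isOpen_ins hAc.isClosed).inter (isOpen_ins hBc.isClosed)) ⟨a, mem_connectedComponentIn hac, ha⟩ ?_
    rintro z ⟨hz, hzc⟩
    replace hzc : z ∉ c := connectedComponentIn_subset _ _ hzc
    have h1 := closure_ins_sub hAc.isClosed (closure_mono inter_subset_left hz)
    have h2 := closure_ins_sub hBc.isClosed (closure_mono inter_subset_right hz)
    have hpq' : z ∉ ({p, q} : Set ℂ) := fun h => hzc (hpq h)
    have h1' : z ∈ ins (A ∪ c) ∨ z ∈ A := by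
      rcases h1 with h | h | h
      exacts [Or.inl h, Or.inr h, absurd h hzc]
    have h2' : z ∈ ins (B ∪ c) ∨ z ∈ B := by
      rcases h2 with h | h | h
      exacts [Or.inl h, Or.inr h, absurd h hzc]
    rcases h1' with h1' | h1' <;> rcases h2' with h2' | h2'
    · exact ⟨h1', h2'⟩
    · exact absurd h2' (nB z h1')
    · exact absurd h1' (nA z h2')
    · exact absurd (hAB ▸ ⟨h1', h2'⟩) hpq'

lemma IsJordan.ulc {J : Set ℂ} (hJ : IsJordan J) {ε : ℝ} (hε : 0 < ε) :
    ∃ η > 0, ∀ p ∈ J, ∀ q ∈ J, dist p q < η → ∃ C ⊆ J, IsPreconnected C ∧ p ∈ C ∧ q ∈ C ∧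
      ∀ z ∈ C, dist z p < ε := by
  choose! B u v hB hBJ hxB hN hpre using fun x (hx : x ∈ J) =>
    hJ.local_arc hx (ball_mem_nhds x (half_pos hε))
  obtain ⟨η, hη, h⟩ := lebesgue_number_lemma_of_metric (s := J) (c := fun x : J => (B x)ᶜ)
    hJ.isCompact (fun x => (hB x x.2).isCompact.isClosed.isOpen_compl)
    (fun x hx => mem_iUnion.2 ⟨⟨x, hx⟩, hxB x hx⟩)
  refine ⟨η, hη, fun p hp q hq hpq => ?_⟩
  obtain ⟨⟨x, hx⟩, hb⟩ := h p hp
  have hpC : p ∈ J \ B x := ⟨hp, hb (mem_ball_self hη)⟩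
  refine ⟨J \ B x, diff_subset, hpre x hx, hpC,
    ⟨hq, hb (by rwa [mem_ball, dist_comm])⟩, fun z hz => ?_⟩
  have h1 := hN x hx hz
  have h2 := hN x hx hpC
  rw [mem_ball] at h1 h2
  have := dist_triangle_right z p x
  linarith

section patharc
variable {X : Type*} [MetricSpace X]

/-- running oscillation -/
noncomputable def osc (f : ℝ → X) (r t : ℝ) : ℝ :=
  sSup ((fun u => min 1 (dist (f r) (f (max r (min u t))))) '' Icc 0 1)

lemma osc_continuous {f : ℝ → X} (hf : Continuous f) (r : ℝ) : Continuous (osc f r) := by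
  refine IsCompact.continuous_sSup (f := fun t u => min 1 (dist (f r) (f (max r (min u t)))))
    isCompact_Icc ?_
  show Continuous (fun x : ℝ × ℝ => min 1 (dist (f r) (f (max r (min x.2 x.1)))))
  fun_prop

lemma osc_bdd (f : ℝ → X) (r t : ℝ) :
    BddAbove ((fun u => min 1 (dist (f r) (f (max r (min u t))))) '' Icc (0 : ℝ) 1) :=
  ⟨1, by rintro _ ⟨u, -, rfl⟩; exact min_le_left _ _⟩

lemma le_osc (f : ℝ → X) (r t : ℝ) {u : ℝ} (hu : u ∈ Icc (0 : ℝ) 1) :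
    min 1 (dist (f r) (f (max r (min u t)))) ≤ osc f r t :=
  le_csSup (osc_bdd f r t) ⟨u, hu, rfl⟩

lemma osc_le (f : ℝ → X) (r t : ℝ) {M : ℝ}
    (h : ∀ u ∈ Icc (0 : ℝ) 1, min 1 (dist (f r) (f (max r (min u t)))) ≤ M) : osc f r t ≤ M :=
  csSup_le ⟨_, 0, by simp, rfl⟩ (by rintro _ ⟨u, hu, rfl⟩; exact h u hu)

lemma osc_nonneg (f : ℝ → X) (r t : ℝ) : 0 ≤ osc f r t :=
  le_trans (le_min zero_le_one dist_nonneg) (le_osc f r t (u := 0) (by simp))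

lemma osc_le_one (f : ℝ → X) (r t : ℝ) : osc f r t ≤ 1 := osc_le f r t fun _ _ => min_le_left _ _

lemma osc_mono (f : ℝ → X) (r : ℝ) {s t : ℝ} (hs : s ∈ Icc (0 : ℝ) 1) (hst : s ≤ t) :
    osc f r s ≤ osc f r t := by
  refine osc_le f r s fun u hu => ?_
  have := le_osc f r t (u := min u s) ⟨le_min hu.1 hs.1, (min_le_left _ _).trans hu.2⟩
  rwa [min_assoc, min_eq_left hst] at this

lemma osc_const (f : ℝ → X) (r : ℝ) {s t : ℝ} (hs : s ∈ Icc (0 : ℝ) 1) (hst : s ≤ t)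
    (hc : ∀ u ∈ Icc s t, f u = f s) : osc f r t = osc f r s := by
  refine le_antisymm (osc_le f r t fun u hu => ?_) (osc_mono f r hs hst)
  rcases le_total r s with hrs | hrs
  · rcases le_total (min u t) s with h | h
    · have := le_osc f r s hu
      have e : min u s = min u t := by
        rcases le_total u s with h' | h'
        · rw [min_eq_left h', min_eq_left (h'.trans hst)]
        · rw [min_eq_right h']
          exact le_antisymm (le_min h' hst) h
      rwa [e] at this
    · have := le_osc f r s hs
      rw [min_self, max_eq_right hrs] at this
      rw [max_eq_right (hrs.trans h), hc _ ⟨h, min_le_right _ _⟩]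
      exact this
  · have : f (max r (min u t)) = f r := by
      rcases le_total r t with hrt | hrt
      · rw [hc _ ⟨hrs.trans (le_max_left _ _), max_le hrt (min_le_right _ _)⟩, hc _ ⟨hrs, hrt⟩]
      · rw [max_eq_left ((min_le_right _ _).trans hrt)]
    rw [this, dist_self]
    exact (min_le_right _ _).trans (osc_nonneg _ _ _)

noncomputable def wt (f : ℝ → X) (t : ℝ) : ℝ := ∑' q : ℚ, (1 / 2 : ℝ) ^ Encodable.encode q * osc f q t

lemma wt_bound (f : ℝ → X) (q : ℚ) (t : ℝ) :
    ‖(1 / 2 : ℝ) ^ Encodable.encode q * osc f q t‖ ≤ (1 / 2 : ℝ) ^ Encodable.encode q := by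
  rw [Real.norm_of_nonneg (mul_nonneg (by positivity) (osc_nonneg _ _ _))]
  exact mul_le_of_le_one_right (by positivity) (osc_le_one _ _ _)

lemma wt_summable (f : ℝ → X) (t : ℝ) :
    Summable (fun q : ℚ => (1 / 2 : ℝ) ^ Encodable.encode q * osc f q t) :=
  Summable.of_norm_bounded summable_geometric_two_encode (fun q => wt_bound f q t)

lemma wt_continuous {f : ℝ → X} (hf : Continuous f) : Continuous (wt f) :=
  continuous_tsum (fun q => continuous_const.mul (osc_continuous hf q))
    summable_geometric_two_encode (fun q t => wt_bound f q t)

lemma wt_mono (f : ℝ → X) {s t : ℝ} (hs : s ∈ Icc (0 : ℝ) 1) (hst : s ≤ t) : wt f s ≤ wt f t :=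
  Summable.tsum_le_tsum (fun q => mul_le_mul_of_nonneg_left (osc_mono f q hs hst) (by positivity))
    (wt_summable f s) (wt_summable f t)

lemma wt_lt {f : ℝ → X} (hf : Continuous f) {s t : ℝ} (hs : s ∈ Icc (0 : ℝ) 1)
    (ht : t ∈ Icc (0 : ℝ) 1) (hst : s ≤ t) (hne : f s ≠ f t) : wt f s < wt f t := by
  have hd : 0 < dist (f s) (f t) := dist_pos.2 hne
  set ε := min 1 (dist (f s) (f t)) / 4 with hε
  have hε0 : 0 < ε := by have := lt_min one_pos hd; positivity
  have hε1 : 4 * ε ≤ 1 := by rw [hε]; linarith [min_le_left 1 (dist (f s) (f t))]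
  have hε2 : 4 * ε ≤ dist (f s) (f t) := by rw [hε]; linarith [min_le_right 1 (dist (f s) (f t))]
  obtain ⟨δ, hδ, h⟩ := Metric.continuousAt_iff.1 (hf.continuousAt (x := s)) ε hε0
  obtain ⟨q, hq1, hq2⟩ := exists_rat_btwn (show s - δ < s by linarith)
  have hq : dist (f q) (f s) < ε := h (by rw [Real.dist_eq, abs_lt]; constructor <;> linarith)
  have h1 : osc f q s ≤ 2 * ε := by
    refine osc_le f q s fun u hu => (min_le_right _ _).trans ?_
    have : dist (f (max q (min u s))) (f s) < ε := h (by
      rw [Real.dist_eq, abs_lt]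
      constructor
      · linarith [le_max_left (q : ℝ) (min u s)]
      · linarith [max_le hq2.le (min_le_right u s)])
    have := dist_triangle_right (f q) (f (max q (min u s))) (f s)
    linarith
  have h2 : 3 * ε ≤ osc f q t := by
    have := le_osc f q t ht
    rw [min_self, max_eq_right (hq2.le.trans hst)] at this
    refine le_trans (le_min (by linarith) ?_) this
    have := dist_triangle_left (f s) (f t) (f q)
    linarith
  refine Summable.tsum_lt_tsum (i := q) (fun q => mul_le_mul_of_nonneg_left (osc_mono f q hs hst) (by positivity))
    (mul_lt_mul_of_pos_left (by linarith) (by positivity)) (wt_summable f s) (wt_summable f t)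

lemma arc_of_monotone {f : ℝ → X} (hf : Continuous f) (hne : f 0 ≠ f 1)
    (hm : ∀ s ∈ Icc (0 : ℝ) 1, ∀ t ∈ Icc (0 : ℝ) 1, f s = f t → ∀ u ∈ Icc s t, f u = f s) :
    IsArc (f '' Icc 0 1) (f 0) (f 1) := by
  set w := wt f with hw
  have hwc : Continuous w := wt_continuous hf
  have h01 : w 0 < w 1 := wt_lt hf (by simp) (by simp) zero_le_one hne
  have himg : w '' Icc 0 1 = Icc (w 0) (w 1) := by
    apply Subset.antisymm
    · rintro _ ⟨t, ht, rfl⟩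
      exact ⟨wt_mono f (by simp) ht.1, wt_mono f ht ht.2⟩
    · exact intermediate_value_Icc zero_le_one hwc.continuousOn
  have hiff : ∀ s ∈ Icc (0 : ℝ) 1, ∀ t ∈ Icc (0 : ℝ) 1, (w s = w t ↔ f s = f t) := by
    have key : ∀ s ∈ Icc (0 : ℝ) 1, ∀ t ∈ Icc (0 : ℝ) 1, s ≤ t → (w s = w t ↔ f s = f t) := by
      intro s hs t ht hst
      constructor
      · intro h
        by_contra hcon
        exact (wt_lt hf hs ht hst hcon).ne h
      · intro h
        have := hm s hs t ht h
        simp only [hw, wt]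
        congr 1; ext q
        rw [osc_const f q hs hst this]
    intro s hs t ht
    rcases le_total s t with h | h
    · exact key s hs t ht h
    · rw [eq_comm, key t ht s hs h, eq_comm]
  let α : ℝ → X := fun x => f (Function.invFunOn w (Icc 0 1) x)
  have hα : ∀ t ∈ Icc (0 : ℝ) 1, α (w t) = f t := by
    intro t ht
    have h1 : w t ∈ w '' Icc 0 1 := ⟨t, ht, rfl⟩
    exact (hiff _ (Function.invFunOn_mem h1) _ ht).1 (Function.invFunOn_eq h1)
  have hαc : ContinuousOn α (Icc (w 0) (w 1)) := by
    rw [continuousOn_iff_isClosed]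
    intro T hT
    refine ⟨w '' (Icc 0 1 ∩ f ⁻¹' T),
      ((isCompact_Icc.inter_right (hT.preimage hf)).image hwc).isClosed, ?_⟩
    rw [← himg]
    ext y
    constructor
    · rintro ⟨hy, t, ht, rfl⟩
      refine ⟨⟨t, ⟨ht, ?_⟩, rfl⟩, t, ht, rfl⟩
      simpa [hα t ht] using hy
    · rintro ⟨⟨t, ⟨ht, htT⟩, rfl⟩, -⟩
      refine ⟨?_, t, ht, rfl⟩
      simpa [hα t ht] using htT
  have hαi : InjOn α (Icc (w 0) (w 1)) := by
    rw [← himg]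
    rintro _ ⟨s, hs, rfl⟩ _ ⟨t, ht, rfl⟩ h
    rw [hα s hs, hα t ht] at h
    exact (hiff s hs t ht).2 h
  have := isArc_of_Icc h01 hαc hαi
  rw [hα 0 (by simp), hα 1 (by simp)] at this
  convert this using 1
  rw [← himg, image_image]
  exact image_congr fun t ht => (hα t ht).symm

/-- admissible closed parameter sets -/
def Adm (f : ℝ → X) (A : Set ℝ) : Prop := IsClosed A ∧ A ⊆ Icc 0 1 ∧ 0 ∈ A ∧ 1 ∈ A ∧
  ∀ a ∈ A, ∀ b ∈ A, a < b → (∀ x ∈ A, x ≤ a ∨ b ≤ x) → f a = f b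

lemma adm_near {f : ℝ → X} {A : Set ℝ} (hA : Adm f A) {m : ℝ} (hm : m ∈ Icc (0 : ℝ) 1) :
    ∃ a ∈ A, ∃ b ∈ A, a ≤ m ∧ m ≤ b ∧ f a = f b ∧ (∀ x ∈ A, x ≤ m → x ≤ a) ∧
      (∀ x ∈ A, m ≤ x → b ≤ x) := by
  obtain ⟨hcl, hsub, h0, h1, hgap⟩ := hA
  have hc : IsCompact A := isCompact_Icc.of_isClosed_subset hcl hsub
  have c1 := hc.inter_right (isClosed_Iic (a := m))
  have c2 := hc.inter_right (isClosed_Ici (a := m))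
  have n1 : (A ∩ Iic m).Nonempty := ⟨0, h0, hm.1⟩
  have n2 : (A ∩ Ici m).Nonempty := ⟨1, h1, hm.2⟩
  have m1 := c1.sSup_mem n1
  have m2 := c2.sInf_mem n2
  have b1 : ∀ x ∈ A, x ≤ m → x ≤ sSup (A ∩ Iic m) := fun x hx h => le_csSup c1.bddAbove ⟨hx, h⟩
  have b2 : ∀ x ∈ A, m ≤ x → sInf (A ∩ Ici m) ≤ x := fun x hx h => csInf_le c2.bddBelow ⟨hx, h⟩
  refine ⟨_, m1.1, _, m2.1, m1.2, m2.2, ?_, b1, b2⟩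
  rcases (m1.2.trans m2.2 : sSup (A ∩ Iic m) ≤ sInf (A ∩ Ici m)).eq_or_lt with h | h
  · rw [← h]
  · refine hgap _ m1.1 _ m2.1 h fun x hx => ?_
    rcases le_total x m with h' | h'
    · exact Or.inl (b1 x hx h')
    · exact Or.inr (b2 x hx h')

lemma exists_min_adm {f : ℝ → X} (hf : Continuous f) : ∃ A, Minimal (Adm f) A := by
  refine zorn_superset {A | Adm f A} ?_
  intro c hc hch
  rcases c.eq_empty_or_nonempty with rfl | hne
  · refine ⟨Icc 0 1, ⟨isClosed_Icc, Subset.rfl, by simp, by simp, ?_⟩, by simp⟩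
    intro a ha b hb hab h
    exfalso
    rcases h ((a + b) / 2) ⟨by linarith [ha.1, hb.1], by linarith [ha.2, hb.2]⟩ with h | h <;> linarith
  have hclosed : IsClosed (⋂₀ c) := isClosed_sInter fun s hs => (hc hs).1
  obtain ⟨s0, hs0⟩ := hne
  refine ⟨⋂₀ c, ⟨hclosed, (sInter_subset_of_mem hs0).trans (hc hs0).2.1, fun s hs => (hc hs).2.2.1,
    fun s hs => (hc hs).2.2.2.1, ?_⟩, fun s hs => sInter_subset_of_mem hs⟩
  intro a ha b hb hab hgap
  by_contra hfab
  have hd : 0 < dist (f a) (f b) := dist_pos.2 hfab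
  obtain ⟨δ1, hδ1, h1⟩ := Metric.continuousAt_iff.1 (hf.continuousAt (x := a)) _ (half_pos hd)
  obtain ⟨δ2, hδ2, h2⟩ := Metric.continuousAt_iff.1 (hf.continuousAt (x := b)) _ (half_pos hd)
  set δ := min (min δ1 δ2) ((b - a) / 2) / 2 with hδ
  have hδ0 : 0 < δ := by
    have : 0 < (b - a) / 2 := by linarith
    positivity
  have hδ3 : δ < δ1 := by
    have := (min_le_left (min δ1 δ2) ((b - a) / 2)).trans (min_le_left _ _); rw [hδ]; linarith
  have hδ4 : δ < δ2 := by
    have := (min_le_left (min δ1 δ2) ((b - a) / 2)).trans (min_le_right _ _); rw [hδ]; linarith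
  have hδ5 : δ ≤ (b - a) / 4 := by
    have := (min_le_right (min δ1 δ2) ((b - a) / 2)); rw [hδ]; linarith
  have hs : ∃ s ∈ c, s ∩ Icc (a + δ) (b - δ) = ∅ := by
    by_contra hcon
    push Not at hcon
    haveI : Nonempty ((fun s => s ∩ Icc (a + δ) (b - δ)) '' c) := ⟨⟨_, s0, hs0, rfl⟩⟩
    have hnon := IsCompact.nonempty_sInter_of_directed_nonempty_isCompact_isClosed
      (S := (fun s => s ∩ Icc (a + δ) (b - δ)) '' c) (by
        rintro _ ⟨s, hs, rfl⟩ _ ⟨t, ht, rfl⟩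
        rcases hch.total hs ht with h | h
        · exact ⟨_, ⟨s, hs, rfl⟩, Subset.rfl, inter_subset_inter_left _ h⟩
        · exact ⟨_, ⟨t, ht, rfl⟩, inter_subset_inter_left _ h, Subset.rfl⟩)
      (by rintro _ ⟨s, hs, rfl⟩; exact hcon s hs)
      (by rintro _ ⟨s, hs, rfl⟩; exact isCompact_Icc.inter_left (hc hs).1)
      (by rintro _ ⟨s, hs, rfl⟩; exact (hc hs).1.inter isClosed_Icc)
    obtain ⟨x, hx⟩ := hnon
    have hxc : x ∈ ⋂₀ c := fun s hs => (hx _ ⟨s, hs, rfl⟩).1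
    have hxI : x ∈ Icc (a + δ) (b - δ) := (hx _ ⟨s0, hs0, rfl⟩).2
    rcases hgap x hxc with h | h
    · linarith [hxI.1]
    · linarith [hxI.2]
  obtain ⟨s, hs, hse⟩ := hs
  have hadm := hc hs
  have haI := hadm.2.1 (ha s hs)
  have hbI := hadm.2.1 (hb s hs)
  obtain ⟨a', ha', b', hb', ham, hbm, hab', hA, hB⟩ := adm_near hadm (m := (a + b) / 2)
    ⟨by linarith [haI.1, hbI.1], by linarith [haI.2, hbI.2]⟩
  have e1 : a ≤ a' := hA a (ha s hs) (by linarith)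
  have e2 : b' ≤ b := hB b (hb s hs) (by linarith)
  have e3 : a' < a + δ := by
    by_contra h
    push Not at h
    have : a' ∈ s ∩ Icc (a + δ) (b - δ) := ⟨ha', h, by linarith⟩
    rw [hse] at this; exact this
  have e4 : b - δ < b' := by
    by_contra h
    push Not at h
    have : b' ∈ s ∩ Icc (a + δ) (b - δ) := ⟨hb', by linarith, h⟩
    rw [hse] at this; exact this
  have g1 := h1 (x := a') (by rw [Real.dist_eq, abs_lt]; constructor <;> linarith)
  have g2 := h2 (x := b') (by rw [Real.dist_eq, abs_lt]; constructor <;> linarith)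
  rw [hab'] at g1
  have := dist_triangle_left (f a) (f b) (f b')
  linarith

lemma arc_of_path {f : ℝ → X} (hf : Continuous f) (hne : f 0 ≠ f 1) :
    ∃ A ⊆ f '' Icc 0 1, IsArc A (f 0) (f 1) := by
  obtain ⟨A, hA⟩ := exists_min_adm hf
  have hadm : Adm f A := hA.prop
  have hmin : ∀ s ∈ A, ∀ t ∈ A, s < t → f s = f t → ∀ x ∈ A, x ≤ s ∨ t ≤ x := by
    intro s hs t ht hst hfst x hx
    have hB : Adm f (A \ Ioo s t) := by
      obtain ⟨hcl, hsub, h0, h1, hgap⟩ := hadm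
      refine ⟨hcl.sdiff isOpen_Ioo, diff_subset.trans hsub, ⟨h0, fun h => ?_⟩, ⟨h1, fun h => ?_⟩, ?_⟩
      · linarith [h.1, (hsub hs).1]
      · linarith [h.2, (hsub ht).2]
      · intro a ha b hb hab hg
        by_cases has : a = s
        · subst has
          by_cases hbt : b = t
          · rw [hbt]; exact hfst
          · exfalso
            have hta := hg t ⟨ht, fun h => lt_irrefl _ h.2⟩
            rcases hta with h | h
            · linarith
            · exact hb.2 ⟨hab, lt_of_le_of_ne h hbt⟩
        · refine hgap a ha.1 b hb.1 hab fun y hy => ?_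
          by_cases hyI : y ∈ Ioo s t
          · rcases hg s ⟨hs, fun h => lt_irrefl _ h.1⟩ with h | h
            · rcases hg t ⟨ht, fun h => lt_irrefl _ h.2⟩ with h' | h'
              · left; exact hyI.2.le.trans h'
              · exfalso
                refine ha.2 ⟨lt_of_le_of_ne h (Ne.symm has), lt_of_lt_of_le hab h'⟩
            · right; exact h.trans hyI.1.le
          · exact hg y ⟨hy, hyI⟩
    have := hA.le_of_le hB diff_subset hx
    have h2 : ¬ (s < x ∧ x < t) := this.2
    by_contra hcon
    push Not at hcon
    exact h2 hcon
  let cl : ℝ → ℝ := fun t => max 0 (min 1 t)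
  have hcl : ∀ t, cl t ∈ Icc (0 : ℝ) 1 := fun t => ⟨le_max_left _ _, max_le zero_le_one (min_le_left _ _)⟩
  have hcle : ∀ t ∈ Icc (0 : ℝ) 1, cl t = t := fun t ht => by
    simp only [cl]; rw [min_eq_right ht.2, max_eq_right ht.1]
  choose a ha b hb ham hbm hab hAm hBm using fun t : ℝ => adm_near hadm (hcl t)
  have hclm : ∀ {s t : ℝ}, s ≤ t → cl s ≤ cl t := fun h => max_le_max le_rfl (min_le_min le_rfl h)
  have hmono : ∀ {s t : ℝ}, s ≤ t → a s ≤ a t := fun {s t} h => hAm t _ (ha s) ((ham s).trans (hclm h))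
  have hfun : ∀ s t, s ≤ t → f (a s) = f (a t) ∨
      ∃ x ∈ Icc (cl s) (cl t), ∃ y ∈ Icc (cl s) (cl t), f (a s) = f x ∧ f (a t) = f y := by
    intro s t hst
    rcases (hmono hst).eq_or_lt with h | h
    · left; rw [h]
    · right
      have h1 : cl s ≤ a t := by
        by_contra hcon
        push Not at hcon
        exact absurd (hAm s _ (ha t) hcon.le) (not_le.2 h)
      exact ⟨b s, ⟨hbm s, (hBm s _ (ha t) h1).trans (ham t)⟩, a t, ⟨h1, ham t⟩, hab s, rfl⟩
  have hcont : Continuous (fun t => f (a t)) := by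
    have huc : UniformContinuousOn f (Icc 0 1) :=
      isCompact_Icc.uniformContinuousOn_of_continuous hf.continuousOn
    rw [Metric.uniformContinuousOn_iff] at huc
    have key : ∀ ε > 0, ∃ δ > 0, ∀ s t, s ≤ t → dist (cl s) (cl t) < δ → dist (f (a s)) (f (a t)) < ε := by
      intro ε hε
      obtain ⟨δ, hδ, h⟩ := huc ε hε
      refine ⟨δ, hδ, fun s t hst hd => ?_⟩
      rcases hfun s t hst with h' | ⟨x, hx, y, hy, h1, h2⟩
      · rw [h', dist_self]; exact hε
      · rw [h1, h2]
        refine h x ⟨(hcl s).1.trans hx.1, hx.2.trans (hcl t).2⟩ y ⟨(hcl s).1.trans hy.1, hy.2.trans (hcl t).2⟩ ?_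
        refine lt_of_le_of_lt ?_ hd
        rw [dist_comm (cl s)]
        exact (Real.dist_le_of_mem_Icc hx hy).trans (le_abs_self _)
    rw [Metric.continuous_iff]
    intro t ε hε
    obtain ⟨δ, hδ, h⟩ := key ε hε
    have hclc : Continuous cl := by fun_prop
    obtain ⟨δ', hδ', h'⟩ := Metric.continuous_iff.1 hclc t δ hδ
    refine ⟨δ', hδ', fun s hs => ?_⟩
    rcases le_total s t with hst | hst
    · exact h s t hst (h' s hs)
    · rw [dist_comm]; exact h t s hst (by rw [dist_comm]; exact h' s hs)
  have ea : ∀ t ∈ A, a t = t := fun t ht => by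
    have h1 := hcle t (hadm.2.1 ht)
    exact le_antisymm ((ham t).trans h1.le) (hAm t t ht h1.ge)
  have e0 := ea 0 hadm.2.2.1
  have e1 := ea 1 hadm.2.2.2.1
  have := arc_of_monotone hcont (by rw [e0, e1]; exact hne) ?_
  · rw [e0, e1] at this
    refine ⟨_, ?_, this⟩
    rintro _ ⟨t, -, rfl⟩
    exact ⟨a t, hadm.2.1 (ha t), rfl⟩
  · intro s hs t ht h u hu
    rcases (hmono (hu.1.trans hu.2)).eq_or_lt with h' | h'
    · rw [le_antisymm ((hmono hu.2).trans h'.ge) (hmono hu.1)]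
    · rcases hmin _ (ha s) _ (ha t) h' h (a u) (ha u) with h3 | h3
      · rw [le_antisymm h3 (hmono hu.1)]
      · rw [le_antisymm (hmono hu.2) h3, h]
end patharc

/-- `e` can be reached by a path running in `Ω`. -/
def Acc (Ω : Set ℂ) (e : ℂ) : Prop := ∃ x ∈ Ω, JoinedIn (insert e Ω) e x

lemma acc_of_seq {Ω : Set ℂ} {e : ℂ} (x : ℕ → ℂ) (hx : x 0 ∈ Ω)
    (h : ∀ n : ℕ, JoinedIn (Ω ∩ ball e (1 / ((n : ℝ) + 1))) (x n) (x (n + 1))) : Acc Ω e := by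
  choose γ hγ using h
  let g : ℝ → ℂ := fun t => (γ ⌊t⌋₊).extend (t - ⌊t⌋₊)
  have hext : ∀ (n : ℕ) (t : ℝ), (γ n).extend t ∈ Ω ∩ ball e (1 / ((n : ℝ) + 1)) := by
    intro n t
    have : (γ n).extend t ∈ range (γ n) := by rw [← Path.extend_range]; exact ⟨t, rfl⟩
    obtain ⟨s, hs⟩ := this
    rw [← hs]; exact hγ n s
  have hgf : ∀ (m : ℕ) (t : ℝ), ⌊t⌋₊ = m → g t = (γ m).extend (t - m) := by
    rintro _ t rfl; rfl
  have hg : ∀ n : ℕ, ∀ t ∈ Icc (n : ℝ) (n + 1), g t = (γ n).extend (t - n) := by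
    intro n t ht
    rcases ht.2.eq_or_lt with h | h
    · have hf : ⌊t⌋₊ = n + 1 := by rw [h]; exact_mod_cast Nat.floor_natCast (n + 1)
      rw [hgf _ t hf, h]
      push_cast
      simp
    · have hf : ⌊t⌋₊ = n := by rw [Nat.floor_eq_iff ((Nat.cast_nonneg n).trans ht.1)]; exact ⟨ht.1, h⟩
      exact hgf _ t hf
  have hgc : ∀ n : ℕ, ContinuousOn g (Icc 0 n) := by
    intro n
    induction n with
    | zero => simp
    | succ n ih =>
      have : Icc (0 : ℝ) ((n + 1 : ℕ) : ℝ) = Icc 0 (n : ℝ) ∪ Icc (n : ℝ) (n + 1) := by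
        push_cast; rw [Icc_union_Icc_eq_Icc (Nat.cast_nonneg n) (by linarith)]
      rw [this]
      refine ih.union_of_isClosed ?_ isClosed_Icc isClosed_Icc
      refine ContinuousOn.congr ?_ (hg n)
      exact ((γ n).continuous_extend.comp (by fun_prop)).continuousOn
  have hgm : ∀ t, g t ∈ Ω ∩ ball e (1 / (⌊t⌋₊ + 1)) := fun t => hext _ _
  let h : ℝ → ℂ := fun s => if s = 0 then e else g (1 / s - 1)
  have h0 : h 0 = e := by simp [h]
  have hpos : ∀ s, s ≠ 0 → h s = g (1 / s - 1) := fun s hs => by simp [h, hs]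
  refine ⟨x 0, hx, JoinedIn.ofLine (f := h) ?_ h0 ?_ ?_⟩
  · intro s hs
    rcases hs.1.eq_or_lt with rfl | hs0
    · rw [ContinuousWithinAt, h0, Metric.tendsto_nhdsWithin_nhds]
      intro ε hε
      refine ⟨min (ε / 2) (1 / 2), by positivity, fun {s} hs hd => ?_⟩
      rcases hs.1.eq_or_lt with rfl | hs0
      · rw [h0, dist_self]; exact hε
      rw [hpos s hs0.ne']
      have h1 := (hgm (1 / s - 1)).2
      rw [mem_ball] at h1
      refine h1.trans ?_
      rw [Real.dist_eq, sub_zero, abs_of_pos hs0] at hd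
      have h2 : s < ε / 2 := lt_of_lt_of_le hd (min_le_left _ _)
      have h2' : s < 1 / 2 := lt_of_lt_of_le hd (min_le_right _ _)
      have h3 := Nat.lt_floor_add_one (1 / s - 1)
      have h4 : 1 / (2 * s) ≤ 1 / s - 1 := by
        rw [div_le_iff₀ (by linarith)]
        field_simp
        linarith
      have h5 : 1 / ε < 1 / (2 * s) := one_div_lt_one_div_of_lt (by linarith) (by linarith)
      rw [div_lt_comm₀ (by positivity) hε]
      linarith
    · have hsub : ContinuousOn h (Icc (s / 2) 1) := by
        have : ContinuousOn (fun s => g (1 / s - 1)) (Icc (s / 2) 1) := by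
          obtain ⟨n, hn⟩ := exists_nat_ge (1 / (s / 2))
          refine (hgc n).comp ?_ ?_
          · refine ContinuousOn.sub (ContinuousOn.div continuousOn_const continuousOn_id ?_) continuousOn_const
            intro u hu; have := hu.1; intro h; linarith
          · intro u hu
            have hu0 : 0 < u := lt_of_lt_of_le (by linarith) hu.1
            constructor
            · have : 1 ≤ 1 / u := by rw [le_div_iff₀ hu0]; linarith [hu.2]
              linarith
            · have : 1 / u ≤ 1 / (s / 2) := one_div_le_one_div_of_le (by linarith) hu.1
              linarith
        refine this.congr fun u hu => hpos u ?_
        have := hu.1; intro h; linarith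
      refine (hsub s ⟨by linarith, hs.2⟩).mono_of_mem_nhdsWithin ?_
      rw [mem_nhdsWithin]
      exact ⟨Ioi (s / 2), isOpen_Ioi, by show s / 2 < s; linarith, fun u hu => ⟨le_of_lt hu.1, hu.2.2⟩⟩
  · rw [hpos 1 one_ne_zero]
    have := hg 0 0 (by simp)
    simpa using this
  · rintro _ ⟨s, hs, rfl⟩
    by_cases hs0 : s = 0
    · left; rw [hs0, h0]
    · right; rw [hpos s hs0]; exact (hgm _).1

lemma joinedIn_of_preconn {U C : Set ℂ} (hU : IsOpen U) (hC : IsPreconnected C) (hCU : C ⊆ U) {x y : ℂ}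
    (hx : x ∈ C) (hy : y ∈ C) : JoinedIn U x y := by
  have h1 : IsConnected (connectedComponentIn U x) :=
    isConnected_connectedComponentIn_iff.2 (hCU hx)
  have h2 := (hU.connectedComponentIn.isConnected_iff_isPathConnected).1 h1
  refine (h2.joinedIn x (mem_connectedComponentIn (hCU hx)) y ?_).mono (connectedComponentIn_subset _ _)
  exact hC.subset_connectedComponentIn hx hCU hy

lemma acc_of_local {K Ω : Set ℂ} (hK : IsCompact K) (hΩ : IsOpen Ω) {e : ℂ}
    (hcon : ∀ x ∈ Ω, ∀ y ∈ Ω, Conn K x y) (hcl : ∀ x y, Conn K x y → x ∈ Ω → y ∈ Ω)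
    (he : e ∈ closure Ω)
    (hloc : ∀ ε > 0, ∃ B ⊆ K, IsCompact B ∧ IsPreconnected B ∧ e ∉ B ∧ K \ B ⊆ ball e ε) :
    Acc Ω e := by
  have key : ∀ ε > 0, ∃ δ > 0, ∀ x ∈ Ω ∩ ball e δ, ∀ y ∈ Ω ∩ ball e δ, JoinedIn (Ω ∩ ball e ε) x y := by
    intro ε hε
    obtain ⟨B, hBK, hBc, hBp, heB, hKB⟩ := hloc ε hε
    obtain ⟨δ', hδ', hb⟩ := Metric.isOpen_iff.1 hBc.isClosed.isOpen_compl e heB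
    refine ⟨min δ' ε, by positivity, fun x hx y hy => ?_⟩
    have hsph : IsCompact (sphere e ε) := isCompact_sphere _ _
    have h_meet_eq : K ∩ (B ∪ sphere e ε) = B := by
      apply Subset.antisymm
      · rintro z ⟨hzK, hz | hz⟩
        · exact hz
        · by_contra hzB
          have := hKB ⟨hzK, hzB⟩
          rw [mem_ball] at this
          exact this.ne hz
      · exact fun z hz => ⟨hBK hz, Or.inl hz⟩
    have c2 : Conn (B ∪ sphere e ε) x y := by
      refine ⟨ball e (min δ' ε), (convex_ball _ _).isPreconnected, ?_, hx.2, hy.2⟩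
      rintro z hz (h | h)
      · exact hb (ball_subset_ball (min_le_left _ _) hz) h
      · have : dist z e < ε := ball_subset_ball (min_le_right _ _) hz
        exact this.ne h
    obtain ⟨C, hC, hCK, hxC, hyC⟩ := janiszewski hK (hBc.union hsph) (by rw [h_meet_eq]; exact hBp)
      (hcon x hx.1 y hy.1) c2
    refine joinedIn_of_preconn (hΩ.inter isOpen_ball) hC (subset_inter ?_ ?_) hxC hyC
    · intro z hz
      exact hcl x z ⟨C, hC, fun w hw h => hCK hw (Or.inl h), hxC, hz⟩ hx.1
    · refine hC.subset_left_of_subset_union isOpen_ball (v := (closedBall e ε)ᶜ)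
        isClosed_closedBall.isOpen_compl ?_ ?_ ⟨x, hxC, ball_subset_ball (min_le_right _ _) hx.2⟩
      · rw [disjoint_left]; intro z h1 h2; exact h2 (ball_subset_closedBall h1)
      · intro z hz
        by_contra hcon
        rw [mem_union, not_or, mem_compl_iff, not_not] at hcon
        refine hCK hz (Or.inr (Or.inr ?_))
        have h1 : dist z e ≤ ε := hcon.2
        have h2 : ¬ dist z e < ε := hcon.1
        exact le_antisymm h1 (not_lt.1 h2)
  choose! δ hδ hj using fun n : ℕ => key (1 / ((n : ℝ) + 1)) (by positivity)
  have hex : ∀ n, ∃ x, x ∈ Ω ∩ ball e (min (δ n) (δ (n - 1))) := by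
    intro n
    obtain ⟨y, hy, hd⟩ := Metric.mem_closure_iff.1 he (min (δ n) (δ (n - 1))) (lt_min (hδ _) (hδ _))
    exact ⟨y, hy, by rwa [mem_ball, dist_comm]⟩
  choose x hx using hex
  refine acc_of_seq x (hx 0).1 fun n => hj n _ ⟨(hx n).1, ball_subset_ball (min_le_left _ _) (hx n).2⟩ _
    ⟨(hx (n + 1)).1, ball_subset_ball (min_le_right _ _) (hx (n + 1)).2⟩

lemma acc_join {Ω : Set ℂ} (hΩ : IsOpen Ω) (hpre : IsPreconnected Ω) {p q : ℂ} (hpq : p ≠ q)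
    (hp : Acc Ω p) (hq : Acc Ω q) : ∃ c, IsArc c p q ∧ c \ {p, q} ⊆ Ω := by
  obtain ⟨x, hx, hpx⟩ := hp
  obtain ⟨y, hy, hqy⟩ := hq
  have s1 : insert p Ω ⊆ Ω ∪ {p, q} := by
    rintro z (rfl | h) <;> simp [*]
  have s2 : insert q Ω ⊆ Ω ∪ {p, q} := by
    rintro z (rfl | h) <;> simp [*]
  obtain ⟨γ, hγ⟩ := ((hpx.mono s1).trans ((joinedIn_of_preconn hΩ hpre Subset.rfl hx hy).mono
    subset_union_left)).trans (hqy.mono s2).symm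
  obtain ⟨A, hA, harc⟩ := arc_of_path γ.continuous_extend (by simpa using hpq)
  simp only [Path.extend_zero, Path.extend_one] at harc
  refine ⟨A, harc, ?_⟩
  rintro z ⟨hz, hzn⟩
  obtain ⟨t, ht, rfl⟩ := hA hz
  rw [Path.extend_apply γ ht] at hzn ⊢
  exact (hγ _).resolve_right hzn

lemma IsJordan.acc {J : Set ℂ} (hJ : IsJordan J) {p : ℂ} (hp : p ∈ J) : Acc (ins J) p := by
  refine acc_of_local hJ.isCompact (isOpen_ins hJ.isCompact.isClosed)
    (fun x hx y hy => hJ.conn_ins hx hy) (fun x y h hx => h.ins hx) (hJ.sub_closure.1 hp) ?_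
  intro ε hε
  obtain ⟨B, u, v, hB, hBJ, hpB, hJB, -⟩ := hJ.local_arc hp (ball_mem_nhds p hε)
  exact ⟨B, hBJ, hB.isCompact, hB.isPreconnected, hpB, hJB⟩

/-- crosscuts exist -/
lemma IsJordan.crosscut {J : Set ℂ} (hJ : IsJordan J) {p q : ℂ} (hp : p ∈ J) (hq : q ∈ J)
    (hpq : p ≠ q) : ∃ c, IsArc c p q ∧ c \ {p, q} ⊆ ins J :=
  acc_join (isOpen_ins hJ.isCompact.isClosed) hJ.isPreconnected_ins hpq (hJ.acc hp) (hJ.acc hq)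

lemma IsArc.local_tip {E : Set ℂ} {p e : ℂ} (hE : IsArc E p e) {N : Set ℂ} (hN : N ∈ 𝓝 e) :
    ∃ B u, IsArc B p u ∧ B ⊆ E ∧ e ∉ B ∧ E \ B ⊆ N := by
  obtain ⟨γ, hc, hi, h0, h1, rfl⟩ := hE
  have hcw : ContinuousWithinAt γ (Icc 0 1) 1 := hc 1 (by simp)
  rw [ContinuousWithinAt, h1] at hcw
  obtain ⟨ε, hε, hb⟩ := Metric.mem_nhdsWithin_iff.1 (hcw hN)
  set δ := min (ε / 2) (1 / 2) with hδ
  have hδ0 : 0 < δ := by positivity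
  have hδ1 : δ ≤ 1 / 2 := min_le_right _ _
  have hδ2 : δ ≤ ε / 2 := min_le_left _ _
  have hsub : Icc (0 : ℝ) (1 - δ) ⊆ Icc 0 1 := Icc_subset_Icc le_rfl (by linarith)
  have := isArc_of_Icc (show (0 : ℝ) < 1 - δ by linarith) (hc.mono hsub) (hi.mono hsub)
  rw [h0] at this
  refine ⟨_, _, this, image_mono hsub, ?_, ?_⟩
  · rintro ⟨t, ht, h⟩
    have := hi (hsub ht) (by simp) (h.trans h1.symm)
    linarith [ht.2]
  · rintro _ ⟨⟨t, ht, rfl⟩, hn⟩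
    refine hb ⟨?_, ht⟩
    have : 1 - δ < t := by
      by_contra h
      push Not at h
      exact hn ⟨t, ⟨ht.1, h⟩, rfl⟩
    rw [mem_ball, Real.dist_eq, abs_lt]
    constructor <;> linarith [ht.2]

/-- Extending an inner arc `E` of the curve `J` to a crosscut ending at `q`. -/
lemma extend_tip {J E : Set ℂ} {p e q : ℂ} (hJ : IsJordan J) (hE : IsArc E p e) (hp : p ∈ J)
    (hEJ : E \ {p} ⊆ ins J) (hq : q ∈ J) (hpq : p ≠ q) :
    ∃ F, IsArc F e q ∧ F \ {e, q} ⊆ ins J \ E := by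
  have hei : e ∈ ins J := hEJ ⟨hE.right_mem, hE.ne.symm⟩
  have hJE : J ∩ E = {p} := by
    apply Subset.antisymm
    · rintro z ⟨hzJ, hzE⟩
      by_contra hzp
      exact (hEJ ⟨hzE, hzp⟩).1 hzJ
    · rintro _ rfl; exact ⟨hp, hE.left_mem⟩
  have hqE : q ∉ E := fun h => hpq (hJE ▸ (⟨hq, h⟩ : q ∈ J ∩ E) : q ∈ ({p} : Set ℂ)).symm
  have hΩ : IsOpen (ins J \ E) := (isOpen_ins hJ.isCompact.isClosed).sdiff hE.isCompact.isClosed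
  have hcon : ∀ x ∈ ins J \ E, ∀ y ∈ ins J \ E, Conn (J ∪ E) x y := fun x hx y hy =>
    janiszewski hJ.isCompact hE.isCompact (by rw [hJE]; exact isPreconnected_singleton)
      (hJ.conn_ins hx.1 hy.1) (hE.conn hx.2 hy.2)
  have hcl : ∀ x y, Conn (J ∪ E) x y → x ∈ ins J \ E → y ∈ ins J \ E := fun x y h hx =>
    ⟨(h.mono subset_union_left).ins hx.1, (h.mono subset_union_right).symm.notMem_left⟩
  have hK := hJ.isCompact.union hE.isCompact
  refine acc_join hΩ (isPreconnected_of_conn hcon hcl) (fun h => hei.1 (h ▸ hq)) ?_ ?_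
  · refine acc_of_local hK hΩ hcon hcl ?_ ?_
    · rw [Metric.mem_closure_iff]
      intro ε hε
      obtain ⟨ρ, hρ, hb⟩ := Metric.isOpen_iff.1 (isOpen_ins hJ.isCompact.isClosed) e hei
      set r := min ε ρ / 2 with hr
      have hr0 : 0 < r := by positivity
      have hr1 : r < ε := by rw [hr]; linarith [min_le_left ε ρ, lt_min hε hρ]
      have hr2 : r < ρ := by rw [hr]; linarith [min_le_right ε ρ, lt_min hε hρ]
      obtain ⟨B, u, hB, hBE, heB, hEB⟩ := hE.local_tip (ball_mem_nhds e hr0)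
      have : ∃ z ∈ sphere e r, z ∉ E := by
        by_contra hcon
        push Not at hcon
        have hsB : sphere e r ⊆ B := by
          intro z hz
          by_contra hzB
          have : dist z e < r := hEB ⟨hcon z hz, hzB⟩
          exact this.ne hz
        have h1 : HasLog (fun z => z - e) B := hasLog_arc hB (by fun_prop) (fun z hz h =>
          heB (by rwa [← sub_eq_zero.1 h]))
        exact not_hasLog_circle e r hr0 1 one_ne_zero ((h1.mono hsB).congr (by simp))
      obtain ⟨z, hz, hzE⟩ := this
      have hz' : dist z e = r := hz
      exact ⟨z, ⟨hb (by rw [mem_ball, hz']; exact hr2), hzE⟩, by rw [dist_comm, hz']; exact hr1⟩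
    · intro ε hε
      obtain ⟨B, u, hB, hBE, heB, hEB⟩ := hE.local_tip (ball_mem_nhds e hε)
      refine ⟨J ∪ B, union_subset_union_right _ hBE, hJ.isCompact.union hB.isCompact,
        hJ.isPreconnected.union p hp hB.left_mem hB.isPreconnected, ?_, ?_⟩
      · rintro (h | h)
        exacts [hei.1 h, heB h]
      · rintro z ⟨hz | hz, hzn⟩
        · exact absurd (Or.inl hz) hzn
        · exact hEB ⟨hz, fun h => hzn (Or.inr h)⟩
  · refine acc_of_local hK hΩ hcon hcl ?_ ?_
    · rw [_root_.mem_closure_iff]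
      intro N hN hqN
      obtain ⟨z, hz⟩ := _root_.mem_closure_iff.1 (hJ.sub_closure.1 hq) (N ∩ Eᶜ)
        (hN.inter hE.isCompact.isClosed.isOpen_compl) ⟨hqN, hqE⟩
      exact ⟨z, hz.1.1, hz.2, hz.1.2⟩
    · intro ε hε
      obtain ⟨B, u, v, hB, hBJ, hqB, hJB, -⟩ := hJ.local_arc hq
        (inter_mem (ball_mem_nhds q hε) (hE.isCompact.isClosed.isOpen_compl.mem_nhds hqE))
      have hpB : p ∈ B := by
        by_contra h
        exact (hJB ⟨hp, h⟩).2 hE.left_mem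
      refine ⟨B ∪ E, union_subset_union_left _ hBJ, hB.isCompact.union hE.isCompact,
        hB.isPreconnected.union p hpB hE.left_mem hE.isPreconnected, ?_, ?_⟩
      · rintro (h | h)
        exacts [hqB h, hqE h]
      · rintro z ⟨hz | hz, hzn⟩
        · exact (hJB ⟨hz, fun h => hzn (Or.inl h)⟩).1
        · exact absurd (Or.inr hz) hzn

/-- The closed region bounded by `J`. -/
def dsk (J : Set ℂ) : Set ℂ := J ∪ ins J

/-- A simple closed curve in `ℂ × ℂ` whose two projections are simple closed curves. -/
structure CP (Γ : Set (ℂ × ℂ)) : Prop where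
  jord : IsJordan Γ
  inj1 : InjOn Prod.fst Γ
  inj2 : InjOn Prod.snd Γ

/-- One of the two coordinate projections. -/
def IsProj (π : ℂ × ℂ → ℂ) : Prop := π = Prod.fst ∨ π = Prod.snd

lemma IsProj.cont {π : ℂ × ℂ → ℂ} (h : IsProj π) : Continuous π := by
  rcases h with rfl | rfl
  exacts [continuous_fst, continuous_snd]

lemma CP.inj {Γ : Set (ℂ × ℂ)} (h : CP Γ) {π : ℂ × ℂ → ℂ} (hπ : IsProj π) : InjOn π Γ := by
  rcases hπ with rfl | rfl
  exacts [h.inj1, h.inj2]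

lemma CP.jordan {Γ : Set (ℂ × ℂ)} (h : CP Γ) {π : ℂ × ℂ → ℂ} (hπ : IsProj π) : IsJordan (π '' Γ) :=
  h.jord.image hπ.cont.continuousOn (h.inj hπ)

lemma isCompact_dsk {J : Set ℂ} (hJ : IsCompact J) : IsCompact (dsk J) := by
  have h1 : IsClosed (dsk J) := by
    rw [← closure_subset_iff_isClosed, dsk, closure_union, hJ.isClosed.closure_eq, union_comm J (ins J)]
    exact union_subset subset_union_right (closure_ins_sub hJ.isClosed)
  exact Metric.isCompact_of_isClosed_isBounded h1 (hJ.isBounded.union (ins_bounded hJ))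

lemma IsJordan.dsk_sub_closure {J : Set ℂ} (hJ : IsJordan J) : dsk J ⊆ closure (ins J) :=
  union_subset hJ.sub_closure.1 subset_closure

/-- The regions bounded by the members of `L` tile that of `Γ0`. -/
structure Part (π : ℂ × ℂ → ℂ) (Γ0 : Set (ℂ × ℂ)) (L : Set (Set (ℂ × ℂ))) : Prop where
  cover : ⋃ Γ ∈ L, dsk (π '' Γ) = dsk (π '' Γ0)
  sep : ∀ Γ ∈ L, ∀ Γ' ∈ L, Γ ≠ Γ' → dsk (π '' Γ) ∩ dsk (π '' Γ') ⊆ π '' (Γ ∩ Γ')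

/-- Subdivisions of the pair of regions of `Γ0`. -/
structure IsSub (Γ0 : Set (ℂ × ℂ)) (L : Set (Set (ℂ × ℂ))) : Prop where
  fin : L.Finite
  cp : ∀ Γ ∈ L, CP Γ
  part : ∀ π, IsProj π → Part π Γ0 L
  bdry : Γ0 ⊆ ⋃₀ L

lemma IsSub.sub {Γ0 : Set (ℂ × ℂ)} {L : Set (Set (ℂ × ℂ))} (h : IsSub Γ0 L) {π : ℂ × ℂ → ℂ} (hπ : IsProj π)
    {Γ : Set (ℂ × ℂ)} (hΓ : Γ ∈ L) : dsk (π '' Γ) ⊆ dsk (π '' Γ0) := by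
  rw [← (h.part π hπ).cover]
  exact subset_biUnion_of_mem (u := fun Γ => dsk (π '' Γ)) hΓ

lemma isSub_self {Γ : Set (ℂ × ℂ)} (h : CP Γ) : IsSub Γ {Γ} where
  fin := finite_singleton _
  cp := by rintro _ rfl; exact h
  part := fun π _ => ⟨by simp, by rintro _ rfl _ rfl h; exact absurd rfl h⟩
  bdry := by simp

lemma IsSub.refine {Γ0 : Set (ℂ × ℂ)} {L : Set (Set (ℂ × ℂ))} (h : IsSub Γ0 L)
    (M : Set (ℂ × ℂ) → Set (Set (ℂ × ℂ))) (hM : ∀ Γ ∈ L, IsSub Γ (M Γ)) :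
    IsSub Γ0 (⋃ Γ ∈ L, M Γ) where
  fin := h.fin.biUnion fun Γ hΓ => (hM Γ hΓ).fin
  cp := by
    intro Γ' h'
    simp only [mem_iUnion] at h'
    obtain ⟨Γ, hΓ, h'⟩ := h'
    exact (hM Γ hΓ).cp _ h'
  bdry := by
    intro z hz
    obtain ⟨Γ, hΓ, hz⟩ := h.bdry hz
    obtain ⟨Γ', hΓ', hz⟩ := (hM Γ hΓ).bdry hz
    exact ⟨Γ', by simp only [mem_iUnion]; exact ⟨Γ, hΓ, hΓ'⟩, hz⟩
  part := by
    intro π hπ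
    constructor
    · rw [← (h.part π hπ).cover]
      simp only [biUnion_iUnion]
      refine iUnion₂_congr fun Γ hΓ => ?_
      exact ((hM Γ hΓ).part π hπ).cover
    · have key : ∀ Γ ∈ L, ∀ Γ1 ∈ M Γ, ∀ w ∈ Γ, π w ∈ dsk (π '' Γ1) → w ∈ Γ1 := by
        intro Γ hΓ Γ1 h1 w hw hd
        obtain ⟨Γ3, h3, hw3⟩ := (hM Γ hΓ).bdry hw
        by_cases he : Γ1 = Γ3
        · rwa [he]
        obtain ⟨w', hw', he'⟩ := ((hM Γ hΓ).part π hπ).sep _ h1 _ h3 he ⟨hd, Or.inl ⟨w, hw3, rfl⟩⟩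
        rw [← ((hM Γ hΓ).cp _ h3).inj hπ hw'.2 hw3 he']
        exact hw'.1
      intro Γ1 h1 Γ2 h2 hne
      simp only [mem_iUnion] at h1 h2
      obtain ⟨Γ, hΓ, h1⟩ := h1
      obtain ⟨Γ', hΓ', h2⟩ := h2
      by_cases he : Γ = Γ'
      · subst he
        exact ((hM Γ hΓ).part π hπ).sep _ h1 _ h2 hne
      rintro x ⟨hx1, hx2⟩
      obtain ⟨w, ⟨hw, hw'⟩, rfl⟩ := (h.part π hπ).sep _ hΓ _ hΓ' he
        ⟨(hM Γ hΓ).sub hπ h1 hx1, (hM Γ' hΓ').sub hπ h2 hx2⟩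
      exact ⟨w, ⟨key Γ hΓ Γ1 h1 w hw hx1, key Γ' hΓ' Γ2 h2 w hw' hx2⟩, rfl⟩

lemma theta_dsk {A B c : Set ℂ} {p q : ℂ} (hA : IsArc A p q) (hB : IsArc B p q) (hc : IsArc c p q)
    (hAB : A ∩ B = {p, q}) (hcJ : c \ {p, q} ⊆ ins (A ∪ B)) :
    dsk (A ∪ c) ∪ dsk (B ∪ c) = dsk (A ∪ B) ∧ dsk (A ∪ c) ∩ dsk (B ∪ c) ⊆ c := by
  obtain ⟨h1, h2, h3, h4⟩ := theta hA hB hc hAB hcJ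
  have hpq : ∀ z ∈ ({p, q} : Set ℂ), z ∈ c := by
    rintro z (rfl | rfl)
    exacts [hc.left_mem, hc.right_mem]
  have hpq' : ∀ z ∈ ({p, q} : Set ℂ), z ∈ A := fun z hz => by rw [← hAB] at hz; exact hz.1
  constructor
  · apply Subset.antisymm
    · have hi : ∀ z, z ∈ ins (A ∪ c) ∪ ins (B ∪ c) → z ∈ dsk (A ∪ B) := fun z hz => by
        rw [h1] at hz; exact Or.inr hz.1
      have hcc : ∀ z ∈ c, z ∈ dsk (A ∪ B) := fun z hz => by
        by_cases h : z ∈ ({p, q} : Set ℂ)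
        · exact Or.inl (Or.inl (hpq' z h))
        · exact Or.inr (hcJ ⟨hz, h⟩)
      rintro z (((h | h) | h) | ((h | h) | h))
      exacts [Or.inl (Or.inl h), hcc z h, hi z (Or.inl h), Or.inl (Or.inr h), hcc z h, hi z (Or.inr h)]
    · rintro z ((h | h) | h)
      · exact Or.inl (Or.inl (Or.inl h))
      · exact Or.inr (Or.inl (Or.inl h))
      · by_cases hz : z ∈ c
        · exact Or.inl (Or.inl (Or.inr hz))
        · have : z ∈ ins (A ∪ c) ∪ ins (B ∪ c) := by rw [h1]; exact ⟨h, hz⟩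
          rcases this with h | h
          exacts [Or.inl (Or.inr h), Or.inr (Or.inr h)]
  · have hA' : ∀ z ∈ A, z ∈ ins (B ∪ c) → z ∈ c := fun z hz hi => by
      by_cases h : z ∈ ({p, q} : Set ℂ)
      · exact hpq z h
      · exact (not_ins_out hi (h3 ⟨hz, h⟩)).elim
    have hB' : ∀ z ∈ B, z ∈ ins (A ∪ c) → z ∈ c := fun z hz hi => by
      by_cases h : z ∈ ({p, q} : Set ℂ)
      · exact hpq z h
      · exact (not_ins_out hi (h4 ⟨hz, h⟩)).elim
    rintro z ⟨(h | h) | h, (h' | h') | h'⟩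
    · exact hpq z (by rw [← hAB]; exact ⟨h, h'⟩)
    · exact h'
    · exact hA' z h h'
    · exact h
    · exact h
    · exact h
    · exact hB' z h' h
    · exact h'
    · have : z ∈ ins (A ∪ c) ∩ ins (B ∪ c) := ⟨h, h'⟩
      rw [h2] at this
      exact this.elim

lemma cut_facts {π : ℂ × ℂ → ℂ} {A B c : Set (ℂ × ℂ)} {p q : ℂ × ℂ}
    (hA : IsArc A p q) (hc : IsArc c p q)
    (hinj : InjOn π (A ∪ B)) (hinjc : InjOn π c) (hcJ : π '' c \ {π p, π q} ⊆ ins (π '' (A ∪ B))) :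
    A ∩ c = {p, q} ∧ InjOn π (A ∪ c) := by
  have key : ∀ z ∈ c, π z ∈ π '' (A ∪ B) → z = p ∨ z = q := by
    intro z hz h
    by_contra hn
    push Not at hn
    refine (hcJ ⟨⟨z, hz, rfl⟩, ?_⟩).1 h
    rintro (h | h)
    · exact hn.1 (hinjc hz hc.left_mem h)
    · exact hn.2 (hinjc hz hc.right_mem h)
  have key2 : ∀ x ∈ A, ∀ y ∈ c, π x = π y → x = y := by
    intro x hx y hy h
    have : y ∈ A := by
      rcases key y hy ⟨x, Or.inl hx, h⟩ with rfl | rfl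
      exacts [hA.left_mem, hA.right_mem]
    exact hinj (Or.inl hx) (Or.inl this) h
  constructor
  · apply Subset.antisymm
    · rintro z ⟨hzA, hzc⟩
      exact key z hzc ⟨z, Or.inl hzA, rfl⟩
    · rintro z (rfl | rfl)
      exacts [⟨hA.left_mem, hc.left_mem⟩, ⟨hA.right_mem, hc.right_mem⟩]
  · rintro x (hx | hx) y (hy | hy) h
    · exact hinj (Or.inl hx) (Or.inl hy) h
    · exact key2 x hx y hy h
    · exact (key2 y hy x hx h.symm).symm
    · exact hinjc hx hy h

/-- Cutting a pair of regions along a pair of crosscuts. -/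
lemma cut_pair {A B c : Set (ℂ × ℂ)} {p q : ℂ × ℂ}
    (hA : IsArc A p q) (hB : IsArc B p q) (hc : IsArc c p q) (hAB : A ∩ B = {p, q})
    (hinj : ∀ π, IsProj π → InjOn π (A ∪ B)) (hinjc : ∀ π, IsProj π → InjOn π c)
    (hcJ : ∀ π, IsProj π → π '' c \ {π p, π q} ⊆ ins (π '' (A ∪ B))) :
    IsSub (A ∪ B) {A ∪ c, B ∪ c} := by
  have fA := fun π hπ => cut_facts hA hc (hinj π hπ) (hinjc π hπ) (hcJ π hπ)
  have fB := fun π hπ => cut_facts hB hc (B := A) (by rw [union_comm]; exact hinj π hπ) (hinjc π hπ)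
    (by rw [union_comm]; exact hcJ π hπ)
  have i1 : IsProj Prod.fst := Or.inl rfl
  have i2 : IsProj Prod.snd := Or.inr rfl
  refine ⟨by simp, ?_, ?_, ?_⟩
  · rintro _ (rfl | rfl)
    · exact ⟨isJordan_of_arcs hA hc (fA _ i1).1, (fA _ i1).2, (fA _ i2).2⟩
    · exact ⟨isJordan_of_arcs hB hc (fB _ i1).1, (fB _ i1).2, (fB _ i2).2⟩
  · intro π hπ
    have hπc := hπ.cont.continuousOn (s := A)
    have hAi := (hinj π hπ).mono (show A ⊆ A ∪ B from subset_union_left)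
    have hBi := (hinj π hπ).mono (show B ⊆ A ∪ B from subset_union_right)
    have hi : π '' A ∩ π '' B = {π p, π q} := by
      rw [← (hinj π hπ).image_inter subset_union_left subset_union_right, hAB, image_pair]
    obtain ⟨t1, t2⟩ := theta_dsk (hA.image hπ.cont.continuousOn hAi)
      (hB.image hπ.cont.continuousOn hBi) (hc.image hπ.cont.continuousOn (hinjc π hπ)) hi
      (by rw [← image_union]; exact hcJ π hπ)
    simp only [← image_union] at t1 t2
    constructor
    · rw [biUnion_pair, t1]
    · have s1 : c ⊆ (A ∪ c) ∩ (B ∪ c) := subset_inter subset_union_right subset_union_right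
      rintro _ (rfl | rfl) _ (rfl | rfl) hne
      · exact absurd rfl hne
      · exact t2.trans (image_mono s1)
      · rw [inter_comm, inter_comm (B ∪ c)]; exact t2.trans (image_mono s1)
      · exact absurd rfl hne
  · rintro z (h | h)
    exacts [⟨_, Or.inl rfl, Or.inl h⟩, ⟨_, Or.inr rfl, Or.inl h⟩]

/-- Combine two arcs to an arc in the product. -/
lemma pair_arc {c1 c2 : Set ℂ} {p q : ℂ × ℂ} (h1 : IsArc c1 p.1 q.1) (h2 : IsArc c2 p.2 q.2) :
    ∃ c, IsArc c p q ∧ InjOn Prod.fst c ∧ InjOn Prod.snd c ∧ Prod.fst '' c = c1 ∧ Prod.snd '' c = c2 := by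
  obtain ⟨γ, hc, hi, h0, h1, rfl⟩ := h1
  obtain ⟨γ', hc', hi', h0', h1', rfl⟩ := h2
  refine ⟨(fun t => (γ t, γ' t)) '' Icc 0 1, ⟨_, hc.prodMk hc', ?_, ?_, ?_, rfl⟩, ?_, ?_, ?_, ?_⟩
  · intro s hs t ht h
    exact hi hs ht (congrArg Prod.fst h)
  · exact Prod.ext h0 h0'
  · exact Prod.ext h1 h1'
  · rintro _ ⟨s, hs, rfl⟩ _ ⟨t, ht, rfl⟩ h
    rw [hi hs ht h]
  · rintro _ ⟨s, hs, rfl⟩ _ ⟨t, ht, rfl⟩ h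
    rw [hi' hs ht h]
  · rw [image_image]
  · rw [image_image]

/-- The union of the projections of the curves of `L`. -/
def skel (π : ℂ × ℂ → ℂ) (L : Set (Set (ℂ × ℂ))) : Set ℂ := ⋃ Γ ∈ L, π '' Γ

lemma cut_both {Γ : Set (ℂ × ℂ)} (hΓ : CP Γ) {p q : ℂ × ℂ} (hp : p ∈ Γ) (hq : q ∈ Γ) {c1 c2 : Set ℂ}
    (h1 : IsArc c1 p.1 q.1) (h2 : IsArc c2 p.2 q.2) (hc1 : c1 \ {p.1, q.1} ⊆ ins (Prod.fst '' Γ))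
    (hc2 : c2 \ {p.2, q.2} ⊆ ins (Prod.snd '' Γ)) :
    ∃ L, IsSub Γ L ∧ skel Prod.fst L = Prod.fst '' Γ ∪ c1 ∧ skel Prod.snd L = Prod.snd '' Γ ∪ c2 := by
  have hpq : p ≠ q := fun h => h1.ne (by rw [h])
  obtain ⟨A, B, hA, hB, rfl, hAB⟩ := hΓ.jord.split hp hq hpq
  obtain ⟨c, hc, hi1, hi2, rfl, rfl⟩ := pair_arc h1 h2
  refine ⟨_, cut_pair hA hB hc hAB (fun π hπ => hΓ.inj hπ) ?_ ?_, ?_, ?_⟩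
  · rintro _ (rfl | rfl)
    exacts [hi1, hi2]
  · rintro _ (rfl | rfl)
    exacts [hc1, hc2]
  · rw [skel, biUnion_pair, ← image_union, ← image_union]; congr 1
    ext z; simp only [mem_union]; tauto
  · rw [skel, biUnion_pair, ← image_union, ← image_union]; congr 1
    ext z; simp only [mem_union]; tauto

lemma cut_one {Γ : Set (ℂ × ℂ)} (hΓ : CP Γ) {π : ℂ × ℂ → ℂ} (hπ : IsProj π) {p q : ℂ} (hp : p ∈ π '' Γ)
    (hq : q ∈ π '' Γ) {c : Set ℂ} (hc : IsArc c p q) (hcJ : c \ {p, q} ⊆ ins (π '' Γ)) :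
    ∃ L, IsSub Γ L ∧ skel π L = π '' Γ ∪ c := by
  obtain ⟨p, hp, rfl⟩ := hp
  obtain ⟨q, hq, rfl⟩ := hq
  have hpq : p ≠ q := fun h => hc.ne (by rw [h])
  rcases hπ with rfl | rfl
  · obtain ⟨c2, h2, hc2⟩ := (hΓ.jordan (Or.inr rfl)).crosscut (mem_image_of_mem _ hp) (mem_image_of_mem _ hq)
      (fun h => hpq (hΓ.inj2 hp hq h))
    obtain ⟨L, h, h', -⟩ := cut_both hΓ hp hq hc h2 hcJ hc2
    exact ⟨L, h, h'⟩
  · obtain ⟨c2, h2, hc2⟩ := (hΓ.jordan (Or.inl rfl)).crosscut (mem_image_of_mem _ hp) (mem_image_of_mem _ hq)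
      (fun h => hpq (hΓ.inj1 hp hq h))
    obtain ⟨L, h, -, h'⟩ := cut_both hΓ hp hq h2 hc hc2 hcJ
    exact ⟨L, h, h'⟩

lemma IsSub.ins_skel {Γ0 : Set (ℂ × ℂ)} {L : Set (Set (ℂ × ℂ))} (h : IsSub Γ0 L) {π : ℂ × ℂ → ℂ}
    (hπ : IsProj π) {Γ : Set (ℂ × ℂ)} (hΓ : Γ ∈ L) : Disjoint (ins (π '' Γ)) (skel π L) := by
  rw [disjoint_left]
  intro z hz hs
  simp only [skel, mem_iUnion] at hs
  obtain ⟨Γ', hΓ', hz'⟩ := hs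
  by_cases he : Γ = Γ'
  · subst he; exact hz.1 hz'
  · exact hz.1 (image_mono inter_subset_left ((h.part π hπ).sep _ hΓ _ hΓ' he ⟨Or.inr hz, Or.inl hz'⟩))

lemma IsSub.bdry_skel {Γ0 : Set (ℂ × ℂ)} {L : Set (Set (ℂ × ℂ))} (h : IsSub Γ0 L) (π : ℂ × ℂ → ℂ) :
    π '' Γ0 ⊆ skel π L := by
  rintro _ ⟨z, hz, rfl⟩
  obtain ⟨Γ, hΓ, hz⟩ := h.bdry hz
  exact mem_biUnion hΓ ⟨z, hz, rfl⟩

lemma IsSub.cut {Γ0 : Set (ℂ × ℂ)} {L : Set (Set (ℂ × ℂ))} (h : IsSub Γ0 L) {π : ℂ × ℂ → ℂ} (hπ : IsProj π)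
    {p q : ℂ} {c : Set ℂ} (hc : IsArc c p q) (hp : p ∈ skel π L) (hq : q ∈ skel π L)
    (hcJ : c \ {p, q} ⊆ dsk (π '' Γ0) \ skel π L) :
    ∃ L', IsSub Γ0 L' ∧ skel π L' = skel π L ∪ c := by
  classical
  obtain ⟨hpre, ⟨z0, hz0⟩, hcl⟩ := hc.open_part
  have hmem : ∀ z ∈ c \ {p, q}, ∃ Γ ∈ L, z ∈ ins (π '' Γ) := by
    intro z hz
    have h1 := (hcJ hz).1
    rw [← (h.part π hπ).cover] at h1
    simp only [mem_iUnion] at h1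
    obtain ⟨Γ, hΓ, h1⟩ := h1
    exact ⟨Γ, hΓ, h1.resolve_left fun h2 => (hcJ hz).2 (mem_biUnion hΓ h2)⟩
  obtain ⟨Γ, hΓ, hzΓ⟩ := hmem z0 hz0
  have hJ := (h.cp _ hΓ).jordan hπ
  have hopen : ∀ Γ ∈ L, IsOpen (ins (π '' Γ)) := fun Γ hΓ =>
    isOpen_ins ((h.cp _ hΓ).jordan hπ).isCompact.isClosed
  have hcΓ : c \ {p, q} ⊆ ins (π '' Γ) := by
    refine hpre.subset_left_of_subset_union (hopen _ hΓ) (v := ⋃ Γ' ∈ L \ {Γ}, ins (π '' Γ'))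
      (isOpen_biUnion fun Γ' h' => hopen _ h'.1) ?_ ?_ ⟨z0, hz0, hzΓ⟩
    · rw [disjoint_left]
      intro z h1 h2
      simp only [mem_iUnion] at h2
      obtain ⟨Γ', hΓ', h2⟩ := h2
      exact h1.1 (image_mono inter_subset_left ((h.part π hπ).sep _ hΓ _ hΓ'.1 (fun h => hΓ'.2 h.symm)
        ⟨Or.inr h1, Or.inr h2⟩))
    · intro z hz
      obtain ⟨Γ', hΓ', hz'⟩ := hmem z hz
      by_cases he : Γ' = Γ
      · left; rwa [← he]
      · right; exact mem_biUnion (show Γ' ∈ L \ {Γ} from ⟨hΓ', he⟩) hz'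
  have hend : ∀ e ∈ c, e ∈ skel π L → e ∈ π '' Γ := by
    intro e hec hes
    rcases closure_ins_sub hJ.isCompact.isClosed (closure_mono hcΓ (hcl hec)) with h1 | h1
    · exact absurd hes (disjoint_left.1 (h.ins_skel hπ hΓ) h1)
    · exact h1
  obtain ⟨L1, hL1, hs1⟩ := cut_one (h.cp _ hΓ) hπ (hend p hc.left_mem hp) (hend q hc.right_mem hq) hc hcΓ
  refine ⟨_, h.refine (fun Γ' => if Γ' = Γ then L1 else {Γ'}) ?_, ?_⟩
  · intro Γ' hΓ'
    by_cases he : Γ' = Γ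
    · subst he; simpa using hL1
    · simpa [he] using isSub_self (h.cp _ hΓ')
  · have hsk : ∀ Γ', skel π (if Γ' = Γ then L1 else {Γ'}) = π '' Γ' ∪ (if Γ' = Γ then c else ∅) := by
      intro Γ'
      by_cases he : Γ' = Γ
      · subst he; simpa using hs1
      · simp [he, skel]
    have : skel π (⋃ Γ' ∈ L, (if Γ' = Γ then L1 else {Γ'})) =
        ⋃ Γ' ∈ L, skel π (if Γ' = Γ then L1 else {Γ'}) := by
      simp only [skel, biUnion_iUnion]
    rw [this]
    simp only [hsk]
    apply Subset.antisymm
    · refine iUnion₂_subset fun Γ' hΓ' => union_subset ?_ ?_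
      · exact subset_union_of_subset_left (subset_biUnion_of_mem (u := fun Γ => π '' Γ) hΓ') _
      · split_ifs
        · exact subset_union_right
        · exact empty_subset _
    · refine union_subset ?_ ?_
      · refine iUnion₂_subset fun Γ' hΓ' => ?_
        exact subset_iUnion₂_of_subset Γ' hΓ' subset_union_left
      · refine subset_iUnion₂_of_subset Γ hΓ ?_
        simp

lemma conn_strip {J : Set ℂ} (hJ : IsJordan J) {w : ℂ} (hw : ‖w‖ = 1) (c : ℝ) {δ : ℝ} (hδ : 0 < δ) :
    ∃ η > 0, ∀ x ∈ ins J, ∀ y ∈ ins J, (w * x).re < c - δ → c + δ < (w * y).re → ∀ K, IsCompact K →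
      (∀ z ∈ K, (w * z).re = c ∧ ∃ p ∈ J, dist z p < η) → Conn (J ∪ K) x y := by
  classical
  obtain ⟨η1, hη1, hulc⟩ := hJ.ulc (half_pos hδ)
  refine ⟨min (η1 / 4) (δ / 4), by positivity, fun x hx y hy hxc hyc K hK hKJ => ?_⟩
  have hre : ∀ a b : ℂ, |(w * a).re - (w * b).re| ≤ dist a b := by
    intro a b
    rw [← Complex.sub_re, ← mul_sub]
    refine (Complex.abs_re_le_norm _).trans ?_
    rw [norm_mul, hw, one_mul, dist_eq_norm]
  have hxK : x ∉ J ∪ K := by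
    rintro (h | h)
    · exact hx.1 h
    · linarith [(hKJ x h).1]
  have hyK : y ∉ J ∪ K := by
    rintro (h | h)
    · exact hy.1 h
    · linarith [(hKJ y h).1]
  refine conn_of_hasLog (hJ.isCompact.union hK) hxK hyK ?_
  obtain ⟨φ, hφc, hφ⟩ := hasLog_of_conn hJ.isCompact (hJ.conn_ins hx hy)
  let S : Set ℂ := {z | |(w * z).re - c| < δ}
  let g : ℂ → ℂ := fun z => Complex.log ((z - x) * w) - Complex.log ((y - z) * w) + Real.pi * Complex.I
  have hS1 : ∀ z ∈ S, 0 < ((z - x) * w).re := by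
    intro z hz
    have h1 := (abs_lt.1 (show |(w * z).re - c| < δ from hz)).1
    rw [mul_comm, mul_sub, Complex.sub_re]; linarith
  have hS2 : ∀ z ∈ S, 0 < ((y - z) * w).re := by
    intro z hz
    have h1 := (abs_lt.1 (show |(w * z).re - c| < δ from hz)).2
    rw [mul_comm, mul_sub, Complex.sub_re]; linarith
  have hgc : ContinuousOn g S := by
    refine ContinuousOn.add (ContinuousOn.sub ?_ ?_) continuousOn_const
    · exact ContinuousOn.clog (by fun_prop) fun z hz => Or.inl (hS1 z hz)
    · exact ContinuousOn.clog (by fun_prop) fun z hz => Or.inl (hS2 z hz)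
  have hw0 : w ≠ 0 := by rintro rfl; simp at hw
  have hge : ∀ z ∈ S, Complex.exp (g z) = (z - x) * (z - y)⁻¹ := by
    intro z hz
    have n1 : (z - x) * w ≠ 0 := fun h => by have := hS1 z hz; rw [h] at this; simp at this
    have n2 : (y - z) * w ≠ 0 := fun h => by have := hS2 z hz; rw [h] at this; simp at this
    have n3 : y - z ≠ 0 := left_ne_zero_of_mul n2
    have n4 : z - y ≠ 0 := by rw [← neg_sub]; exact neg_ne_zero.2 n3
    simp only [g]
    rw [Complex.exp_add, Complex.exp_sub, Complex.exp_log n1, Complex.exp_log n2, Complex.exp_pi_mul_I]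
    rw [← neg_sub z y]
    field_simp
  have hn : ∀ p ∈ J, ∀ p0 ∈ J, |(w * p).re - c| < δ / 2 → dist p p0 < η1 → φ p - g p = φ p0 - g p0 := by
    intro p hp p0 hp0 hpc hd
    obtain ⟨C, hCJ, hC, hpC, hp0C, hCd⟩ := hulc p hp p0 hp0 hd
    have hCS : C ⊆ S := by
      intro z hz
      have h1 := hre z p
      have h2 := hCd z hz
      show |(w * z).re - c| < δ
      rw [abs_lt] at hpc ⊢
      rw [abs_le] at h1
      constructor <;> linarith
    obtain ⟨n, hn⟩ := exp_eq_on hC (hφc.mono hCJ) (hgc.mono hCS)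
      (fun z hz => by rw [hφ z (hCJ hz), hge z (hCS hz)])
    rw [hn p hpC, hn p0 hp0C]; ring
  choose! P hPJ hPd using fun z hz => (hKJ z hz).2
  have hPc : ∀ z ∈ K, |(w * P z).re - c| < δ / 2 := by
    intro z hz
    have h1 := hre (P z) z
    have h2 := hPd z hz
    rw [dist_comm] at h2
    rw [(hKJ z hz).1] at h1
    have := min_le_right (η1 / 4) (δ / 4)
    linarith
  have hKS : K ⊆ S := by
    intro z hz
    show |(w * z).re - c| < δ
    rw [(hKJ z hz).1]; simpa using hδ
  have hm := min_le_left (η1 / 4) (δ / 4)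
  let ψ : ℂ → ℂ := fun z => g z + (φ (P z) - g (P z))
  have hψc : ContinuousOn ψ K := by
    intro z0 hz0
    have h1 : ContinuousWithinAt (fun z => g z + (φ (P z0) - g (P z0))) K z0 :=
      ((hgc.mono hKS) z0 hz0).add continuousWithinAt_const
    refine h1.congr_of_eventuallyEq ?_ rfl
    filter_upwards [self_mem_nhdsWithin, mem_nhdsWithin_of_mem_nhds (ball_mem_nhds z0 (show 0 < η1 / 4 by linarith))]
      with z hz hzb
    show g z + _ = g z + _
    rw [hn (P z) (hPJ z hz) (P z0) (hPJ z0 hz0) (hPc z hz)]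
    have h2 := hPd z hz
    have h3 := hPd z0 hz0
    rw [mem_ball] at hzb
    rw [dist_comm] at h2
    have := dist_triangle4 (P z) z z0 (P z0)
    linarith
  have hψJ : ∀ z ∈ K, z ∈ J → ψ z = φ z := by
    intro z hz hzJ
    have := hn z hzJ (P z) (hPJ z hz) (by rw [(hKJ z hz).1]; simpa using half_pos hδ) (by
      have h2 := hPd z hz
      linarith)
    show g z + (φ (P z) - g (P z)) = φ z
    rw [← this]; ring
  have hψe : ∀ z ∈ K, Complex.exp (ψ z) = (z - x) * (z - y)⁻¹ := by
    intro z hz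
    have hs : P z ∈ S := lt_trans (hPc z hz) (by linarith)
    show Complex.exp (g z + (φ (P z) - g (P z))) = _
    have hne := Complex.exp_ne_zero (g (P z))
    have hφ' : Complex.exp (φ (P z)) = Complex.exp (g (P z)) := by rw [hge _ hs]; exact hφ (P z) (hPJ z hz)
    rw [Complex.exp_add, Complex.exp_sub, hφ', div_self hne, mul_one, hge z (hKS hz)]
  refine ⟨fun z => if z ∈ K then ψ z else φ z, ?_, ?_⟩
  · refine ContinuousOn.union_of_isClosed ?_ ?_ hJ.isCompact.isClosed hK.isClosed
    · refine hφc.congr fun z hz => ?_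
      by_cases h : z ∈ K
      · simp only [h, if_true]; exact hψJ z h hz
      · simp only [h, if_false]
    · exact hψc.congr fun z hz => by simp only [hz, if_true]
  · intro z hz
    by_cases h : z ∈ K
    · simp only [h, if_true]; exact hψe z h
    · simp only [h, if_false]; exact hφ z (hz.resolve_right h)

lemma gap {I : Set ℝ} (hI : IsOpen I) (hb : Bornology.IsBounded I) {t : ℝ} (ht : t ∈ I) :
    ∃ a b, a < t ∧ t < b ∧ Ioo a b ⊆ I ∧ a ∉ I ∧ b ∉ I := by
  have half : ∀ {I : Set ℝ}, IsOpen I → Bornology.IsBounded I → ∀ {t : ℝ}, t ∈ I →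
      ∃ b, t < b ∧ Ico t b ⊆ I ∧ b ∉ I := by
    intro I hI hb t ht
    obtain ⟨M, hM⟩ := hb.bddAbove
    have hcl : IsClosed (Iᶜ ∩ Ici t) := hI.isClosed_compl.inter isClosed_Ici
    have hne : (Iᶜ ∩ Ici t).Nonempty := ⟨max (M + 1) t, fun h => by
      have := hM h
      linarith [le_max_left (M + 1) t], mem_Ici.2 (le_max_right _ _)⟩
    have hbb : BddBelow (Iᶜ ∩ Ici t) := ⟨t, fun s hs => hs.2⟩
    have hm := hcl.csInf_mem hne hbb
    refine ⟨sInf (Iᶜ ∩ Ici t), lt_of_le_of_ne hm.2 (fun h => hm.1 (h ▸ ht)), ?_, hm.1⟩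
    intro s hs
    by_contra h
    exact not_lt.2 (csInf_le hbb ⟨h, hs.1⟩) hs.2
  obtain ⟨b, hb1, hb2, hb3⟩ := half hI hb ht
  obtain ⟨a, ha1, ha2, ha3⟩ := half (I := Neg.neg '' I) ((Homeomorph.neg ℝ).isOpen_image.2 hI)
    (by rw [image_neg_eq_neg]; exact hb.neg) ⟨t, ht, rfl⟩
  refine ⟨-a, b, by linarith, hb1, ?_, fun h => ha3 ⟨-a, h, neg_neg a⟩, hb3⟩
  intro s hs
  rcases le_total t s with h | h
  · exact hb2 ⟨h, hs.2⟩
  · obtain ⟨r, hr, he⟩ := ha2 (show -s ∈ Ico (-t) a from ⟨by linarith, by linarith [hs.1]⟩)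
    rwa [← neg_inj.1 he]

lemma line_sub {Γ : Set (ℂ × ℂ)} (hΓ : CP Γ) {π : ℂ × ℂ → ℂ} (hπ : IsProj π) {w : ℂ} (hw : ‖w‖ = 1)
    (c : ℝ) {δ : ℝ} (hδ : 0 < δ) :
    ∃ L, IsSub Γ L ∧ ∀ Γ' ∈ L, ∀ x ∈ dsk (π '' Γ'), ∀ y ∈ dsk (π '' Γ'), (w * x).re < c - δ →
      c + δ < (w * y).re → False := by
  classical
  have hJ := hΓ.jordan hπ
  set J := π '' Γ with hJdef
  obtain ⟨η, hη, hconn⟩ := conn_strip hJ hw c hδ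
  let ℓ : ℝ → ℂ := fun t => (starRingEnd ℂ) w * (c + t * Complex.I)
  have hwl : ∀ t, w * ℓ t = c + t * Complex.I := by
    intro t
    simp only [ℓ]
    rw [← mul_assoc, Complex.mul_conj, Complex.normSq_eq_norm_sq, hw]; simp
  have hlw : ∀ z, (w * z).re = c → ℓ (w * z).im = z := by
    intro z hz
    simp only [ℓ]
    have : (c : ℂ) + (w * z).im * Complex.I = w * z := by
      rw [← hz]; exact Complex.re_add_im _
    rw [this, ← mul_assoc, mul_comm _ w, Complex.mul_conj, Complex.normSq_eq_norm_sq, hw]; simp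
  have hlc : Continuous ℓ := by fun_prop
  have hli : Function.Injective ℓ := by
    intro s t h
    have := congrArg (fun z => (w * z).im) h
    simpa [hwl] using this
  have hlre : ∀ t, (w * ℓ t).re = c := fun t => by rw [hwl]; simp
  have hbd : ∀ {S : Set ℂ}, Bornology.IsBounded S → Bornology.IsBounded (ℓ ⁻¹' S) := by
    intro S hS
    obtain ⟨R, hR⟩ := isBounded_iff_forall_norm_le.1 hS
    refine isBounded_iff_forall_norm_le.2 ⟨R, fun t ht => ?_⟩
    have h1 := hR _ ht
    have h2 : t = (w * ℓ t).im := by rw [hwl]; simp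
    rw [Real.norm_eq_abs, h2]
    refine (Complex.abs_im_le_norm _).trans ?_
    rwa [norm_mul, hw, one_mul]
  let I : Set ℝ := ℓ ⁻¹' (ins J)
  have hIo : IsOpen I := (isOpen_ins hJ.isCompact.isClosed).preimage hlc
  have hIb : Bornology.IsBounded I := hbd (ins_bounded hJ.isCompact)
  have hDc : IsCompact (ℓ ⁻¹' (dsk J)) := Metric.isCompact_of_isClosed_isBounded
    ((isCompact_dsk hJ.isCompact).isClosed.preimage hlc) (hbd (isCompact_dsk hJ.isCompact).isBounded)
  let Good : Set (ℝ × ℝ) := {r | r.1 < r.2 ∧ Ioo r.1 r.2 ⊆ I ∧ r.1 ∉ I ∧ r.2 ∉ I}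
  have hGuniq : ∀ r ∈ Good, ∀ r' ∈ Good, ∀ t ∈ Ioo r.1 r.2, t ∈ Icc r'.1 r'.2 → r = r' := by
    intro r hr r' hr' t ht ht'
    have hl : ∀ s, s ∉ I → s ∉ Ioo r.1 r.2 := fun s hs h => hs (hr.2.1 h)
    have hl' : ∀ s, s ∉ I → s ∉ Ioo r'.1 r'.2 := fun s hs h => hs (hr'.2.1 h)
    have tI : t ∈ I := hr.2.1 ht
    have t1 : r'.1 < t := lt_of_le_of_ne ht'.1 (fun h => hr'.2.2.1 (h ▸ tI))
    have t2 : t < r'.2 := lt_of_le_of_ne ht'.2 (fun h => hr'.2.2.2 (h ▸ tI))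
    have e1 : r.1 = r'.1 := by
      rcases lt_trichotomy r.1 r'.1 with h | h | h
      · exact absurd ⟨h, t1.trans ht.2⟩ (hl _ hr'.2.2.1)
      · exact h
      · exact absurd ⟨h, ht.1.trans t2⟩ (hl' _ hr.2.2.1)
    have e2 : r.2 = r'.2 := by
      rcases lt_trichotomy r.2 r'.2 with h | h | h
      · exact absurd ⟨t1.trans ht.2, h⟩ (hl' _ hr.2.2.2)
      · exact h
      · exact absurd ⟨ht.1.trans t2, h⟩ (hl _ hr'.2.2.2)
    exact Prod.ext e1 e2
  have hGend : ∀ r ∈ Good, ℓ r.1 ∈ J ∧ ℓ r.2 ∈ J := by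
    intro r hr
    have h1 : Icc r.1 r.2 ⊆ ℓ ⁻¹' (dsk J) := by
      rw [← closure_Ioo hr.1.ne]
      exact closure_minimal (fun s hs => Or.inr (hr.2.1 hs)) hDc.isClosed
    exact ⟨(h1 (left_mem_Icc.2 hr.1.le)).resolve_right hr.2.2.1,
      (h1 (right_mem_Icc.2 hr.1.le)).resolve_right hr.2.2.2⟩
  -- finitely many cuts
  let T : Set ℝ := ℓ ⁻¹' (dsk J) ∩ {t | η ≤ infDist (ℓ t) J}
  have hTc : IsCompact T := hDc.inter_right (isClosed_le continuous_const ((continuous_infDist_pt J).comp hlc))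
  have hTI : T ⊆ I := by
    rintro t ⟨h1 | h1, h2⟩
    · have h2' : η ≤ infDist (ℓ t) J := h2
      rw [infDist_zero_of_mem h1] at h2'; linarith
    · exact h1
  obtain ⟨F, hFG, hFT⟩ : ∃ F : Finset (ℝ × ℝ), (↑F : Set (ℝ × ℝ)) ⊆ Good ∧ T ⊆ ⋃ r ∈ F, Ioo r.1 r.2 := by
    obtain ⟨F, hF⟩ := hTc.elim_finite_subcover (fun r : Good => Ioo r.1.1 r.1.2) (fun _ => isOpen_Ioo) (by
      intro t ht
      obtain ⟨a, b, h1, h2, h3, h4, h5⟩ := gap hIo hIb (hTI ht)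
      exact mem_iUnion.2 ⟨⟨(a, b), h1.trans h2, h3, h4, h5⟩, h1, h2⟩)
    refine ⟨F.image Subtype.val, ?_, ?_⟩
    · intro r hr
      simp only [Finset.coe_image, mem_image] at hr
      obtain ⟨r', -, rfl⟩ := hr
      exact r'.2
    · simpa using hF
  have hcuts : ∀ F : Finset (ℝ × ℝ), (↑F : Set (ℝ × ℝ)) ⊆ Good → ∃ L, IsSub Γ L ∧
      skel π L = J ∪ ⋃ r ∈ F, ℓ '' Icc r.1 r.2 := by
    intro F
    induction F using Finset.induction_on with
    | empty => intro _; exact ⟨{Γ}, isSub_self hΓ, by simp [skel, J]⟩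
    | insert r F hr ih =>
      intro hF
      obtain ⟨L, hL, hs⟩ := ih ((Finset.coe_subset.2 (Finset.subset_insert _ _)).trans hF)
      have hrG : r ∈ Good := hF (by simp)
      obtain ⟨L', hL', hs'⟩ := hL.cut hπ (isArc_of_Icc hrG.1 hlc.continuousOn hli.injOn)
        (hs ▸ Or.inl (hGend r hrG).1) (hs ▸ Or.inl (hGend r hrG).2) (by
          rintro _ ⟨⟨t, ht, rfl⟩, hne⟩
          have ht' : t ∈ Ioo r.1 r.2 := ⟨lt_of_le_of_ne ht.1 (fun h => hne (by simp [h])),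
            lt_of_le_of_ne ht.2 (fun h => hne (by simp [h]))⟩
          have htI : ℓ t ∈ ins J := hrG.2.1 ht'
          refine ⟨Or.inr htI, ?_⟩
          rw [hs]
          rintro (h | h)
          · exact htI.1 h
          · simp only [mem_iUnion] at h
            obtain ⟨r', hr', s, hs, he⟩ := h
            rw [hli he] at hs
            have := hGuniq r hrG r' (hF (by simp [hr'])) t ht' hs
            exact hr (this ▸ hr'))
      refine ⟨L', hL', ?_⟩
      rw [hs', hs, Finset.set_biUnion_insert]
      ext z; simp only [mem_union]; tauto
  obtain ⟨L, hL, hs⟩ := hcuts F hFG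
  refine ⟨L, hL, ?_⟩
  have main : ∀ Γ' ∈ L, ∀ x ∈ ins (π '' Γ'), ∀ y ∈ ins (π '' Γ'), (w * x).re < c - δ →
      c + δ < (w * y).re → False := by
    intro Γ' hΓ' x hx y hy hxc hyc
    have hdis := hL.ins_skel hπ hΓ'
    have hinsJ : ∀ z ∈ ins (π '' Γ'), z ∈ ins J := fun z hz =>
      (hL.sub hπ hΓ' (Or.inr hz)).resolve_left fun h => disjoint_left.1 hdis hz (hL.bdry_skel π h)
    have c1 : Conn (skel π L) x y := ⟨ins (π '' Γ'), ((hL.cp _ hΓ').jordan hπ).isPreconnected_ins,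
      fun z hz => disjoint_left.1 hdis hz, hx, hy⟩
    let K : Set ℂ := ℓ '' (ℓ ⁻¹' (dsk J) \ ⋃ r ∈ F, Ioo r.1 r.2)
    have hKc : IsCompact K := (hDc.diff (isOpen_biUnion fun _ _ => isOpen_Ioo)).image hlc
    have c2 : Conn (J ∪ K) x y := by
      refine hconn x (hinsJ x hx) y (hinsJ y hy) hxc hyc K hKc ?_
      rintro _ ⟨t, ht, rfl⟩
      refine ⟨hlre t, ?_⟩
      refine (infDist_lt_iff hJ.nonempty).1 ?_
      by_contra h
      exact ht.2 (hFT ⟨ht.1, not_lt.1 h⟩)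
    have hskc : IsCompact (skel π L) := by
      rw [hs]
      exact hJ.isCompact.union (F.finite_toSet.isCompact_biUnion fun r _ => isCompact_Icc.image hlc)
    have h_meet_eq : (J ∪ K) ∩ skel π L = J := by
      apply Subset.antisymm
      · rintro z ⟨h1 | ⟨t, ht, rfl⟩, h2⟩
        · exact h1
        · rw [hs] at h2
          rcases h2 with h2 | h2
          · exact h2
          · simp only [mem_iUnion] at h2
            obtain ⟨r, hr, s, hs, he⟩ := h2
            rw [hli he] at hs
            have htn : t ∉ Ioo r.1 r.2 := fun h => ht.2 (mem_biUnion hr h)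
            rcases hs.1.eq_or_lt with h | h
            · rw [← h]; exact (hGend r (hFG hr)).1
            rcases hs.2.eq_or_lt with h' | h'
            · rw [h']; exact (hGend r (hFG hr)).2
            · exact absurd ⟨h, h'⟩ htn
      · exact fun z hz => ⟨Or.inl hz, hs ▸ Or.inl hz⟩
    obtain ⟨C, hC, hCK, hxC, hyC⟩ := janiszewski (hJ.isCompact.union hKc) hskc
      (by rw [h_meet_eq]; exact hJ.isPreconnected) c2 c1
    have hcont : ContinuousOn (fun z : ℂ => (w * z).re) C :=
      (Complex.continuous_re.comp (continuous_const.mul continuous_id)).continuousOn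
    obtain ⟨z, hzC, hz⟩ := hC.intermediate_value hxC hyC hcont
      (show c ∈ Icc (w * x).re (w * y).re from ⟨by linarith, by linarith⟩)
    have hzi : z ∈ ins J := (show Conn J x z from
      ⟨C, hC, fun v hv h => hCK hv (Or.inl (Or.inl h)), hxC, hzC⟩).ins (hinsJ x hx)
    have hzl := hlw z hz
    refine hCK hzC ?_
    by_cases ht : (w * z).im ∈ ⋃ r ∈ F, Ioo r.1 r.2
    · right
      rw [hs]; right
      simp only [mem_iUnion] at ht ⊢
      obtain ⟨r, hr, ht⟩ := ht
      exact ⟨r, hr, (w * z).im, Ioo_subset_Icc_self ht, hzl⟩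
    · left; right
      exact ⟨(w * z).im, ⟨by show ℓ (w * z).im ∈ dsk J; rw [hzl]; exact Or.inr hzi, ht⟩, hzl⟩
  intro Γ' hΓ' x hx y hy hxc hyc
  have hcl := ((hL.cp _ hΓ').jordan hπ).dsk_sub_closure
  have hcr : Continuous (fun z : ℂ => (w * z).re) := by fun_prop
  obtain ⟨x', hx', hx'i⟩ := _root_.mem_closure_iff.1 (hcl hx) {z | (w * z).re < c - δ}
    (isOpen_lt hcr continuous_const) hxc
  obtain ⟨y', hy', hy'i⟩ := _root_.mem_closure_iff.1 (hcl hy) {z | c + δ < (w * z).re}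
    (isOpen_lt continuous_const hcr) hyc
  exact main Γ' hΓ' x' hx'i y' hy'i hx' hy'

lemma lines_sub {Γ : Set (ℂ × ℂ)} (hΓ : CP Γ) {π : ℂ × ℂ → ℂ} (hπ : IsProj π) {δ : ℝ} (hδ : 0 < δ)
    (F : Finset (ℂ × ℝ)) (hF : ∀ r ∈ F, ‖r.1‖ = 1) :
    ∃ L, IsSub Γ L ∧ ∀ r ∈ F, ∀ Γ' ∈ L, ∀ x ∈ dsk (π '' Γ'), ∀ y ∈ dsk (π '' Γ'),
      (r.1 * x).re < r.2 - δ → r.2 + δ < (r.1 * y).re → False := by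
  classical
  induction F using Finset.induction_on with
  | empty => exact ⟨{Γ}, isSub_self hΓ, by simp⟩
  | insert r F hr ih =>
    obtain ⟨L, hL, hs⟩ := ih fun r' hr' => hF r' (Finset.mem_insert_of_mem hr')
    choose! M hM hMs using fun Γ' (h' : Γ' ∈ L) => line_sub (hL.cp _ h') hπ (hF r (Finset.mem_insert_self _ _)) r.2 hδ
    refine ⟨_, hL.refine M hM, ?_⟩
    intro r' hr' Γ'' h'' x hx y hy
    simp only [mem_iUnion] at h''
    obtain ⟨Γ', h', h''⟩ := h''
    rcases Finset.mem_insert.1 hr' with rfl | hr'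
    · exact hMs Γ' h' Γ'' h'' x hx y hy
    · exact hs r' hr' Γ' h' x ((hM Γ' h').sub hπ h'' hx) y ((hM Γ' h').sub hπ h'' hy)

lemma mesh_one {Γ : Set (ℂ × ℂ)} (hΓ : CP Γ) {π : ℂ × ℂ → ℂ} (hπ : IsProj π) {ε : ℝ} (hε : 0 < ε) :
    ∃ L, IsSub Γ L ∧ ∀ Γ' ∈ L, ∀ x ∈ dsk (π '' Γ'), ∀ y ∈ dsk (π '' Γ'), dist x y < ε := by
  classical
  set δ := ε / 10 with hδ
  have hδ0 : 0 < δ := by positivity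
  obtain ⟨R, hR⟩ := isBounded_iff_forall_norm_le.1 (isCompact_dsk (hΓ.jordan hπ).isCompact).isBounded
  obtain ⟨N, hN⟩ := exists_nat_ge (R / δ + 1)
  obtain ⟨L, hL, hs⟩ := lines_sub hΓ hπ hδ0
    (({1, -Complex.I} : Finset ℂ) ×ˢ (Finset.Icc (-N : ℤ) N).image (fun k : ℤ => (k : ℝ) * δ)) (by
      intro r hr
      simp only [Finset.mem_product, Finset.mem_insert, Finset.mem_singleton] at hr
      rcases hr.1 with h | h <;> simp [h])
  refine ⟨L, hL, fun Γ' h' => ?_⟩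
  have key : ∀ w : ℂ, (w = 1 ∨ w = -Complex.I) → ∀ x ∈ dsk (π '' Γ'), ∀ y ∈ dsk (π '' Γ'),
      (w * y).re ≤ (w * x).re + 4 * δ := by
    intro w hw x hx y hy
    by_contra hlt
    push Not at hlt
    have hnw : ‖w‖ = 1 := by rcases hw with h | h <;> simp [h]
    have hbnd : ∀ z ∈ dsk (π '' Γ'), |(w * z).re| ≤ R := by
      intro z hz
      refine (Complex.abs_re_le_norm _).trans ?_
      rw [norm_mul, hnw, one_mul]
      exact hR z (hL.sub hπ h' hz)
    set k : ℤ := ⌊(w * x).re / δ⌋ + 2 with hk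
    have f1 : (⌊(w * x).re / δ⌋ : ℝ) * δ ≤ (w * x).re := by
      rw [← le_div_iff₀ hδ0]; exact Int.floor_le _
    have f2 : (w * x).re < ((⌊(w * x).re / δ⌋ : ℝ) + 1) * δ := by
      rw [← div_lt_iff₀ hδ0]; exact Int.lt_floor_add_one _
    have hkc : (k : ℝ) = (⌊(w * x).re / δ⌋ : ℝ) + 2 := by rw [hk]; push_cast; ring
    have g1 : (w * x).re < k * δ - δ := by rw [hkc]; linarith
    have g2 : k * δ + δ < (w * y).re := by rw [hkc]; linarith
    have b1 := abs_le.1 (hbnd x hx)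
    have b2 := abs_le.1 (hbnd y hy)
    have hRN : R + δ ≤ N * δ := by
      have : (R / δ + 1) * δ ≤ N * δ := by gcongr
      rwa [add_mul, one_mul, div_mul_cancel₀ _ hδ0.ne'] at this
    have k1 : (k : ℝ) ≤ N := by
      by_contra h; push Not at h
      have : (N : ℝ) * δ < k * δ := by gcongr
      linarith
    have k2 : (-N : ℝ) ≤ k := by
      by_contra h; push Not at h
      have : k * δ < (-N : ℝ) * δ := by gcongr
      linarith
    refine hs (w, k * δ) ?_ Γ' h' x hx y hy g1 g2
    simp only [Finset.mem_product, Finset.mem_insert, Finset.mem_singleton, Finset.mem_image, Finset.mem_Icc]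
    exact ⟨hw, k, ⟨by exact_mod_cast k2, by exact_mod_cast k1⟩, rfl⟩
  intro x hx y hy
  have a1 := key 1 (Or.inl rfl) x hx y hy
  have a2 := key 1 (Or.inl rfl) y hy x hx
  have a3 := key _ (Or.inr rfl) x hx y hy
  have a4 := key _ (Or.inr rfl) y hy x hx
  simp at a1 a2 a3 a4
  rw [dist_eq_norm]
  refine (Complex.norm_le_abs_re_add_abs_im _).trans_lt ?_
  have e1 : |(x - y).re| ≤ 4 * δ := by rw [Complex.sub_re, abs_le]; constructor <;> linarith
  have e2 : |(x - y).im| ≤ 4 * δ := by rw [Complex.sub_im, abs_le]; constructor <;> linarith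
  linarith

/-- The relation attached to a subdivision. -/
def rel (L : Set (Set (ℂ × ℂ))) : Set (ℂ × ℂ) := {z | ∃ Γ ∈ L, ∀ π, IsProj π → π z ∈ dsk (π '' Γ)}

/-- The regions of `L` have diameter less than `ε`. -/
def Mesh (L : Set (Set (ℂ × ℂ))) (ε : ℝ) : Prop :=
  ∀ π, IsProj π → ∀ Γ ∈ L, ∀ x ∈ dsk (π '' Γ), ∀ y ∈ dsk (π '' Γ), dist x y < ε

lemma isProj_fst : IsProj Prod.fst := Or.inl rfl
lemma isProj_snd : IsProj Prod.snd := Or.inr rfl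

lemma mesh_step {Γ0 : Set (ℂ × ℂ)} {L : Set (Set (ℂ × ℂ))} (h : IsSub Γ0 L) {ε : ℝ} (hε : 0 < ε) :
    ∃ L', IsSub Γ0 L' ∧ Mesh L' ε ∧ rel L' ⊆ rel L := by
  choose! M hM hMs using fun Γ' (h' : Γ' ∈ L) => mesh_one (h.cp _ h') isProj_fst hε
  have h1 := h.refine M hM
  choose! N hN hNs using fun Γ' (h' : Γ' ∈ ⋃ Γ ∈ L, M Γ) => mesh_one (h1.cp _ h') isProj_snd hε
  refine ⟨_, h1.refine N hN, ?_, ?_⟩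
  · rintro _ (rfl | rfl) Γ hΓ x hx y hy
    · rw [mem_iUnion₂] at hΓ
      obtain ⟨Γ', h', h''⟩ := hΓ
      have s := (hN Γ' h').sub isProj_fst h''
      rw [mem_iUnion₂] at h'
      obtain ⟨Γ1, h1, h1'⟩ := h'
      exact hMs Γ1 h1 Γ' h1' x (s hx) y (s hy)
    · rw [mem_iUnion₂] at hΓ
      obtain ⟨Γ', h', h''⟩ := hΓ
      exact hNs Γ' h' Γ h'' x hx y hy
  · rintro z ⟨Γ, hΓ, hz⟩
    rw [mem_iUnion₂] at hΓ
    obtain ⟨Γ', h', h''⟩ := hΓ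
    have hN' := hN Γ' h'
    rw [mem_iUnion₂] at h'
    obtain ⟨Γ1, h1, h1'⟩ := h'
    exact ⟨Γ1, h1, fun π hπ => (hM Γ1 h1).sub hπ h1' (hN'.sub hπ h'' (hz π hπ))⟩

lemma isCompact_rel {Γ0 : Set (ℂ × ℂ)} {L : Set (Set (ℂ × ℂ))} (h : IsSub Γ0 L) : IsCompact (rel L) := by
  have : rel L = ⋃ Γ ∈ L, dsk (Prod.fst '' Γ) ×ˢ dsk (Prod.snd '' Γ) := by
    ext z
    simp only [rel, mem_setOf_eq, mem_iUnion, exists_prop]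
    refine exists_congr fun Γ => and_congr_right fun _ => ⟨fun h => ⟨h _ isProj_fst, h _ isProj_snd⟩, ?_⟩
    rintro ⟨h1, h2⟩ _ (rfl | rfl)
    exacts [h1, h2]
  rw [this]
  exact h.fin.isCompact_biUnion fun Γ hΓ =>
    (isCompact_dsk ((h.cp _ hΓ).jordan isProj_fst).isCompact).prod
      (isCompact_dsk ((h.cp _ hΓ).jordan isProj_snd).isCompact)

lemma dsk_nonempty {Γ : Set (ℂ × ℂ)} (h : CP Γ) (π : ℂ × ℂ → ℂ) : (dsk (π '' Γ)).Nonempty := by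
  obtain ⟨z, hz⟩ := h.jord.nonempty
  exact ⟨π z, Or.inl ⟨z, hz, rfl⟩⟩

lemma rel_surj {Γ0 : Set (ℂ × ℂ)} {L : Set (Set (ℂ × ℂ))} (h : IsSub Γ0 L) {π : ℂ × ℂ → ℂ} (hπ : IsProj π) :
    π '' rel L = dsk (π '' Γ0) := by
  apply Subset.antisymm
  · rintro _ ⟨z, ⟨Γ, hΓ, hz⟩, rfl⟩
    exact h.sub hπ hΓ (hz π hπ)
  · intro x hx
    rw [← (h.part π hπ).cover, mem_iUnion₂] at hx
    obtain ⟨Γ, hΓ, hx⟩ := hx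
    rcases hπ with rfl | rfl
    · obtain ⟨y, hy⟩ := dsk_nonempty (h.cp _ hΓ) Prod.snd
      refine ⟨(x, y), ⟨Γ, hΓ, ?_⟩, rfl⟩
      rintro _ (rfl | rfl)
      exacts [hx, hy]
    · obtain ⟨y, hy⟩ := dsk_nonempty (h.cp _ hΓ) Prod.fst
      refine ⟨(y, x), ⟨Γ, hΓ, ?_⟩, rfl⟩
      rintro _ (rfl | rfl)
      exacts [hy, hx]

lemma rel_inj {Γ0 : Set (ℂ × ℂ)} {L : Set (Set (ℂ × ℂ))} (h : IsSub Γ0 L) {ε : ℝ} (hL : Mesh L ε)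
    {π π' : ℂ × ℂ → ℂ} (hπ : IsProj π) (hπ' : IsProj π') {z z' : ℂ × ℂ} (hz : z ∈ rel L) (hz' : z' ∈ rel L)
    (he : π z = π z') : dist (π' z) (π' z') ≤ 2 * ε := by
  obtain ⟨Γ, hΓ, hz⟩ := hz
  obtain ⟨Γ', hΓ', hz'⟩ := hz'
  have hε : 0 < ε := dist_nonneg.trans_lt (hL π hπ Γ hΓ _ (hz π hπ) _ (hz π hπ))
  by_cases hg : Γ = Γ'
  · subst hg
    linarith [hL π' hπ' Γ hΓ _ (hz π' hπ') _ (hz' π' hπ')]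
  obtain ⟨v, hv, hve⟩ := (h.part π hπ).sep _ hΓ _ hΓ' hg ⟨hz π hπ, he ▸ hz' π hπ⟩
  have h1 := hL π' hπ' Γ hΓ _ (hz π' hπ') (π' v) (Or.inl ⟨v, hv.1, rfl⟩)
  have h2 := hL π' hπ' Γ' hΓ' (π' v) (Or.inl ⟨v, hv.2, rfl⟩) _ (hz' π' hπ')
  linarith [dist_triangle (π' z) (π' v) (π' z')]

/-- The inner Schoenflies theorem in the form of a relation. -/
theorem schoenflies {Γ : Set (ℂ × ℂ)} (hΓ : CP Γ) : ∃ R : Set (ℂ × ℂ), IsCompact R ∧ Γ ⊆ R ∧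
    ∀ π, IsProj π → π '' R = dsk (π '' Γ) ∧ InjOn π R := by
  choose f hf1 hf2 hf3 using fun (L : {L // IsSub Γ L}) (n : ℕ) =>
    mesh_step L.2 (show (0 : ℝ) < 1 / ((n : ℝ) + 1) by positivity)
  let S : ℕ → {L // IsSub Γ L} := fun n => Nat.rec ⟨{Γ}, isSub_self hΓ⟩ (fun n L => ⟨f L n, hf1 L n⟩) n
  have hmesh : ∀ n, Mesh (S (n + 1)).1 (1 / ((n : ℝ) + 1)) := fun n => hf2 (S n) n
  have hanti : ∀ n, rel (S (n + 1)).1 ⊆ rel (S n).1 := fun n => hf3 (S n) n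
  refine ⟨⋂ n, rel (S n).1, ?_, ?_, ?_⟩
  · exact (isCompact_rel (S 0).2).of_isClosed_subset (isClosed_iInter fun n => (isCompact_rel (S n).2).isClosed)
      (iInter_subset (fun n => rel (S n).1) 0)
  · refine subset_iInter fun n z hz => ?_
    obtain ⟨Γ', h', hz⟩ := (S n).2.bdry hz
    exact ⟨Γ', h', fun π hπ => Or.inl ⟨z, hz, rfl⟩⟩
  · intro π hπ
    constructor
    · apply Subset.antisymm
      · rw [← rel_surj (S 0).2 hπ]
        exact image_mono (iInter_subset (fun n => rel (S n).1) 0)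
      · intro x hx
        have := IsCompact.nonempty_iInter_of_sequence_nonempty_isCompact_isClosed
          (fun n => rel (S n).1 ∩ π ⁻¹' {x}) (fun n => inter_subset_inter_left _ (hanti n)) (fun n => by
            rw [← rel_surj (S n).2 hπ] at hx
            obtain ⟨z, hz, he⟩ := hx
            exact ⟨z, hz, he⟩)
          ((isCompact_rel (S 0).2).inter_right (isClosed_singleton.preimage hπ.cont))
          (fun n => (isCompact_rel (S n).2).isClosed.inter (isClosed_singleton.preimage hπ.cont))
        obtain ⟨z, hz⟩ := this
        rw [mem_iInter] at hz
        exact ⟨z, mem_iInter.2 fun n => (hz n).1, (hz 0).2⟩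
    · intro z hz z' hz' he
      rw [mem_iInter] at hz hz'
      have key : ∀ π', IsProj π' → π' z = π' z' := by
        intro π' hπ'
        rw [← dist_le_zero]
        refine le_of_forall_pos_le_add fun ε hε => ?_
        obtain ⟨n, hn⟩ := exists_nat_one_div_lt (half_pos hε)
        have := rel_inj (S (n + 1)).2 (hmesh n) hπ hπ' (hz (n + 1)) (hz' (n + 1)) he
        linarith
      exact Prod.ext (key _ isProj_fst) (key _ isProj_snd)

/-- The embedding of the plane in the sphere. -/
def co : ℂ → OnePoint ℂ := OnePoint.some

/-- The partial inverse of `co`. -/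
def unc : OnePoint ℂ → ℂ := fun x => x.elim 0 id

lemma unc_co (z : ℂ) : unc (co z) = z := rfl

lemma co_inj : Function.Injective co := OnePoint.coe_injective

lemma continuous_co : Continuous co := OnePoint.continuous_coe

lemma isOpenMap_co : IsOpenMap co := OnePoint.isOpenMap_coe

lemma co_ne (z : ℂ) : co z ≠ OnePoint.infty := OnePoint.coe_ne_infty z

lemma co_unc {x : OnePoint ℂ} (hx : x ≠ OnePoint.infty) : co (unc x) = x := by
  obtain ⟨z, rfl⟩ := OnePoint.ne_infty_iff_exists.1 hx
  rfl

lemma continuousOn_unc : ContinuousOn unc {OnePoint.infty}ᶜ := by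
  intro x hx
  obtain ⟨z, rfl⟩ := OnePoint.ne_infty_iff_exists.1 hx
  refine ContinuousAt.continuousWithinAt ?_
  rw [OnePoint.continuousAt_coe]
  exact continuousAt_id

/-- Inversion of the sphere. -/
noncomputable def inv0 : OnePoint ℂ → OnePoint ℂ := fun x => x.elim (co 0) (fun z => if z = 0 then OnePoint.infty else co z⁻¹)

lemma inv0_infty : inv0 OnePoint.infty = co 0 := rfl
lemma inv0_co (z : ℂ) : inv0 (co z) = if z = 0 then OnePoint.infty else co z⁻¹ := rfl

lemma inv0_inv0 (x : OnePoint ℂ) : inv0 (inv0 x) = x := by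
  by_cases hx : x = OnePoint.infty
  · rw [hx, inv0_infty, inv0_co, if_pos rfl]
  · rw [← co_unc hx]
    generalize unc x = z
    by_cases h : z = 0
    · rw [inv0_co, if_pos h, inv0_infty, h]
    · rw [inv0_co, if_neg h, inv0_co, if_neg (inv_ne_zero h), inv_inv]

lemma tendsto_co : Tendsto co (Bornology.cobounded ℂ) (𝓝 OnePoint.infty) := by
  have := OnePoint.tendsto_coe_infty (X := ℂ)
  rwa [coclosedCompact_eq_cocompact, ← Metric.cobounded_eq_cocompact] at this

lemma continuous_inv0 : Continuous inv0 := by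
  rw [continuous_iff_continuousAt]
  intro x
  by_cases hx : x = OnePoint.infty
  · rw [hx, OnePoint.continuousAt_infty', coclosedCompact_eq_cocompact, ← Metric.cobounded_eq_cocompact]
    show Tendsto (inv0 ∘ co) _ (𝓝 (co 0))
    have h1 : Tendsto (fun z : ℂ => co z⁻¹) (Bornology.cobounded ℂ) (𝓝 (co 0)) :=
      (continuous_co.tendsto 0).comp tendsto_inv₀_cobounded
    refine h1.congr' ?_
    have : ({0} : Set ℂ)ᶜ ∈ Bornology.cobounded ℂ := 
      Bornology.isBounded_def.1 Bornology.isBounded_singleton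
    filter_upwards [this] with z hz
    show _ = inv0 (co z)
    rw [inv0_co, if_neg (show ¬ z = 0 from hz)]
  · rw [← co_unc hx]
    generalize unc x = z
    show ContinuousAt inv0 (OnePoint.some z)
    rw [OnePoint.continuousAt_coe]
    show ContinuousAt (inv0 ∘ co) z
    by_cases h : z = 0
    · subst h
      rw [continuousAt_iff_punctured_nhds]
      show Tendsto (inv0 ∘ co) _ (𝓝 (inv0 (co 0)))
      rw [inv0_co, if_pos rfl]
      refine (tendsto_co.comp tendsto_inv₀_nhdsNE_zero).congr' ?_
      filter_upwards [self_mem_nhdsWithin] with z hz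
      show co z⁻¹ = inv0 (co z)
      rw [inv0_co, if_neg (show ¬ z = 0 from hz)]
    · have h1 : ContinuousAt (fun z => co z⁻¹) z := continuous_co.continuousAt.comp (continuousAt_inv₀ h)
      refine h1.congr ?_
      filter_upwards [isOpen_ne.mem_nhds h] with y hy
      show co y⁻¹ = inv0 (co y)
      rw [inv0_co, if_neg hy]

/-- Inversion as a homeomorphism. -/
noncomputable def invH : OnePoint ℂ ≃ₜ OnePoint ℂ where
  toFun := inv0
  invFun := inv0
  left_inv := inv0_inv0
  right_inv := inv0_inv0
  continuous_toFun := continuous_inv0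
  continuous_invFun := continuous_inv0

lemma exists_move (x : OnePoint ℂ) : ∃ T : OnePoint ℂ ≃ₜ OnePoint ℂ, T x = OnePoint.infty := by
  by_cases hx : x = OnePoint.infty
  · exact ⟨Homeomorph.refl _, hx⟩
  · refine ⟨((Homeomorph.addRight (-unc x)).onePointCongr).trans invH, ?_⟩
    have : (Homeomorph.addRight (-unc x)).onePointCongr x = co 0 := by
      conv_lhs => rw [← co_unc hx]
      show co (unc (co (unc x)) + -unc (co (unc x))) = co 0
      rw [add_neg_cancel]
    show inv0 ((Homeomorph.addRight (-unc x)).onePointCongr x) = _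
    rw [this, inv0_co, if_pos rfl]

/-- The outer domain on the sphere. -/
def outS (J : Set ℂ) : Set (OnePoint ℂ) := insert OnePoint.infty (co '' out J)

lemma compl_dsk (J : Set ℂ) : (co '' dsk J)ᶜ = outS J := by
  ext x
  by_cases hx : x = OnePoint.infty
  · subst hx
    simp [outS, co_ne]
  · rw [← co_unc hx]
    generalize unc x = z
    simp only [outS, mem_compl_iff, co_inj.mem_set_image, mem_insert_iff, co_ne, false_or, dsk, mem_union, not_or]
    exact ⟨fun h => (ins_or_out h.1).resolve_left h.2, fun h => ⟨h.1, fun h' => not_ins_out h' h⟩⟩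

lemma isOpen_outS {J : Set ℂ} (hJ : IsCompact J) : IsOpen (outS J) := by
  rw [← compl_dsk]
  exact ((isCompact_dsk hJ).image continuous_co).isClosed.isOpen_compl

lemma isOpen_insS {J : Set ℂ} (hJ : IsCompact J) : IsOpen (co '' ins J) :=
  isOpenMap_co _ (isOpen_ins hJ.isClosed)

lemma isPreconnected_outS {J : Set ℂ} (hJ : IsCompact J) : IsPreconnected (outS J) := by
  have h1 : IsPreconnected (co '' out J) := (isPreconnected_out hJ).image _ continuous_co.continuousOn
  refine h1.subset_closure (subset_insert _ _) (insert_subset ?_ subset_closure)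
  rw [_root_.mem_closure_iff]
  intro U hU hi
  have h2 : co ⁻¹' U ∈ Bornology.cobounded ℂ := tendsto_co (hU.mem_nhds hi)
  have h3 := out_unbounded hJ
  by_contra hne
  refine h3 ((Bornology.isBounded_def.2 (mem_of_superset h2 ?_)))
  intro z hz hzo
  exact hne ⟨co z, hz, z, hzo, rfl⟩

/-- A connected subset of the complement of `J` is on one side. -/
lemma sideS {J : Set ℂ} (hJ : IsCompact J) {C : Set (OnePoint ℂ)} (hC : IsPreconnected C)
    (hCJ : Disjoint C (co '' J)) : (∀ x ∈ C, x ∈ outS J → C ⊆ outS J) ∧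
    (∀ x ∈ C, x ∈ co '' ins J → C ⊆ co '' ins J) := by
  have hd : Disjoint (outS J) (co '' ins J) := by
    rw [← compl_dsk, disjoint_left]
    exact fun x hx h => hx (image_mono subset_union_right h)
  have hcov : C ⊆ outS J ∪ co '' ins J := by
    intro x hx
    by_cases h : x ∈ co '' dsk J
    · obtain ⟨z, hz | hz, rfl⟩ := h
      · exact absurd ⟨z, hz, rfl⟩ (disjoint_left.1 hCJ hx)
      · exact Or.inr ⟨z, hz, rfl⟩
    · left; rw [← compl_dsk]; exact h
  constructor
  · intro x hx hxo
    exact hC.subset_left_of_subset_union (isOpen_outS hJ) (isOpen_insS hJ) hd hcov ⟨x, hx, hxo⟩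
  · intro x hx hxo
    exact hC.subset_left_of_subset_union (isOpen_insS hJ) (isOpen_outS hJ) hd.symm
      (by rwa [union_comm]) ⟨x, hx, hxo⟩

/-- Moving a point of the inner domain to infinity exchanges inside and outside. -/
lemma swapS {J J' : Set ℂ} (hJ : IsJordan J) (hJ' : IsJordan J') (T : OnePoint ℂ ≃ₜ OnePoint ℂ)
    (hT : T '' (co '' J) = co '' J') {a : ℂ} (ha : a ∈ ins J) (hTa : T (co a) = OnePoint.infty) :
    T '' outS J = co '' ins J' := by
  have hdj : ∀ C : Set (OnePoint ℂ), Disjoint C (co '' J) → Disjoint (T '' C) (co '' J') := by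
    intro C hC
    rw [← hT]; exact (disjoint_image_iff T.injective).2 hC
  have d1 : Disjoint (co '' ins J) (co '' J) := by
    rw [disjoint_image_iff co_inj, disjoint_left]; exact fun x hx => hx.1
  have d2 : Disjoint (outS J) (co '' J) := by
    rw [← compl_dsk, disjoint_left]
    exact fun x hx h => hx (image_mono subset_union_left h)
  have p1 : IsPreconnected (T '' (co '' ins J)) :=
    ((hJ.isPreconnected_ins.image _ continuous_co.continuousOn).image _ T.continuous.continuousOn)
  have p2 : IsPreconnected (T '' outS J) := (isPreconnected_outS hJ.isCompact).image _ T.continuous.continuousOn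
  have s1 : T '' (co '' ins J) ⊆ outS J' :=
    (sideS hJ'.isCompact p1 (hdj _ d1)).1 OnePoint.infty ⟨co a, ⟨a, ha, rfl⟩, hTa⟩ (Or.inl rfl)
  have hcov : co '' ins J' ⊆ T '' outS J := by
    rintro x hx
    obtain ⟨y, rfl⟩ := T.surjective x
    refine ⟨y, ?_, rfl⟩
    rw [← compl_dsk]
    rintro ⟨z, hz | hz, rfl⟩
    · have : T (co z) ∈ co '' J' := by rw [← hT]; exact ⟨_, ⟨z, hz, rfl⟩, rfl⟩
      obtain ⟨w, hw, he⟩ := this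
      rw [← he, co_inj.mem_set_image] at hx
      exact hx.1 hw
    · have h1 := s1 ⟨_, ⟨z, hz, rfl⟩, rfl⟩
      rw [← compl_dsk] at h1
      exact h1 (image_mono subset_union_right hx)
  obtain ⟨z, hz⟩ := hJ'.ins_nonempty
  have hz' : co z ∈ co '' ins J' := ⟨z, hz, rfl⟩
  exact Subset.antisymm ((sideS hJ'.isCompact p2 (hdj _ d2)).2 _ (hcov hz') hz') hcov

/-- Put a circle with an arc in standard position: the arc inside the circle. -/
lemma place {C E : Set (OnePoint ℂ)} {p e : OnePoint ℂ} (hC : IsJordan C) (hE : IsArc E p e)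
    (hCE : C ∩ E = {p}) : ∃ T : OnePoint ℂ ≃ₜ OnePoint ℂ, OnePoint.infty ∉ T '' (C ∪ E) ∧
      T '' (E \ {p}) ⊆ co '' ins (unc '' (T '' C)) := by
  have hcu : ∀ (T : OnePoint ℂ ≃ₜ OnePoint ℂ), OnePoint.infty ∉ T '' C → IsJordan (unc '' (T '' C)) ∧
      co '' (unc '' (T '' C)) = T '' C := by
    intro T hT
    have hne : ∀ x ∈ T '' C, x ≠ OnePoint.infty := fun x hx h => hT (h ▸ hx)
    constructor
    · refine (hC.image T.continuous.continuousOn T.injective.injOn).image (continuousOn_unc.mono hne) ?_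
      intro x hx y hy h
      rw [← co_unc (hne x hx), ← co_unc (hne y hy), h]
    · rw [image_image]
      exact (image_congr fun x hx => co_unc (hne x hx)).trans (image_id _)
  have heC : e ∉ C := by
    intro h
    have : e ∈ C ∩ E := ⟨h, hE.right_mem⟩
    rw [hCE] at this
    exact hE.ne this.symm
  obtain ⟨T1, hT1⟩ := exists_move e
  have hi1 : OnePoint.infty ∉ T1 '' C := by
    rintro ⟨x, hx, h⟩
    rw [← hT1] at h
    exact heC (T1.injective h ▸ hx)
  obtain ⟨hJ1, hc1⟩ := hcu T1 hi1
  set J1 := unc '' (T1 '' C)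
  have hEpre : IsPreconnected (E \ {p}) := by
    refine hE.open_part.1.subset_closure ?_ ?_
    · exact diff_subset_diff_right (by simp)
    · exact diff_subset.trans hE.open_part.2.2
  have hEo : T1 '' (E \ {p}) ⊆ outS J1 := by
    refine (sideS hJ1.isCompact (hEpre.image _ T1.continuous.continuousOn) ?_).1 OnePoint.infty
      ⟨e, ⟨hE.right_mem, hE.ne.symm⟩, hT1⟩ (Or.inl rfl)
    rw [hc1, disjoint_image_iff T1.injective, disjoint_left]
    rintro x ⟨hx, hxp⟩ hxC
    exact hxp (hCE ▸ ⟨hxC, hx⟩ : x ∈ ({p} : Set _))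
  obtain ⟨a, ha⟩ := hJ1.ins_nonempty
  obtain ⟨T2, hT2⟩ := exists_move (co a)
  have hT : ∀ S, (T1.trans T2) '' S = T2 '' (T1 '' S) := fun S => by rw [image_image]; rfl
  have hi2' : OnePoint.infty ∉ (T1.trans T2) '' C := by
    rw [hT, ← hc1]
    rintro ⟨_, ⟨z, hz, rfl⟩, h⟩
    rw [← hT2] at h
    exact ha.1 (co_inj (T2.injective h) ▸ hz)
  obtain ⟨hJ2, hc2⟩ := hcu _ hi2'
  have hsw := swapS hJ1 hJ2 T2 (by rw [hc2, hc1, hT]) ha hT2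
  have hsub : (T1.trans T2) '' (E \ {p}) ⊆ co '' ins (unc '' ((T1.trans T2) '' C)) := by
    rw [← hsw, hT]
    exact image_mono hEo
  refine ⟨T1.trans T2, ?_, hsub⟩
  rintro ⟨x, hx, h⟩
  by_cases hxC : x ∈ C
  · exact hi2' ⟨x, hxC, h⟩
  have hxE : x ∈ E := hx.resolve_left hxC
  have hxp : x ≠ p := by
    rintro rfl
    exact hxC (hCE.symm ▸ (rfl : x ∈ ({x} : Set _)) : x ∈ C ∩ E).1
  obtain ⟨z, -, hz⟩ := hsub ⟨x, ⟨hxE, hxp⟩, h⟩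
  exact co_ne z hz

lemma glue_sub {Γ : Set (ℂ × ℂ)} {L : Set (Set (ℂ × ℂ))} (h : IsSub Γ L) :
    ∃ R, IsCompact R ∧ ⋃₀ L ⊆ R ∧ ∀ π, IsProj π → π '' R = dsk (π '' Γ) ∧ InjOn π R := by
  have h1 := fun Γ' (hΓ' : Γ' ∈ L) => schoenflies (h.cp Γ' hΓ')
  choose! R hRc hRs hR using h1
  refine ⟨⋃ Γ' ∈ L, R Γ', h.fin.isCompact_biUnion hRc, ?_, ?_⟩
  · rintro z ⟨Γ', hΓ', hz⟩
    exact mem_biUnion hΓ' (hRs Γ' hΓ' hz)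
  · intro π hπ
    constructor
    · rw [← (h.part π hπ).cover, image_iUnion₂]
      exact iUnion₂_congr fun Γ' hΓ' => (hR Γ' hΓ' π hπ).1
    · intro x hx y hy hxy
      obtain ⟨A, hA, hxA⟩ := mem_iUnion₂.1 hx
      obtain ⟨B, hB, hyB⟩ := mem_iUnion₂.1 hy
      by_cases hAB : A = B
      · subst hAB
        exact (hR A hA π hπ).2 hxA hyB hxy
      · have m1 : π x ∈ dsk (π '' A) := by
          rw [← (hR A hA π hπ).1]; exact ⟨x, hxA, rfl⟩
        have m2 : π x ∈ dsk (π '' B) := by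
          rw [← (hR B hB π hπ).1]; exact ⟨y, hyB, hxy.symm⟩
        obtain ⟨w, hw, he⟩ := (h.part π hπ).sep A hA B hB hAB ⟨m1, m2⟩
        have e1 : w = x := (hR A hA π hπ).2 (hRs A hA hw.1) hxA he
        have e2 : w = y := (hR B hB π hπ).2 (hRs B hB hw.2) hyB (he.trans hxy)
        rw [← e1, ← e2]

lemma planar_in {Γ F : Set (ℂ × ℂ)} {p e : ℂ × ℂ} (hΓ : CP Γ) (hF : IsArc F p e)
    (hFi : ∀ π, IsProj π → InjOn π F) (hp : p ∈ Γ)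
    (hFJ : ∀ π, IsProj π → π '' F \ {π p} ⊆ ins (π '' Γ)) :
    ∃ R, IsCompact R ∧ Γ ∪ F ⊆ R ∧ ∀ π, IsProj π → π '' R = dsk (π '' Γ) ∧ InjOn π R := by
  obtain ⟨q, hq, hpq⟩ : ∃ q ∈ Γ, p ≠ q := by
    obtain ⟨a, ha, b, hb, hab⟩ := hΓ.jord.two
    by_cases h : p = a
    · exact ⟨b, hb, h ▸ hab⟩
    · exact ⟨a, ha, h⟩
  have ext := fun π (hπ : IsProj π) => extend_tip (hΓ.jordan hπ)
    (hF.image hπ.cont.continuousOn (hFi π hπ)) ⟨p, hp, rfl⟩ (hFJ π hπ) ⟨q, hq, rfl⟩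
    (fun h => hpq (hΓ.inj hπ hp hq h))
  obtain ⟨c1, hc1, hs1⟩ := ext _ isProj_fst
  obtain ⟨c2, hc2, hs2⟩ := ext _ isProj_snd
  obtain ⟨c, hc, hi1, hi2, rfl, rfl⟩ := pair_arc hc1 hc2
  have hci : ∀ π, IsProj π → InjOn π c := by
    rintro π (rfl | rfl)
    exacts [hi1, hi2]
  have hcs : ∀ π, IsProj π → π '' c \ {π e, π q} ⊆ ins (π '' Γ) \ π '' F := by
    rintro π (rfl | rfl)
    exacts [hs1, hs2]
  have hqF : ∀ π, IsProj π → π q ∉ π '' F := by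
    rintro π hπ h
    exact (hFJ π hπ ⟨h, fun h' => hpq (hΓ.inj hπ hq hp h').symm⟩).1 ⟨q, hq, rfl⟩
  -- the projections of F and c meet only at the tip
  have hmeet : ∀ π, IsProj π → ∀ x ∈ F, ∀ y ∈ c, π x = π y → x = e ∧ y = e := by
    intro π hπ x hx y hy hxy
    have : π y = π e := by
      by_contra hne
      have hyq : π y ≠ π q := fun h => hqF π hπ ⟨x, hx, hxy.trans h⟩
      exact (hcs π hπ ⟨⟨y, hy, rfl⟩, by simp [hne, hyq]⟩).2 ⟨x, hx, hxy⟩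
    exact ⟨hFi π hπ hx hF.right_mem (hxy.trans this), hci π hπ hy hc.left_mem this⟩
  have hFc : F ∩ c = {e} := by
    apply Subset.antisymm
    · rintro x ⟨hx, hx'⟩
      exact (hmeet _ isProj_fst x hx x hx' rfl).1
    · rintro _ rfl; exact ⟨hF.right_mem, hc.left_mem⟩
  have hd := hF.trans hc hFc
  obtain ⟨A, B, hA, hB, rfl, hAB⟩ := hΓ.jord.split hp hq hpq
  have hsub := cut_pair hA hB hd hAB (fun π hπ => hΓ.inj hπ) ?_ ?_
  · obtain ⟨R, hRc, hRs, hR⟩ := glue_sub hsub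
    refine ⟨R, hRc, ?_, hR⟩
    refine Subset.trans ?_ hRs
    rintro x ((hx | hx) | hx)
    · exact ⟨_, Or.inl rfl, Or.inl hx⟩
    · exact ⟨_, Or.inr rfl, Or.inl hx⟩
    · exact ⟨_, Or.inl rfl, Or.inr (Or.inl hx)⟩
  · rintro π hπ x (hx | hx) y (hy | hy) hxy
    · exact hFi π hπ hx hy hxy
    · obtain ⟨h1, h2⟩ := hmeet π hπ x hx y hy hxy
      rw [h1, h2]
    · obtain ⟨h1, h2⟩ := hmeet π hπ y hy x hx hxy.symm
      rw [h1, h2]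
    · exact hci π hπ hx hy hxy
  · rintro π hπ _ ⟨⟨x, hx | hx, rfl⟩, hn⟩
    · exact hFJ π hπ ⟨⟨x, hx, rfl⟩, fun h => hn (Or.inl h)⟩
    · by_cases h : π x = π e
      · rw [h]
        exact hFJ π hπ ⟨⟨e, hF.right_mem, rfl⟩, fun h' => hF.ne (hFi π hπ hF.left_mem hF.right_mem h'.symm)⟩
      · refine (hcs π hπ ⟨⟨x, hx, rfl⟩, ?_⟩).1
        rintro (h' | h')
        · exact h h'
        · exact hn (Or.inr h')

lemma flip_one {J : Set ℂ} (hJ : IsJordan J) : ∃ (I : OnePoint ℂ ≃ₜ OnePoint ℂ) (f : ℂ → ℂ),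
    ContinuousOn f J ∧ InjOn f J ∧ (∀ z ∈ J, co (f z) = I (co z)) ∧
    I.symm '' (co '' dsk (f '' J)) = (co '' ins J)ᶜ := by
  obtain ⟨a, ha⟩ := hJ.ins_nonempty
  obtain ⟨I, hI⟩ := exists_move (co a)
  have hne : ∀ z ∈ J, I (co z) ≠ OnePoint.infty := by
    intro z hz h
    rw [← hI] at h
    exact ha.1 (co_inj (I.injective h) ▸ hz)
  have hf : ∀ z ∈ J, co (unc (I (co z))) = I (co z) := fun z hz => co_unc (hne z hz)
  have hc : ContinuousOn (fun z => unc (I (co z))) J :=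
    continuousOn_unc.comp (I.continuous.comp continuous_co).continuousOn hne
  have hi : InjOn (fun z => unc (I (co z))) J := by
    intro z hz w hw h
    have : co (unc (I (co z))) = co (unc (I (co w))) := congrArg co h
    rw [hf z hz, hf w hw] at this
    exact co_inj (I.injective this)
  refine ⟨I, fun z => unc (I (co z)), hc, hi, hf, ?_⟩
  have hT : I '' (co '' J) = co '' ((fun z => unc (I (co z))) '' J) := by
    rw [image_image, image_image]
    exact image_congr fun z hz => (hf z hz).symm
  have hsw := swapS hJ (hJ.image hc hi) I hT ha hI
  have hinv : ∀ S : Set (OnePoint ℂ), I.symm '' (I '' S) = S := by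
    intro S
    rw [image_image]
    simp only [Homeomorph.symm_apply_apply, image_id']
  rw [dsk, image_union, image_union, ← hT, ← hsw, hinv, hinv]
  ext x
  rw [← compl_dsk, dsk, image_union]
  have d1 : Disjoint (co '' ins J) (co '' J) := by
    rw [disjoint_image_iff co_inj, disjoint_left]; exact fun x hx => hx.1
  have := fun h => (disjoint_left.1 d1 : ∀ ⦃a⦄, _) (a := x) h
  simp only [mem_union, mem_compl_iff]
  tauto

lemma planar_out {Γ : Set (ℂ × ℂ)} (hΓ : CP Γ) : ∃ R : Set (OnePoint ℂ × OnePoint ℂ), IsCompact R ∧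
    Prod.map co co '' Γ ⊆ R ∧
    (Prod.fst '' R = (co '' ins (Prod.fst '' Γ))ᶜ ∧ InjOn Prod.fst R) ∧
    (Prod.snd '' R = (co '' ins (Prod.snd '' Γ))ᶜ ∧ InjOn Prod.snd R) := by
  obtain ⟨I1, f1, hc1, hi1, he1, hs1⟩ := flip_one (hΓ.jordan isProj_fst)
  obtain ⟨I2, f2, hc2, hi2, he2, hs2⟩ := flip_one (hΓ.jordan isProj_snd)
  have m1 : ∀ x ∈ Γ, x.1 ∈ Prod.fst '' Γ := fun x hx => ⟨x, hx, rfl⟩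
  have m2 : ∀ x ∈ Γ, x.2 ∈ Prod.snd '' Γ := fun x hx => ⟨x, hx, rfl⟩
  have hφc : ContinuousOn (Prod.map f1 f2) Γ :=
    (hc1.comp continuousOn_fst m1).prodMk (hc2.comp continuousOn_snd m2)
  have j1 : ∀ x ∈ Γ, ∀ y ∈ Γ, f1 x.1 = f1 y.1 → x = y := fun x hx y hy h =>
    hΓ.inj1 hx hy (hi1 (m1 x hx) (m1 y hy) h)
  have j2 : ∀ x ∈ Γ, ∀ y ∈ Γ, f2 x.2 = f2 y.2 → x = y := fun x hx y hy h =>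
    hΓ.inj2 hx hy (hi2 (m2 x hx) (m2 y hy) h)
  have hΓ' : CP (Prod.map f1 f2 '' Γ) := by
    refine ⟨hΓ.jord.image hφc ?_, ?_, ?_⟩
    · intro x hx y hy h
      exact j1 x hx y hy (congrArg Prod.fst h)
    · rintro _ ⟨x, hx, rfl⟩ _ ⟨y, hy, rfl⟩ h
      rw [j1 x hx y hy h]
    · rintro _ ⟨x, hx, rfl⟩ _ ⟨y, hy, rfl⟩ h
      rw [j2 x hx y hy h]
  have e1 : Prod.fst '' (Prod.map f1 f2 '' Γ) = f1 '' (Prod.fst '' Γ) := by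
    rw [image_image, image_image]; rfl
  have e2 : Prod.snd '' (Prod.map f1 f2 '' Γ) = f2 '' (Prod.snd '' Γ) := by
    rw [image_image, image_image]; rfl
  obtain ⟨R, hRc, hRs, hR⟩ := schoenflies hΓ'
  obtain ⟨r1, r1i⟩ := hR _ isProj_fst
  obtain ⟨r2, r2i⟩ := hR _ isProj_snd
  rw [e1] at r1
  rw [e2] at r2
  refine ⟨(fun z : ℂ × ℂ => (I1.symm (co z.1), I2.symm (co z.2))) '' R, ?_, ?_, ⟨?_, ?_⟩, ?_, ?_⟩
  · refine hRc.image ?_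
    exact (I1.symm.continuous.comp (continuous_co.comp continuous_fst)).prodMk
      (I2.symm.continuous.comp (continuous_co.comp continuous_snd))
  · rintro _ ⟨x, hx, rfl⟩
    refine ⟨Prod.map f1 f2 x, hRs ⟨x, hx, rfl⟩, ?_⟩
    show (I1.symm (co (f1 x.1)), I2.symm (co (f2 x.2))) = (co x.1, co x.2)
    rw [he1 _ (m1 x hx), he2 _ (m2 x hx), I1.symm_apply_apply, I2.symm_apply_apply]
  · rw [← hs1, ← r1, image_image, image_image, image_image]
  · rintro _ ⟨x, hx, rfl⟩ _ ⟨y, hy, rfl⟩ h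
    rw [r1i hx hy (co_inj (I1.symm.injective h))]
  · rw [← hs2, ← r2, image_image, image_image, image_image]
  · rintro _ ⟨x, hx, rfl⟩ _ ⟨y, hy, rfl⟩ h
    rw [r2i hx hy (co_inj (I2.symm.injective h))]

lemma glue_side {X Y : Type*} {f : X → Y} {A B G : Set X} {U V : Set Y} (hA : f '' A = U)
    (hB : f '' B = V) (hAi : InjOn f A) (hBi : InjOn f B) (hGA : G ⊆ A) (hGB : G ⊆ B)
    (hUV : U ∩ V ⊆ f '' G) (hcov : U ∪ V = univ) : f '' (A ∪ B) = univ ∧ InjOn f (A ∪ B) := by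
  have key : ∀ x ∈ A, ∀ y ∈ B, f x = f y → x = y := by
    intro x hx y hy h
    obtain ⟨w, hw, he⟩ := hUV ⟨hA.subset ⟨x, hx, rfl⟩, hB.subset ⟨y, hy, h.symm⟩⟩
    rw [← hAi (hGA hw) hx he, ← hBi (hGB hw) hy (he.trans h)]
  constructor
  · rw [image_union, hA, hB, hcov]
  · rintro x (hx | hx) y (hy | hy) h
    · exact hAi hx hy h
    · exact key x hx y hy h
    · exact (key y hy x hx h.symm).symm
    · exact hBi hx hy h

lemma planar_main {Γ F : Set (ℂ × ℂ)} {p e : ℂ × ℂ} (hΓ : CP Γ) (hF : IsArc F p e)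
    (hFi : ∀ π, IsProj π → InjOn π F) (hp : p ∈ Γ)
    (hFJ : ∀ π, IsProj π → π '' F \ {π p} ⊆ ins (π '' Γ)) :
    ∃ R : Set (OnePoint ℂ × OnePoint ℂ), IsCompact R ∧ Prod.map co co '' (Γ ∪ F) ⊆ R ∧
    (Prod.fst '' R = univ ∧ InjOn Prod.fst R) ∧ (Prod.snd '' R = univ ∧ InjOn Prod.snd R) := by
  obtain ⟨R, hRc, hRs, hR⟩ := planar_in hΓ hF hFi hp hFJ
  obtain ⟨R', hRc', hRs', ⟨h1, h1i⟩, h2, h2i⟩ := planar_out hΓ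
  have aux : ∀ J : Set ℂ, co '' dsk J ∩ (co '' ins J)ᶜ ⊆ co '' J ∧ co '' dsk J ∪ (co '' ins J)ᶜ = univ := by
    intro J
    constructor
    · rintro _ ⟨⟨z, hz | hz, rfl⟩, hn⟩
      · exact ⟨z, hz, rfl⟩
      · exact absurd ⟨z, hz, rfl⟩ hn
    · rw [dsk, image_union, union_assoc, union_compl_self, union_univ]
  refine ⟨Prod.map co co '' R ∪ R', (hRc.image (continuous_co.prodMap continuous_co)).union hRc', ?_, ?_, ?_⟩
  · exact (image_mono hRs).trans subset_union_left
  · obtain ⟨r, ri⟩ := hR _ isProj_fst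
    refine glue_side (G := Prod.map co co '' Γ) (U := co '' dsk (Prod.fst '' Γ)) ?_ h1 ?_ h1i
      (image_mono (subset_union_left.trans hRs)) hRs' ((aux _).1.trans ?_) (aux _).2
    · rw [← r, image_image, image_image]; rfl
    · rintro _ ⟨x, hx, rfl⟩ _ ⟨y, hy, rfl⟩ h
      rw [ri hx hy (co_inj h)]
    · rw [image_image, image_image]; exact subset_rfl
  · obtain ⟨r, ri⟩ := hR _ isProj_snd
    refine glue_side (G := Prod.map co co '' Γ) (U := co '' dsk (Prod.snd '' Γ)) ?_ h2 ?_ h2i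
      (image_mono (subset_union_left.trans hRs)) hRs' ((aux _).1.trans ?_) (aux _).2
    · rw [← r, image_image, image_image]; rfl
    · rintro _ ⟨x, hx, rfl⟩ _ ⟨y, hy, rfl⟩ h
      rw [ri hx hy (co_inj h)]
    · rw [image_image, image_image]; exact subset_rfl

lemma graph_homeo {X : Type*} [TopologicalSpace X] [T2Space X] {R : Set (X × X)} (hR : IsCompact R)
    (h1 : Prod.fst '' R = univ) (i1 : InjOn Prod.fst R) (h2 : Prod.snd '' R = univ)
    (i2 : InjOn Prod.snd R) : ∃ H : X ≃ₜ X, ∀ x ∈ R, H x.1 = x.2 := by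
  haveI : CompactSpace R := isCompact_iff_compactSpace.1 hR
  have b1 : Function.Bijective (fun r : R => r.1.1) := by
    refine ⟨fun r s h => Subtype.ext (i1 r.2 s.2 h), fun x => ?_⟩
    obtain ⟨r, hr, he⟩ := h1.symm.subset (mem_univ x)
    exact ⟨⟨r, hr⟩, he⟩
  have b2 : Function.Bijective (fun r : R => r.1.2) := by
    refine ⟨fun r s h => Subtype.ext (i2 r.2 s.2 h), fun x => ?_⟩
    obtain ⟨r, hr, he⟩ := h2.symm.subset (mem_univ x)
    exact ⟨⟨r, hr⟩, he⟩
  have c1 : Continuous (Equiv.ofBijective _ b1) := continuous_fst.comp continuous_subtype_val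
  have c2 : Continuous (Equiv.ofBijective _ b2) := continuous_snd.comp continuous_subtype_val
  refine ⟨(c1.homeoOfEquivCompactToT2).symm.trans c2.homeoOfEquivCompactToT2, fun x hx => ?_⟩
  have e1 : (c1.homeoOfEquivCompactToT2).symm x.1 = ⟨x, hx⟩ := by
    rw [Homeomorph.symm_apply_eq]; rfl
  show c2.homeoOfEquivCompactToT2 ((c1.homeoOfEquivCompactToT2).symm x.1) = x.2
  rw [e1]; rfl

/-- One side of the reduction to the plane. -/
lemma side_plane {X : Type*} [TopologicalSpace X] {C E : Set X} {p e : X} (hC : IsJordan C)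
    (hE : IsArc E p e) (hCE : C ∩ E = {p}) {f : X → OnePoint ℂ} (hf : Continuous f)
    (hfi : InjOn f (C ∪ E)) : ∃ (T : OnePoint ℂ ≃ₜ OnePoint ℂ) (g : X → ℂ), ContinuousOn g (C ∪ E) ∧
      InjOn g (C ∪ E) ∧ (∀ x ∈ C ∪ E, co (g x) = T (f x)) ∧ g '' (E \ {p}) ⊆ ins (g '' C) := by
  have hC' := hC.image hf.continuousOn (hfi.mono subset_union_left)
  have hE' := hE.image hf.continuousOn (hfi.mono subset_union_right)
  have hCE' : f '' C ∩ f '' E = {f p} := by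
    rw [← hfi.image_inter subset_union_left subset_union_right, hCE, image_singleton]
  obtain ⟨T, hT1, hT2⟩ := place hC' hE' hCE'
  have hne : ∀ x ∈ C ∪ E, T (f x) ≠ OnePoint.infty := by
    intro x hx h
    rw [← image_union] at hT1
    exact hT1 ⟨f x, ⟨x, hx, rfl⟩, h⟩
  have hg : ∀ x ∈ C ∪ E, co (unc (T (f x))) = T (f x) := fun x hx => co_unc (hne x hx)
  refine ⟨T, fun x => unc (T (f x)), continuousOn_unc.comp (T.continuous.comp hf).continuousOn hne, ?_, hg, ?_⟩
  · intro x hx y hy h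
    have h' : co (unc (T (f x))) = co (unc (T (f y))) := congrArg co h
    rw [hg x hx, hg y hy] at h'
    exact hfi hx hy (T.injective h')
  · rintro _ ⟨x, ⟨hx, hxp⟩, rfl⟩
    have hpE : p ∈ C ∪ E := Or.inr hE.left_mem
    have h1 : T (f x) ∈ T '' (f '' E \ {f p}) :=
      ⟨f x, ⟨⟨x, hx, rfl⟩, fun h => hxp (hfi (Or.inr hx) hpE h)⟩, rfl⟩
    have h2 := hT2 h1
    rw [← hg x (Or.inr hx), co_inj.mem_set_image, image_image, image_image] at h2
    exact h2

lemma core {C E : Set (OnePoint ℂ × OnePoint ℂ)} {p e : OnePoint ℂ × OnePoint ℂ} (hC : IsJordan C)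
    (hE : IsArc E p e) (hCE : C ∩ E = {p}) (i1 : InjOn Prod.fst (C ∪ E)) (i2 : InjOn Prod.snd (C ∪ E)) :
    ∃ H : OnePoint ℂ ≃ₜ OnePoint ℂ, ∀ x ∈ C ∪ E, H x.1 = x.2 := by
  obtain ⟨T1, g1, c1, j1, e1, s1⟩ := side_plane hC hE hCE continuous_fst i1
  obtain ⟨T2, g2, c2, j2, e2, s2⟩ := side_plane hC hE hCE continuous_snd i2
  set φ : OnePoint ℂ × OnePoint ℂ → ℂ × ℂ := fun x => (g1 x, g2 x) with hφ
  have cφ : ContinuousOn φ (C ∪ E) := c1.prodMk c2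
  have jφ : InjOn φ (C ∪ E) := fun x hx y hy h => j1 hx hy (congrArg Prod.fst h)
  have hp : p ∈ C := (hCE.symm.subset rfl : p ∈ C ∩ E).1
  have hΓ : CP (φ '' C) := by
    refine ⟨hC.image (cφ.mono subset_union_left) (jφ.mono subset_union_left), ?_, ?_⟩
    · rintro _ ⟨x, hx, rfl⟩ _ ⟨y, hy, rfl⟩ h
      rw [j1 (Or.inl hx) (Or.inl hy) h]
    · rintro _ ⟨x, hx, rfl⟩ _ ⟨y, hy, rfl⟩ h
      rw [j2 (Or.inl hx) (Or.inl hy) h]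
  have hF := hE.image (cφ.mono subset_union_right) (jφ.mono subset_union_right)
  have hmain := planar_main hΓ hF ?_ ⟨p, hp, rfl⟩ ?_
  · obtain ⟨R, hRc, hRs, ⟨r1, ri1⟩, r2, ri2⟩ := hmain
    obtain ⟨H, hH⟩ := graph_homeo hRc r1 ri1 r2 ri2
    refine ⟨(T1.trans H).trans T2.symm, fun x hx => ?_⟩
    have hx' : (co (g1 x), co (g2 x)) ∈ R := by
      refine hRs ⟨φ x, ?_, rfl⟩
      rw [← image_union]; exact ⟨x, hx, rfl⟩
    have := hH _ hx'
    show T2.symm (H (T1 x.1)) = x.2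
    rw [Homeomorph.symm_apply_eq, ← e1 x hx, ← e2 x hx]
    exact this
  · rintro π (rfl | rfl)
    · rintro _ ⟨x, hx, rfl⟩ _ ⟨y, hy, rfl⟩ h
      rw [j1 (Or.inr hx) (Or.inr hy) h]
    · rintro _ ⟨x, hx, rfl⟩ _ ⟨y, hy, rfl⟩ h
      rw [j2 (Or.inr hx) (Or.inr hy) h]
  · rintro π (rfl | rfl)
    · rintro _ ⟨⟨_, ⟨x, hx, rfl⟩, rfl⟩, hn⟩
      have := s1 ⟨x, ⟨hx, fun h => hn (by rw [h]; rfl)⟩, rfl⟩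
      rw [image_image]; exact this
    · rintro _ ⟨⟨_, ⟨x, hx, rfl⟩, rfl⟩, hn⟩
      have := s2 ⟨x, ⟨hx, fun h => hn (by rw [h]; rfl)⟩, rfl⟩
      rw [image_image]; exact this

lemma mem_square {x : ℝ × ℝ} : x ∈ Metric.sphere ((0 : ℝ), (0 : ℝ)) 1 ↔ max |x.1| |x.2| = 1 := by
  rw [mem_sphere, Prod.dist_eq, Real.dist_eq, Real.dist_eq, sub_zero, sub_zero]

lemma max_pos_aux (t : ℝ) : 0 < max |Real.cos t| |Real.sin t| := by
  by_contra h
  have h1 := (le_max_left |Real.cos t| |Real.sin t|).trans (not_lt.1 h)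
  have h2 := (le_max_right |Real.cos t| |Real.sin t|).trans (not_lt.1 h)
  have := Real.sin_sq_add_cos_sq t
  rw [abs_nonpos_iff.1 h1, abs_nonpos_iff.1 h2] at this
  norm_num at this

lemma isJordan_square : IsJordan (Metric.sphere ((0 : ℝ), (0 : ℝ)) 1) := by
  set m : ℝ → ℝ := fun t => max |Real.cos t| |Real.sin t| with hm
  have hmp : ∀ t, 0 < m t := max_pos_aux
  have hmc : Continuous m := Real.continuous_cos.abs.max Real.continuous_sin.abs
  set γ : ℝ → ℝ × ℝ := fun t => (Real.cos (2 * Real.pi * t) / m (2 * Real.pi * t),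
    Real.sin (2 * Real.pi * t) / m (2 * Real.pi * t)) with hγ
  have hpi := Real.pi_pos
  refine ⟨γ, ?_, ?_, ?_, ?_⟩
  · refine Continuous.prodMk ?_ ?_
    · exact (Real.continuous_cos.comp (by fun_prop)).div (hmc.comp (by fun_prop)) (fun t => (hmp _).ne')
    · exact (Real.continuous_sin.comp (by fun_prop)).div (hmc.comp (by fun_prop)) (fun t => (hmp _).ne')
  · intro t
    simp only [hγ, hm, mul_add, mul_one, Real.cos_add_two_pi, Real.sin_add_two_pi]
  · intro s hs t ht h
    obtain ⟨h1, h2⟩ := Prod.mk.inj h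
    have ps := hmp (2 * Real.pi * s)
    have pt := hmp (2 * Real.pi * t)
    have q1 := Real.sin_sq_add_cos_sq (2 * Real.pi * s)
    have q2 := Real.sin_sq_add_cos_sq (2 * Real.pi * t)
    rw [div_eq_div_iff ps.ne' pt.ne'] at h1 h2
    have hmm : m (2 * Real.pi * s) = m (2 * Real.pi * t) := by
      have : m (2 * Real.pi * s) ^ 2 = m (2 * Real.pi * t) ^ 2 := by
        calc m (2 * Real.pi * s) ^ 2 = (Real.sin (2 * Real.pi * t) * m (2 * Real.pi * s)) ^ 2 +
              (Real.cos (2 * Real.pi * t) * m (2 * Real.pi * s)) ^ 2 := by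
                rw [mul_pow, mul_pow, ← add_mul, q2, one_mul]
          _ = m (2 * Real.pi * t) ^ 2 := by
                rw [← h1, ← h2, mul_pow, mul_pow, ← add_mul, q1, one_mul]
      exact (pow_left_inj₀ ps.le pt.le two_ne_zero).1 this
    rw [hmm] at h1 h2
    have h1' := mul_right_cancel₀ pt.ne' h1
    have h2' := mul_right_cancel₀ pt.ne' h2
    obtain ⟨k, hk⟩ := Real.Angle.angle_eq_iff_two_pi_dvd_sub.1 (Real.Angle.cos_sin_inj h1' h2')
    have hk' : s - t = k := by
      have : 2 * Real.pi * (s - t) = 2 * Real.pi * k := by rw [← hk]; ring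
      exact mul_left_cancel₀ (by positivity) this
    have k1 : (k : ℝ) < 1 := by rw [← hk']; linarith [hs.2, ht.1]
    have k2 : (-1 : ℝ) < k := by rw [← hk']; linarith [hs.1, ht.2]
    have k3 : k < 1 := by exact_mod_cast k1
    have k4 : -1 < k := by exact_mod_cast k2
    have : k = 0 := by omega
    rw [this] at hk'
    simp at hk'
    linarith
  · ext x
    rw [mem_square]
    constructor
    · rintro ⟨t, rfl⟩
      have ps := hmp (2 * Real.pi * t)
      simp only [hγ]
      rw [abs_div, abs_div, abs_of_pos ps, max_div_div_right ps.le]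
      exact div_self ps.ne'
    · intro hx
      set z : ℂ := ⟨x.1, x.2⟩ with hz
      have hz0 : z ≠ 0 := by
        intro h
        have a1 : x.1 = 0 := congrArg Complex.re h
        have a2 : x.2 = 0 := congrArg Complex.im h
        rw [a1, a2] at hx
        simp at hx
      have hn : 0 < ‖z‖ := norm_pos_iff.2 hz0
      refine ⟨z.arg / (2 * Real.pi), ?_⟩
      have ht : 2 * Real.pi * (z.arg / (2 * Real.pi)) = z.arg := by field_simp
      have hc : Real.cos z.arg = x.1 / ‖z‖ := Complex.cos_arg hz0
      have hs : Real.sin z.arg = x.2 / ‖z‖ := Complex.sin_arg z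
      have hmz : m z.arg = 1 / ‖z‖ := by
        simp only [hm]
        rw [hc, hs, abs_div, abs_div, abs_of_pos hn, max_div_div_right hn.le, hx]
      simp only [hγ]
      rw [ht, hc, hs, hmz]
      ext
      · simp only; field_simp
      · simp only; field_simp

lemma isArc_tail : IsArc (Set.Icc (1 : ℝ) 2 ×ˢ ({0} : Set ℝ)) ((1 : ℝ), (0 : ℝ)) (2, 0) := by
  have := isArc_of_Icc (γ := fun t : ℝ => ((t, 0) : ℝ × ℝ)) (one_lt_two) (by fun_prop)
    (fun s _ t _ h => congrArg Prod.fst h)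
  convert this using 1
  ext ⟨a, b⟩
  simp only [mem_prod, mem_singleton_iff, mem_image, Prod.mk.injEq]
  constructor
  · rintro ⟨h, rfl⟩; exact ⟨a, h, rfl, rfl⟩
  · rintro ⟨t, h, rfl, rfl⟩; exact ⟨h, rfl⟩

lemma square_inter_tail : Metric.sphere ((0 : ℝ), (0 : ℝ)) 1 ∩ (Set.Icc (1 : ℝ) 2 ×ˢ ({0} : Set ℝ)) =
    {((1 : ℝ), (0 : ℝ))} := by
  ext ⟨a, b⟩
  rw [mem_inter_iff, mem_square]
  simp only [mem_prod, mem_singleton_iff, Prod.mk.injEq]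
  constructor
  · rintro ⟨h, h1, rfl⟩
    refine ⟨?_, rfl⟩
    rw [abs_zero, max_eq_left (abs_nonneg _), abs_of_nonneg (by linarith [h1.1])] at h
    exact h
  · rintro ⟨rfl, rfl⟩
    simp

lemma final {M : Set (ℝ × ℝ)} (hM : M = Metric.sphere ((0 : ℝ), (0 : ℝ)) 1 ∪ (Set.Icc (1 : ℝ) 2 ×ˢ ({0} : Set ℝ)))
    (G₁ G₂ : Set (OnePoint (ℝ × ℝ))) (h₁ : G₁ ≃ₜ M) (h : G₁ ≃ₜ G₂) :
    ∃ H : OnePoint (ℝ × ℝ) ≃ₜ OnePoint (ℝ × ℝ),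
      ∀ a : G₁, H (a : OnePoint (ℝ × ℝ)) = ((h a : G₂) : OnePoint (ℝ × ℝ)) := by
  classical
  let k : OnePoint (ℝ × ℝ) ≃ₜ OnePoint ℂ := (Complex.equivRealProdCLM.toHomeomorph.symm).onePointCongr
  let g' : M → OnePoint ℂ × OnePoint ℂ := fun x => (k (h₁.symm x : G₁), k (h (h₁.symm x) : G₂))
  have cg' : Continuous g' :=
    (k.continuous.comp (continuous_subtype_val.comp h₁.symm.continuous)).prodMk
      (k.continuous.comp (continuous_subtype_val.comp (h.continuous.comp h₁.symm.continuous)))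
  have i1' : ∀ x y : M, (g' x).1 = (g' y).1 → x = y := fun x y hxy =>
    h₁.symm.injective (Subtype.ext (k.injective hxy))
  have i2' : ∀ x y : M, (g' x).2 = (g' y).2 → x = y := fun x y hxy =>
    h₁.symm.injective (h.injective (Subtype.ext (k.injective hxy)))
  let g : ℝ × ℝ → OnePoint ℂ × OnePoint ℂ := fun x => if hx : x ∈ M then g' ⟨x, hx⟩ else (OnePoint.infty, OnePoint.infty)
  have hg : ∀ x (hx : x ∈ M), g x = g' ⟨x, hx⟩ := fun x hx => dif_pos hx
  have cg : ContinuousOn g M := by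
    rw [continuousOn_iff_continuous_restrict]
    convert cg' using 1
    funext x
    exact hg x.1 x.2
  have i1 : ∀ x ∈ M, ∀ y ∈ M, (g x).1 = (g y).1 → x = y := by
    intro x hx y hy hxy
    rw [hg x hx, hg y hy] at hxy
    exact congrArg Subtype.val (i1' _ _ hxy)
  have i2 : ∀ x ∈ M, ∀ y ∈ M, (g x).2 = (g y).2 → x = y := by
    intro x hx y hy hxy
    rw [hg x hx, hg y hy] at hxy
    exact congrArg Subtype.val (i2' _ _ hxy)
  have ig : InjOn g M := fun x hx y hy hxy => i1 x hx y hy (by rw [hxy])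
  have sC : Metric.sphere ((0 : ℝ), (0 : ℝ)) 1 ⊆ M := by rw [hM]; exact subset_union_left
  have sE : (Set.Icc (1 : ℝ) 2 ×ˢ ({0} : Set ℝ)) ⊆ M := by rw [hM]; exact subset_union_right
  obtain ⟨H, hH⟩ := core (isJordan_square.image (cg.mono sC) (ig.mono sC))
    (isArc_tail.image (cg.mono sE) (ig.mono sE))
    (by rw [← ig.image_inter sC sE, square_inter_tail, image_singleton])
    (by
      rw [← image_union, ← hM]
      rintro _ ⟨x, hx, rfl⟩ _ ⟨y, hy, rfl⟩ hxy
      rw [i1 x hx y hy hxy])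
    (by
      rw [← image_union, ← hM]
      rintro _ ⟨x, hx, rfl⟩ _ ⟨y, hy, rfl⟩ hxy
      rw [i2 x hx y hy hxy])
  rw [← image_union, ← hM] at hH
  refine ⟨(k.trans H).trans k.symm, fun a => ?_⟩
  have h1 := hH (g (h₁ a)) ⟨_, (h₁ a).2, rfl⟩
  have h2 : g (h₁ a) = (k (a : OnePoint (ℝ × ℝ)), k (h a : G₂)) := by
    rw [hg _ (h₁ a).2]
    show (k (h₁.symm (h₁ a) : G₁), k (h (h₁.symm (h₁ a)) : G₂)) = _
    rw [h₁.symm_apply_apply]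
  rw [h2] at h1
  show k.symm (H (k a)) = _
  rw [Homeomorph.symm_apply_eq]
  exact h1

end Sig

/-- Any homeomorphism between two σ-graphs in the sphere `S² = ℝ² ∪ {∞}` extends to a
homeomorphism of the sphere. -/
theorem stmt_5 (G₁ G₂ : Set (OnePoint (ℝ × ℝ)))
    (h₁ : Nonempty (G₁ ≃ₜ sigmaModel)) (h₂ : Nonempty (G₂ ≃ₜ sigmaModel))
    (h : G₁ ≃ₜ G₂) :
    ∃ H : OnePoint (ℝ × ℝ) ≃ₜ OnePoint (ℝ × ℝ),
      ∀ a : G₁, H (a : OnePoint (ℝ × ℝ)) = ((h a : G₂) : OnePoint (ℝ × ℝ)) := by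
  obtain ⟨f⟩ := h₁
  exact Sig.final rfl G₁ G₂ f h
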